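/- Let K ⊂ ℚ̄ be a number field and let w_1, …, w_d be a basis of K as a ℚ-vector space. Then E_K = w_1 E_ℚ ⊕ ⋯ ⊕ w_d E_ℚ; that is, every element ξ of E_K can be written uniquely as ξ = w_1 ξ_1 + ⋯ + w_d ξ_d with ξ_1, …, ξ_d ∈ E_ℚ. -/

import Mathlib

noncomputable section

/-- The derivative `d/dz` of a formal power series over `ℂ`. -/
def psD (f : PowerSeries ℂ) : PowerSeries ℂ :=
  PowerSeries.mk fun n => ((n : ℂ) + 1) * PowerSeries.coeff (n + 1) f

/-- The Mahler operator `σ_q : f(z) ↦ f(z^q)` on formal power series over `ℂ`. -/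
def psSigma (q : ℕ) (f : PowerSeries ℂ) : PowerSeries ℂ :=
  PowerSeries.mk fun n => if q ∣ n then PowerSeries.coeff (n / q) f else 0

/-- The canonical embedding of polynomials into power series. -/
def polyPS : Polynomial ℂ →+* PowerSeries ℂ := Polynomial.coeToPowerSeries.ringHom

/-- The power series `∑ (a n / n!) zⁿ` attached to a sequence `a` of coefficients. -/
def ePS (a : ℕ → ℂ) : PowerSeries ℂ := PowerSeries.mk fun n => a n / (n.factorial : ℂ)

/-- `IsE a` : the power series `∑ (a n / n!) zⁿ` is an E-function: its coefficients are
algebraic, it satisfies a nonzero linear differential equation over `ℚ̄[z]`, and the size of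
the conjugates of the `a n` as well as their common denominators grow at most geometrically. -/
def IsE (a : ℕ → ℂ) : Prop :=
  (∀ n, IsAlgebraic ℚ (a n)) ∧
  (∃ (m : ℕ) (p : ℕ → Polynomial ℂ),
      (∀ i k, IsAlgebraic ℚ ((p i).coeff k)) ∧ (∃ i, i ≤ m ∧ p i ≠ 0) ∧
      ∑ i ∈ Finset.range (m + 1), polyPS (p i) * psD^[i] (ePS a) = 0) ∧
  (∃ C : ℝ, 0 < C ∧ ∃ d : ℕ → ℕ, ∀ n : ℕ, 1 ≤ n →
      1 ≤ d n ∧ (d n : ℝ) ≤ C ^ n ∧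
      (∀ σ : (integralClosure ℚ ℂ) →+* ℂ, ∀ h : a n ∈ integralClosure ℚ ℂ,
        ‖σ ⟨a n, h⟩‖ ≤ C ^ n) ∧
      (∀ i, 1 ≤ i → i ≤ n → IsIntegral ℤ ((d n : ℂ) * a i)))

/-- The value at `α` of the E-function with coefficient sequence `a`
(E-functions are entire, so this series converges for all `α`). -/
def evalE (a : ℕ → ℂ) (α : ℂ) : ℂ := ∑' n : ℕ, a n / (n.factorial : ℂ) * α ^ n

/-- `IsM q f` : the formal power series `f` is an M_q-function, i.e. it has algebraic
coefficients and satisfies a linear `σ_q`-difference equation over `ℚ̄[z]` with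
not-all-zero polynomial coefficients. -/
def IsM (q : ℕ) (f : PowerSeries ℂ) : Prop :=
  (∀ n, IsAlgebraic ℚ (PowerSeries.coeff n f)) ∧
  ∃ (m : ℕ) (p : ℕ → Polynomial ℂ),
    (∀ i k, IsAlgebraic ℚ ((p i).coeff k)) ∧ (∃ i, i ≤ m ∧ p i ≠ 0) ∧
    ∑ i ∈ Finset.range (m + 1), polyPS (p i) * (psSigma q)^[i] f = 0

/-- `MahlerValue f α v` : the meromorphic extension of (the sum of) the power series `f`
to the open unit disk has no pole at `α` and takes the value `v` there. -/
def MahlerValue (f : PowerSeries ℂ) (α v : ℂ) : Prop :=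
  ∃ F : ℂ → ℂ, MeromorphicOn F (Metric.ball (0 : ℂ) 1) ∧
    (∀ᶠ z in nhds (0 : ℂ), HasSum (fun n => PowerSeries.coeff n f * z ^ n) (F z)) ∧
    AnalyticAt ℂ F α ∧ F α = v

/-- The power series `f` converges (hence defines an analytic function) on the open
disk `D(0,R)`. -/
def AnOnBall (f : PowerSeries ℂ) (R : ℝ) : Prop :=
  ∀ z : ℂ, ‖z‖ < R → Summable fun n => PowerSeries.coeff n f * z ^ n

/-- The value at `z` of (the sum of) the power series `f`. -/
def psEval (f : PowerSeries ℂ) (z : ℂ) : ℂ := ∑' n : ℕ, PowerSeries.coeff n f * z ^ n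

/-- `Banal fv α P` : the homogeneous algebraic relation `P` among the values at `α` of the
power series `fv 1, …, fv r` is banal: it is the specialization at `z = α` of some
`Q ∈ ℚ̄[z, X₁, …, X_r]`, homogeneous in `X₁, …, X_r`, with `Q(z, fv 1, …, fv r) = 0`. -/
def Banal {r : ℕ} (fv : Fin r → PowerSeries ℂ) (α : ℂ) (P : MvPolynomial (Fin r) ℂ) : Prop :=
  ∃ Q : MvPolynomial (Fin r) (Polynomial ℂ),
    (∀ v k, IsAlgebraic ℚ ((MvPolynomial.coeff v Q).coeff k)) ∧
    (∃ e, Q.IsHomogeneous e) ∧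
    MvPolynomial.eval₂ polyPS fv Q = 0 ∧
    MvPolynomial.map (Polynomial.evalRingHom α) Q = P

/-- `Eset S` : the set of values at `z = 1` of all E-functions with coefficients in `S`. -/
def Eset (S : Set ℂ) : Set ℂ :=
  {x | ∃ a : ℕ → ℂ, IsE a ∧ (∀ n, a n ∈ S) ∧ x = evalE a 1}

/-- `Mset q α S` : the set of values at `α` of all M_q-functions with coefficients in `S`
having no pole at `α`. -/
def Mset (q : ℕ) (α : ℂ) (S : Set ℂ) : Set ℂ :=
  {x | ∃ f : PowerSeries ℂ, IsM q f ∧ (∀ n, PowerSeries.coeff n f ∈ S) ∧ MahlerValue f α x}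

section

open scoped TensorProduct

/-- If `k` is algebraically closed in `F`, irreducible monic polynomials over `k` stay irreducible
over `F`. -/
theorem irreducible_map_of_algClosedIn {k F : Type*} [Field k] [Field F] [Algebra k F]
    (hk : ∀ x : F, IsAlgebraic k x → x ∈ Set.range (algebraMap k F))
    {p : Polynomial k} (hp : Irreducible p) (hm : p.Monic) :
    Irreducible (p.map (algebraMap k F)) := by
  have hm' : (p.map (algebraMap k F)).Monic := hm.map _
  have h1 : p.map (algebraMap k F) ≠ 1 := by
    intro h
    have : p = 1 := Polynomial.map_injective _ (algebraMap k F).injective (by simpa using h)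
    exact hp.not_isUnit (this ▸ isUnit_one)
  have lift : ∀ g : Polynomial F, g.Monic → g ∣ p.map (algebraMap k F) →
      ∃ g0 : Polynomial k, g0.map (algebraMap k F) = g := by
    intro g hg hd
    have h := integralClosure.mem_lifts_of_monic_of_dvd_map F hm hg hd
    rw [← Polynomial.mem_lifts, Polynomial.lifts_iff_coeff_lifts]
    rw [Polynomial.lifts_iff_coeff_lifts] at h
    intro n
    obtain ⟨y, hy⟩ := h n
    rw [← hy]
    exact hk _ (y.2.isAlgebraic)
  rw [hm'.irreducible_iff_natDegree' ]
  refine ⟨h1, fun f g hf hg hfg => ?_⟩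
  obtain ⟨f0, rfl⟩ := lift f hf ⟨g, hfg.symm⟩
  obtain ⟨g0, rfl⟩ := lift g hg ⟨_, by rw [mul_comm]; exact hfg.symm⟩
  have : f0 * g0 = p := Polynomial.map_injective _ (algebraMap k F).injective (by simpa using hfg)
  have hu := hp.isUnit_or_isUnit this.symm
  intro hmem
  rw [Finset.mem_Ioc, Polynomial.natDegree_map] at hmem
  rcases hu with hu | hu
  · have h0 := Polynomial.natDegree_eq_zero_of_isUnit hu
    have h2 := congrArg Polynomial.natDegree this
    have hne : f0 ≠ 0 := hu.ne_zero
    have hne' : g0 ≠ 0 := by rintro rfl; simp at hmem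
    rw [Polynomial.natDegree_mul hne hne'] at h2
    rw [Polynomial.natDegree_map] at hmem
    omega
  · have h0 := Polynomial.natDegree_eq_zero_of_isUnit hu
    omega

/-- If `k` is algebraically closed in `F`, then `F ⊗ κ` is a domain for every finite separable
extension `κ` of `k`. -/
theorem isDomain_tensor_of_finite {k F κ : Type*} [Field k] [CharZero k] [Field F] [Algebra k F]
    [Field κ] [Algebra k κ] [FiniteDimensional k κ]
    (hk : ∀ x : F, IsAlgebraic k x → x ∈ Set.range (algebraMap k F)) :
    IsDomain (F ⊗[k] κ) := by
  obtain ⟨α, hα⟩ := Field.exists_primitive_element k κ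
  have hisInt : IsIntegral k α := Algebra.IsIntegral.isIntegral α
  have hirr := irreducible_map_of_algClosedIn hk (minpoly.irreducible hisInt) (minpoly.monic hisInt)
  let e0 : κ ≃ₐ[k] AdjoinRoot (minpoly k α) :=
    ((IntermediateField.topEquiv (F := k) (E := κ)).symm.trans
      (IntermediateField.equivOfEq hα.symm)).trans
      (IntermediateField.adjoinRootEquivAdjoin k hisInt).symm
  let e1 : F ⊗[k] κ ≃ₐ[k] F ⊗[k] AdjoinRoot (minpoly k α) :=
    Algebra.TensorProduct.congr AlgEquiv.refl e0
  let q : Polynomial (F ⊗[k] k) :=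
    (minpoly k α).map (Algebra.TensorProduct.includeRight (R := k) (A := F) (B := k)).toRingHom
  have e2 := AdjoinRoot.tensorAlgEquiv (R := k) (T := F) (S := k) (minpoly k α) q rfl
  let e3 : F ⊗[k] k ≃+* F := (Algebra.TensorProduct.rid k k F).toRingEquiv
  have hq : q.map (e3 : F ⊗[k] k →+* F) = (minpoly k α).map (algebraMap k F) := by
    simp only [q, Polynomial.map_map]
    congr 1
    ext x
    simp [e3, Algebra.smul_def]
  have hpr : Prime q := by
    have hh := hirr.prime
    rw [← hq] at hh
    have hinj : Function.Injective (Polynomial.mapRingHom (e3 : F ⊗[k] k →+* F)) :=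
      Polynomial.map_injective _ e3.injective
    have hsymm : ∀ r : Polynomial F, Polynomial.mapRingHom (e3 : F ⊗[k] k →+* F)
        (Polynomial.mapRingHom (e3.symm : F →+* F ⊗[k] k) r) = r := fun r => by
      simp [Polynomial.map_map]
    refine comap_prime (Polynomial.mapRingHom (e3 : F ⊗[k] k →+* F))
      (Polynomial.mapRingHom (e3.symm : F →+* F ⊗[k] k)) (fun a => hinj (hsymm _)) hh
  have hdom : IsDomain (AdjoinRoot q) := AdjoinRoot.isDomain_of_prime hpr
  exact (MulEquiv.isDomain (AdjoinRoot q) (e1.toMulEquiv.trans e2.toMulEquiv))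

/-- If `k` is algebraically closed in `F` (characteristic zero), then `L ⊗ F` has no zero divisors
for every field extension `L` of `k`. -/
theorem noZeroDivisors_tensor_of_algClosedIn {k F L : Type*} [Field k] [CharZero k] [Field F]
    [Algebra k F] [Field L] [Algebra k L]
    (hk : ∀ x : F, IsAlgebraic k x → x ∈ Set.range (algebraMap k F)) :
    NoZeroDivisors (L ⊗[k] F) := by
  classical
  refine ⟨fun {x y} hxy => ?_⟩
  by_contra! hne
  obtain ⟨hx, hy⟩ := hne
  obtain ⟨ι, ⟨b⟩⟩ : ∃ ι : Type _, Nonempty (Module.Basis ι k F) :=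
    ⟨_, ⟨Module.Basis.ofVectorSpace k F⟩⟩
  have key : ∀ z : L ⊗[k] F, z ≠ 0 → ∃ i, (Algebra.TensorProduct.basis L b).repr z i ≠ 0 := by
    intro z hz
    by_contra! h
    exact hz ((Algebra.TensorProduct.basis L b).repr.map_eq_zero_iff.mp (Finsupp.ext h))
  obtain ⟨i, hi⟩ := key x hx
  obtain ⟨j, hj⟩ := key y hy
  set lx := (Algebra.TensorProduct.basis L b).repr x with hlx
  set ly := (Algebra.TensorProduct.basis L b).repr y with hly
  let S : Finset L := lx.support.image lx ∪ ly.support.image ly ∪ {(lx i)⁻¹, (ly j)⁻¹}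
  let A := Algebra.adjoin k (S : Set L)
  have hSA : ∀ s ∈ S, s ∈ A := fun s hs => Algebra.subset_adjoin hs
  have hlxA : ∀ n, lx n ∈ A := by
    intro n
    by_cases h : lx n = 0
    · rw [h]; exact A.zero_mem
    · exact hSA _ (by
        simp only [S, Finset.mem_union, Finset.mem_image]
        left; left; exact ⟨n, by simpa using h, rfl⟩)
  have hlyA : ∀ n, ly n ∈ A := by
    intro n
    by_cases h : ly n = 0
    · rw [h]; exact A.zero_mem
    · exact hSA _ (by
        simp only [S, Finset.mem_union, Finset.mem_image]
        left; right; exact ⟨n, by simpa using h, rfl⟩)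
  have hix : (lx i)⁻¹ ∈ A := hSA _ (by simp [S])
  have hjy : (ly j)⁻¹ ∈ A := hSA _ (by simp [S])
  have hft : Algebra.FiniteType k A := (Subalgebra.fg_iff_finiteType A).mp ⟨S, rfl⟩
  obtain ⟨m, hm⟩ := Ideal.exists_maximal A
  let : Field (A ⧸ m) := Ideal.Quotient.field m
  have : Algebra.FiniteType k (A ⧸ m) := inferInstance
  have : Module.Finite k (A ⧸ m) := finite_of_finite_type_of_isJacobsonRing k (A ⧸ m)
  have : IsDomain ((A ⧸ m) ⊗[k] F) := by
    have := isDomain_tensor_of_finite (κ := A ⧸ m) hk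
    exact MulEquiv.isDomain (F ⊗[k] (A ⧸ m)) (Algebra.TensorProduct.comm k (A ⧸ m) F).toMulEquiv
  let φ : A ⊗[k] F →ₐ[k] L ⊗[k] F := Algebra.TensorProduct.map A.val (AlgHom.id k F)
  let ψ : A ⊗[k] F →ₐ[k] (A ⧸ m) ⊗[k] F :=
    Algebra.TensorProduct.map (Ideal.Quotient.mkₐ k m) (AlgHom.id k F)
  have hφ : Function.Injective φ :=
    Module.Flat.rTensor_preserves_injective_linearMap (M := F) A.val.toLinearMap
      Subtype.val_injective
  let lift : ∀ l : ι →₀ L, (∀ n, l n ∈ A) → A ⊗[k] F :=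
    fun l hl => ∑ n ∈ l.support, (⟨l n, hl n⟩ : A) ⊗ₜ[k] b n
  have hlift : ∀ l hl, φ (lift l hl) = (Algebra.TensorProduct.basis L b).repr.symm l := by
    intro l hl
    apply (Algebra.TensorProduct.basis L b).repr.injective
    simp only [lift, φ, map_sum, LinearEquiv.apply_symm_apply, Algebra.TensorProduct.map_tmul]
    ext n
    simp [Algebra.TensorProduct.basis_repr_tmul, Finsupp.single_apply]
    intro h; exact h.symm
  have hlift' : ∀ l hl n, (Algebra.TensorProduct.basis (A ⧸ m) b).repr (ψ (lift l hl)) n =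
      Ideal.Quotient.mk m ⟨l n, hl n⟩ := by
    intro l hl n
    simp only [lift, ψ, map_sum, Algebra.TensorProduct.map_tmul]
    simp [Algebra.TensorProduct.basis_repr_tmul, Finsupp.single_apply]
    intro h
    have : (⟨l n, hl n⟩ : A) = 0 := Subtype.ext h
    rw [this, map_zero]
  have hprod : lift lx hlxA * lift ly hlyA = 0 := by
    apply hφ
    rw [map_mul, hlift, hlift, map_zero, hlx, hly, LinearEquiv.symm_apply_apply,
      LinearEquiv.symm_apply_apply, hxy]
  have hprod' : ψ (lift lx hlxA) * ψ (lift ly hlyA) = 0 := by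
    rw [← map_mul, hprod, map_zero]
  have unit : ∀ (u : L) (hu : u ∈ A) (hu' : u⁻¹ ∈ A), u ≠ 0 →
      Ideal.Quotient.mk m ⟨u, hu⟩ ≠ 0 := by
    intro u hu hu' h0 h
    have h1 : Ideal.Quotient.mk m ((⟨u, hu⟩ : A) * ⟨u⁻¹, hu'⟩) = 0 := by rw [map_mul, h, zero_mul]
    have h2 : ((⟨u, hu⟩ : A) * ⟨u⁻¹, hu'⟩) = 1 := Subtype.ext (mul_inv_cancel₀ h0)
    rw [h2, map_one] at h1
    exact one_ne_zero h1
  rcases mul_eq_zero.mp hprod' with h | h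
  · exact unit _ (hlxA i) hix hi (by rw [← hlift', h, map_zero, Finsupp.zero_apply])
  · exact unit _ (hlyA j) hjy hj (by rw [← hlift', h, map_zero, Finsupp.zero_apply])

/-- Let `τ : F → Ω` be a morphism of extensions of `k` and `𝕂` a field between `k` and `Ω` such that
`τ` preserves linear independence when passing from `k` to `𝕂`.  If `k` is algebraically closed in
`F`, then `𝕂` can be replaced by any field `L` algebraic over `𝕂`. -/
theorem linearIndependent_of_algebraic_extension {k F 𝕂 Ω : Type} [Field k] [CharZero k] [Field F]
    [Field 𝕂] [Field Ω] [Algebra k F] [Algebra k 𝕂] [Algebra 𝕂 Ω] [Algebra k Ω]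
    [IsScalarTower k 𝕂 Ω] (τ : F →ₐ[k] Ω)
    (hk : ∀ x : F, IsAlgebraic k x → x ∈ Set.range (algebraMap k F))
    (hτ : ∀ (ι : Type) [Fintype ι] (y : ι → F), LinearIndependent k y →
      ∀ c : ι → 𝕂, ∑ i, algebraMap 𝕂 Ω (c i) * τ (y i) = 0 → ∀ i, c i = 0)
    (L : IntermediateField 𝕂 Ω) [Algebra.IsAlgebraic 𝕂 L]
    {ι : Type} [Fintype ι] (y : ι → F) (hy : LinearIndependent k y)
    (l : ι → L) (hl : ∑ i, (l i : Ω) * τ (y i) = 0) (i : ι) : l i = 0 := by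
  classical
  have : NoZeroDivisors (L ⊗[k] F) := noZeroDivisors_tensor_of_algClosedIn hk
  have : IsDomain (L ⊗[k] F) := NoZeroDivisors.to_isDomain _
  let Φ : L ⊗[k] F →ₐ[k] Ω := Algebra.TensorProduct.lift
    (L.val.restrictScalars k) τ (fun _ _ => Commute.all _ _)
  have hΦ : ∀ (x : L) (f : F), Φ (x ⊗ₜ f) = (x : Ω) * τ f := fun x f => by
    simp [Φ]
  let α : 𝕂 ⊗[k] F →ₐ[k] L ⊗[k] F :=
    Algebra.TensorProduct.map (IsScalarTower.toAlgHom k 𝕂 L) (AlgHom.id k F)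
  have hinj : ∀ x, Φ (α x) = 0 → x = 0 := by
    intro x hx
    obtain ⟨ι', ⟨b⟩⟩ : ∃ ι : Type, Nonempty (Module.Basis ι k F) :=
      ⟨_, ⟨Module.Basis.ofVectorSpace k F⟩⟩
    let B := Algebra.TensorProduct.basis 𝕂 b
    have hx2 : x = ∑ j ∈ (B.repr x).support, (B.repr x j) ⊗ₜ b j := by
      conv_lhs => rw [← B.linearCombination_repr x, Finsupp.linearCombination_apply, Finsupp.sum]
      refine Finset.sum_congr rfl fun j _ => ?_
      exact Algebra.TensorProduct.basis_repr_symm_apply' b _ _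
    have h3 : ∑ j : (B.repr x).support, algebraMap 𝕂 Ω (B.repr x j) * τ (b j) = 0 := by
      rw [hx2, map_sum, map_sum] at hx
      rw [Finset.sum_coe_sort (B.repr x).support
        (fun j => algebraMap 𝕂 Ω (B.repr x j) * τ (b j)), ← hx]
      refine Finset.sum_congr rfl fun j _ => ?_
      simp only [α, Algebra.TensorProduct.map_tmul, hΦ]
      rfl
    have h4 := hτ _ (fun j : (B.repr x).support => b j)
      (b.linearIndependent.comp _ Subtype.val_injective) _ h3
    have h5 : B.repr x = 0 := by
      ext j
      by_contra hj
      exact hj (h4 ⟨j, by simpa using hj⟩)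
    exact B.repr.map_eq_zero_iff.mp h5
  let _ : Algebra (𝕂 ⊗[k] F) (L ⊗[k] F) := α.toRingHom.toAlgebra
  have hisInt : Algebra.IsIntegral (𝕂 ⊗[k] F) (L ⊗[k] F) := by
    refine ⟨fun x => ?_⟩
    induction x with
    | zero => exact isIntegral_zero
    | add x y hx hy => exact hx.add hy
    | tmul x f =>
      have h1 : x ⊗ₜ[k] f = (x ⊗ₜ[k] (1 : F)) * algebraMap (𝕂 ⊗[k] F) (L ⊗[k] F) (1 ⊗ₜ f) := by
        change _ = (x ⊗ₜ[k] (1 : F)) * α (1 ⊗ₜ f)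
        simp [α]
      rw [h1]
      refine IsIntegral.mul ?_ isIntegral_algebraMap
      have hx : IsIntegral 𝕂 x := (Algebra.IsAlgebraic.isAlgebraic x).isIntegral
      refine hx.map_of_comp_eq (Algebra.TensorProduct.includeLeftRingHom : 𝕂 →+* 𝕂 ⊗[k] F)
        (Algebra.TensorProduct.includeLeftRingHom : L →+* L ⊗[k] F) ?_
      ext c
      change α (c ⊗ₜ 1) = _
      simp [α]
  have hker : RingHom.ker Φ.toRingHom = ⊥ := by
    apply Ideal.eq_bot_of_comap_eq_bot (R := 𝕂 ⊗[k] F)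
    rw [eq_bot_iff]
    intro x hx
    rw [Ideal.mem_comap, RingHom.mem_ker] at hx
    exact hinj x hx
  have hz : ∑ j, (l j) ⊗ₜ[k] y j = 0 := by
    have : ∑ j, (l j) ⊗ₜ[k] y j ∈ RingHom.ker Φ.toRingHom := by
      rw [RingHom.mem_ker]
      change Φ _ = 0
      rw [map_sum]
      simpa only [hΦ] using hl
    rw [hker] at this
    simpa using this
  have hfun : ∃ φ : F →ₗ[k] k, ∀ j, φ (y j) = if j = i then 1 else 0 := by
    let g := (Module.Basis.span hy).constr k (fun j => if j = i then (1 : k) else 0)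
    obtain ⟨φ, hφ⟩ := LinearMap.exists_extend g
    refine ⟨φ, fun j => ?_⟩
    have h1 : φ ((Module.Basis.span hy) j : F) = g ((Module.Basis.span hy) j) := by
      rw [← hφ]; rfl
    rwa [Module.Basis.constr_basis, Module.Basis.span_apply] at h1
  obtain ⟨φ, hφ⟩ := hfun
  let ψ : L ⊗[k] F →ₗ[k] L := TensorProduct.lift (((LinearMap.lsmul k L) ∘ₗ φ).flip)
  have hψ : ∀ (x : L) (f : F), ψ (x ⊗ₜ f) = φ f • x := fun x f => rfl
  have h6 := congrArg ψ hz
  simpa only [map_sum, hψ, hφ, ite_smul, one_smul, zero_smul, Finset.sum_ite_eq',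
    Finset.mem_univ, if_true, map_zero] using h6

end

namespace EFun

open scoped PowerSeries Polynomial Topology

/-- The formal derivative on rational power series. -/
abbrev D (f : ℚ⟦X⟧) : ℚ⟦X⟧ := PowerSeries.derivative ℚ f

theorem coeff_D (f : ℚ⟦X⟧) (n : ℕ) :
    PowerSeries.coeff n (D f) = PowerSeries.coeff (n + 1) f * (n + 1) :=
  PowerSeries.coeff_derivative f n

theorem D_mul (f g : ℚ⟦X⟧) : D (f * g) = D f * g + f * D g := by
  simp only [D, Derivation.leibniz, smul_eq_mul]; ring

/-- Growth witness: the numbers `n! fₙ` have size and common denominators at most `C ^ (n + 1)`. -/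
def GrBy (C : ℕ) (f : ℚ⟦X⟧) : Prop :=
  ∃ d : ℕ → ℕ, ∀ n, 0 < d n ∧ d n ≤ C ^ (n + 1) ∧
    |(n.factorial : ℚ) * PowerSeries.coeff n f| ≤ (C : ℚ) ^ (n + 1) ∧
    ∀ i ≤ n, ∃ z : ℤ, (d n : ℚ) * ((i.factorial : ℚ) * PowerSeries.coeff i f) = z

/-- Power series `∑ aₙ zⁿ / n!` with `aₙ` of at most geometric size and common denominators. -/
def Gr (f : ℚ⟦X⟧) : Prop := ∃ C, GrBy C f

theorem GrBy.mono {C C' : ℕ} (h : C ≤ C') {f : ℚ⟦X⟧} (hf : GrBy C f) : GrBy C' f := by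
  obtain ⟨d, hd⟩ := hf
  refine ⟨d, fun n => ⟨(hd n).1, (hd n).2.1.trans (Nat.pow_le_pow_left h _),
    (hd n).2.2.1.trans ?_, (hd n).2.2.2⟩⟩
  exact_mod_cast Nat.pow_le_pow_left h _

theorem GrBy.pos {C : ℕ} {f : ℚ⟦X⟧} (hf : GrBy C f) : 1 ≤ C := by
  obtain ⟨d, hd⟩ := hf
  by_contra h
  have h0 : C = 0 := by omega
  have := hd 0
  simp only [h0, zero_add, pow_one] at this
  omega

theorem Gr.add {f g : ℚ⟦X⟧} (hf : Gr f) (hg : Gr g) : Gr (f + g) := by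
  obtain ⟨C, hf⟩ := hf
  obtain ⟨C', hg⟩ := hg
  have hC := hf.pos
  have hC' := hg.pos
  replace hf := hf.mono (show C ≤ C * C' by nlinarith)
  replace hg := hg.mono (show C' ≤ C * C' by nlinarith)
  have hE : 1 ≤ C * C' := Nat.mul_pos hC hC'
  generalize C * C' = E at hf hg hE
  obtain ⟨d, hd⟩ := hf
  obtain ⟨d', hd'⟩ := hg
  refine ⟨2 * E * E, fun n => d n * d' n, fun n => ?_⟩
  obtain ⟨h1, h2, h3, h4⟩ := hd n
  obtain ⟨h1', h2', h3', h4'⟩ := hd' n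
  have hE1 : 1 ≤ E ^ (n + 1) := Nat.one_le_pow _ _ hE
  have h2p : 2 ≤ 2 ^ (n + 1) := by
    calc 2 = 2 ^ 1 := rfl
      _ ≤ 2 ^ (n + 1) := Nat.pow_le_pow_right (by norm_num) (by omega)
  refine ⟨Nat.mul_pos h1 h1', ?_, ?_, ?_⟩
  · calc d n * d' n ≤ E ^ (n + 1) * E ^ (n + 1) := Nat.mul_le_mul h2 h2'
      _ = (E * E) ^ (n + 1) := by rw [mul_pow]
      _ ≤ _ := Nat.pow_le_pow_left (by nlinarith) _
  · rw [map_add, mul_add]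
    refine (abs_add_le _ _).trans ((add_le_add h3 h3').trans ?_)
    have : E ^ (n + 1) + E ^ (n + 1) ≤ (2 * E * E) ^ (n + 1) := by
      rw [mul_pow, mul_pow]
      nlinarith [Nat.mul_le_mul h2p (Nat.mul_le_mul hE1 (le_refl (E ^ (n + 1))))]
    exact_mod_cast this
  · intro i hi
    obtain ⟨z, hz⟩ := h4 i hi
    obtain ⟨z', hz'⟩ := h4' i hi
    refine ⟨d' n * z + d n * z', ?_⟩
    push_cast
    rw [← hz, ← hz', map_add]
    ring

theorem Gr.mul {f g : ℚ⟦X⟧} (hf : Gr f) (hg : Gr g) : Gr (f * g) := by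
  obtain ⟨C, hf⟩ := hf
  obtain ⟨C', hg⟩ := hg
  have hC := hf.pos
  have hC' := hg.pos
  replace hf := hf.mono (show C ≤ C * C' by nlinarith)
  replace hg := hg.mono (show C' ≤ C * C' by nlinarith)
  have hE : 1 ≤ C * C' := Nat.mul_pos hC hC'
  generalize C * C' = E at hf hg hE
  obtain ⟨d, hd⟩ := hf
  obtain ⟨d', hd'⟩ := hg
  have key : ∀ n, (n.factorial : ℚ) * PowerSeries.coeff n (f * g) =
      ∑ p ∈ Finset.HasAntidiagonal.antidiagonal n, (n.choose p.1 : ℚ) *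
        ((p.1.factorial * PowerSeries.coeff p.1 f) * (p.2.factorial * PowerSeries.coeff p.2 g)) := by
    intro n
    rw [PowerSeries.coeff_mul, Finset.mul_sum]
    refine Finset.sum_congr rfl fun p hp => ?_
    rw [Finset.HasAntidiagonal.mem_antidiagonal] at hp
    have : (n.choose p.1 * p.1.factorial * p.2.factorial : ℚ) = n.factorial := by
      subst hp
      rw [Nat.choose_symm_add]
      exact_mod_cast Nat.add_choose_mul_factorial_mul_factorial p.1 p.2
    rw [← this]; ring
  refine ⟨2 * E * E, fun n => d n * d' n, fun n => ?_⟩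
  obtain ⟨h1, h2, h3, h4⟩ := hd n
  obtain ⟨h1', h2', h3', h4'⟩ := hd' n
  refine ⟨Nat.mul_pos h1 h1', ?_, ?_, ?_⟩
  · calc d n * d' n ≤ E ^ (n + 1) * E ^ (n + 1) := Nat.mul_le_mul h2 h2'
      _ = (E * E) ^ (n + 1) := by rw [mul_pow]
      _ ≤ _ := Nat.pow_le_pow_left (by nlinarith) _
  · rw [key]
    have hEQ : (1 : ℚ) ≤ E := by exact_mod_cast hE
    calc _ ≤ ∑ p ∈ Finset.HasAntidiagonal.antidiagonal n,
            (n.choose p.1 : ℚ) * (E ^ (n + 1) * E ^ (n + 1)) := by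
          refine (Finset.abs_sum_le_sum_abs _ _).trans (Finset.sum_le_sum fun p hp => ?_)
          rw [Finset.HasAntidiagonal.mem_antidiagonal] at hp
          rw [abs_mul, abs_mul, abs_of_nonneg (Nat.cast_nonneg _)]
          have a1 := (hd p.1).2.2.1.trans (pow_le_pow_right₀ hEQ (show p.1 + 1 ≤ n + 1 by omega))
          have a2 := (hd' p.2).2.2.1.trans (pow_le_pow_right₀ hEQ (show p.2 + 1 ≤ n + 1 by omega))
          gcongr
      _ = 2 ^ n * (E ^ (n + 1) * E ^ (n + 1)) := by
          rw [← Finset.sum_mul, Finset.Nat.sum_antidiagonal_eq_sum_range_succ_mk]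
          congr 1
          exact_mod_cast Nat.sum_range_choose n
      _ ≤ 2 ^ (n + 1) * (E ^ (n + 1) * E ^ (n + 1)) := by
          gcongr
          · norm_num
          · omega
      _ = _ := by push_cast; rw [mul_pow, mul_pow]; ring
  · intro i hi
    rw [key]
    have h5 : ∀ p ∈ Finset.HasAntidiagonal.antidiagonal i, ∃ z : ℤ,
        (↑(d n * d' n) : ℚ) * ((i.choose p.1 : ℚ) *
        ((p.1.factorial * PowerSeries.coeff p.1 f) *
          (p.2.factorial * PowerSeries.coeff p.2 g))) = z := by
      intro p hp
      rw [Finset.HasAntidiagonal.mem_antidiagonal] at hp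
      obtain ⟨z, hz⟩ := h4 p.1 (by omega)
      obtain ⟨z', hz'⟩ := h4' p.2 (by omega)
      refine ⟨i.choose p.1 * z * z', ?_⟩
      push_cast
      rw [← hz, ← hz']
      ring
    rw [Finset.mul_sum]
    choose! z hz using h5
    exact ⟨∑ p ∈ Finset.HasAntidiagonal.antidiagonal i, z p, by
      rw [Finset.sum_congr rfl hz]; push_cast; rfl⟩

theorem Gr.D {f : ℚ⟦X⟧} (hf : Gr f) : Gr (D f) := by
  obtain ⟨C, hf⟩ := hf
  have hC := hf.pos
  obtain ⟨d, hd⟩ := hf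
  have hp : ∀ n, C ^ (n + 1 + 1) ≤ (C * C) ^ (n + 1) := fun n => by
    rw [mul_pow, pow_succ]
    exact Nat.mul_le_mul_left _ (Nat.le_self_pow (by omega) _)
  have hfac : ∀ n, (n.factorial : ℚ) * PowerSeries.coeff n (EFun.D f) =
      ((n + 1).factorial : ℚ) * PowerSeries.coeff (n + 1) f := fun n => by
    rw [coeff_D, Nat.factorial_succ]; push_cast; ring
  refine ⟨C * C, fun n => d (n + 1), fun n => ⟨(hd _).1, (hd _).2.1.trans (hp n), ?_, ?_⟩⟩
  · rw [hfac]
    exact (hd _).2.2.1.trans (by exact_mod_cast hp n)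
  · intro i hi
    rw [hfac]
    exact (hd _).2.2.2 _ (by omega)

theorem Gr.iterate_D {f : ℚ⟦X⟧} (hf : Gr f) (n : ℕ) : Gr (EFun.D^[n] f) := by
  induction n with
  | zero => exact hf
  | succ n ih => rw [Function.iterate_succ_apply']; exact ih.D

theorem gr_of_finite (f : ℚ⟦X⟧) (B : ℕ) (hB : ∀ n, B < n → PowerSeries.coeff n f = 0) : Gr f := by
  classical
  let q : ℕ → ℚ := fun i => (i.factorial : ℚ) * PowerSeries.coeff i f
  let dd : ℕ := ∏ i ∈ Finset.range (B + 1), (q i).den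
  let s : ℕ := ∑ i ∈ Finset.range (B + 1), ⌈|q i|⌉₊
  have hdd : 0 < dd := Finset.prod_pos fun i _ => (q i).den_pos
  have hq0 : ∀ i, B < i → q i = 0 := fun i hi => by simp [q, hB i hi]
  have hs : ∀ i, |q i| ≤ s := by
    intro i
    by_cases hi : i ≤ B
    · refine (Nat.le_ceil _).trans ?_
      exact_mod_cast Finset.single_le_sum (f := fun i => ⌈|q i|⌉₊) (fun _ _ => Nat.zero_le _)
        (Finset.mem_range.mpr (by omega))
    · rw [hq0 i (by omega)]; simp
  have h1 : 1 ≤ dd + s := by omega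
  refine ⟨dd + s, fun _ => dd, fun n => ⟨hdd, ?_, ?_, ?_⟩⟩
  · exact (Nat.le_add_right _ _).trans (Nat.le_self_pow (by omega) _)
  · refine (hs n).trans ?_
    exact_mod_cast (Nat.le_add_left s dd).trans (Nat.le_self_pow (by omega) _)
  · intro i _
    change ∃ z : ℤ, (dd : ℚ) * q i = z
    by_cases hi : i ≤ B
    · obtain ⟨e, he⟩ := Finset.dvd_prod_of_mem (fun i => (q i).den)
        (Finset.mem_range.mpr (show i < B + 1 by omega))
      refine ⟨e * (q i).num, ?_⟩
      rw [show dd = (q i).den * e from he]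
      push_cast
      rw [mul_right_comm, Rat.den_mul_eq_num, mul_comm]
    · exact ⟨0, by rw [hq0 i (by omega)]; simp⟩

theorem gr_coe (P : ℚ[X]) : Gr (P : ℚ⟦X⟧) :=
  gr_of_finite _ P.natDegree fun n hn => by
    rw [Polynomial.coeff_coe]; exact Polynomial.coeff_eq_zero_of_natDegree_lt hn

theorem smul_eq_coe_mul (P : ℚ[X]) (f : ℚ⟦X⟧) : P • f = (P : ℚ⟦X⟧) * f := by
  rw [Algebra.smul_def, PowerSeries.algebraMap_apply']; simp

theorem Gr.smul (P : ℚ[X]) {f : ℚ⟦X⟧} (hf : Gr f) : Gr (P • f) := by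
  rw [smul_eq_coe_mul]; exact (gr_coe P).mul hf

/-- The growth ring as a subalgebra over polynomials. -/
def grAlg : Subalgebra ℚ[X] ℚ⟦X⟧ where
  carrier := {f | Gr f}
  mul_mem' := Gr.mul
  add_mem' := Gr.add
  algebraMap_mem' P := by
    rw [Set.mem_ofPred_eq, PowerSeries.algebraMap_apply']
    simpa using gr_coe P

/-- `f` lies in the finitely generated differential module `M` of series of growth type. -/
def IsEModule (M : Submodule ℚ[X] ℚ⟦X⟧) : Prop :=
  M.FG ∧ (∀ f ∈ M, Gr f) ∧ ∃ T : ℚ[X], T ≠ 0 ∧ ∀ f ∈ M, T • D f ∈ M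

theorem IsEModule.sup {M M' : Submodule ℚ[X] ℚ⟦X⟧} (h : IsEModule M) (h' : IsEModule M') :
    IsEModule (M ⊔ M') := by
  obtain ⟨h1, h2, T, h3, h4⟩ := h
  obtain ⟨h1', h2', T', h3', h4'⟩ := h'
  refine ⟨h1.sup h1', fun f hf => ?_, T * T', mul_ne_zero h3 h3', fun f hf => ?_⟩
  · obtain ⟨a, ha, b, hb, rfl⟩ := Submodule.mem_sup.mp hf
    exact (h2 a ha).add (h2' b hb)
  · obtain ⟨a, ha, b, hb, rfl⟩ := Submodule.mem_sup.mp hf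
    rw [D, map_add, smul_add]
    refine Submodule.add_mem_sup ?_ ?_
    · rw [mul_comm, mul_smul]; exact M.smul_mem _ (h4 a ha)
    · rw [mul_smul]; exact M'.smul_mem _ (h4' b hb)

theorem IsEModule.mul {M M' : Submodule ℚ[X] ℚ⟦X⟧} (h : IsEModule M) (h' : IsEModule M') :
    IsEModule (M * M') := by
  obtain ⟨h1, h2, T, h3, h4⟩ := h
  obtain ⟨h1', h2', T', h3', h4'⟩ := h'
  refine ⟨h1.mul h1', fun f hf => ?_, T * T', mul_ne_zero h3 h3', fun f hf => ?_⟩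
  · exact Submodule.mul_induction_on hf (fun a ha b hb => (h2 a ha).mul (h2' b hb))
      (fun _ _ => Gr.add)
  · refine Submodule.mul_induction_on hf (fun a ha b hb => ?_) (fun a b ha hb => ?_)
    · have : (T * T') • D (a * b) = T' • ((T • D a) * b) + T • (a * (T' • D b)) := by
        rw [D_mul, smul_add]
        simp only [smul_eq_coe_mul, Polynomial.coe_mul]
        ring
      rw [this]
      exact add_mem (Submodule.smul_mem _ _ (Submodule.mul_mem_mul (h4 a ha) hb))
        (Submodule.smul_mem _ _ (Submodule.mul_mem_mul ha (h4' b hb)))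
    · rw [D, map_add, smul_add]; exact add_mem ha hb

theorem isEModule_one : IsEModule (1 : Submodule ℚ[X] ℚ⟦X⟧) := by
  have h : ∀ f ∈ (1 : Submodule ℚ[X] ℚ⟦X⟧), ∃ P : ℚ[X], f = (P : ℚ⟦X⟧) := by
    intro f hf
    obtain ⟨P, rfl⟩ := Submodule.mem_one.mp hf
    exact ⟨P, by rw [PowerSeries.algebraMap_apply']; simp⟩
  refine ⟨by rw [Submodule.one_eq_span]; exact Submodule.fg_span_singleton _,
    fun f hf => ?_, 1, one_ne_zero, fun f hf => ?_⟩
  · obtain ⟨P, rfl⟩ := h f hf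
    exact gr_coe P
  · obtain ⟨P, rfl⟩ := h f hf
    rw [one_smul, D, PowerSeries.derivative_coe]
    exact Submodule.mem_one.mpr ⟨Polynomial.derivative P, by
      rw [PowerSeries.algebraMap_apply']; simp⟩

/-- The ring of rational E-functions. -/
def eAlg : Subalgebra ℚ[X] ℚ⟦X⟧ where
  carrier := {f | ∃ M, IsEModule M ∧ f ∈ M}
  mul_mem' := by
    rintro a b ⟨M, hM, ha⟩ ⟨M', hM', hb⟩
    exact ⟨_, hM.mul hM', Submodule.mul_mem_mul ha hb⟩
  add_mem' := by
    rintro a b ⟨M, hM, ha⟩ ⟨M', hM', hb⟩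
    exact ⟨_, hM.sup hM', Submodule.add_mem_sup ha hb⟩
  algebraMap_mem' P := ⟨1, isEModule_one, Submodule.mem_one.mpr ⟨P, rfl⟩⟩

theorem mem_eAlg {f : ℚ⟦X⟧} : f ∈ eAlg ↔ ∃ M, IsEModule M ∧ f ∈ M := Iff.rfl

theorem gr_of_mem_eAlg {f : ℚ⟦X⟧} (hf : f ∈ eAlg) : Gr f := by
  obtain ⟨M, hM, hf⟩ := hf
  exact hM.2.1 f hf

theorem isEModule_bot : IsEModule ⊥ :=
  ⟨Submodule.fg_bot, by rintro f (rfl : f = 0); simpa using gr_coe 0, 1, one_ne_zero, by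
    rintro f (rfl : f = 0); simp [D]⟩

/-- Finitely many E-functions lie in a common finitely generated differential module. -/
theorem exists_common_module {ι : Type*} [Finite ι] (f : ι → ℚ⟦X⟧) (hf : ∀ i, f i ∈ eAlg) :
    ∃ M, IsEModule M ∧ ∀ i, f i ∈ M := by
  classical
  have := Fintype.ofFinite ι
  choose M hM hfM using hf
  have : ∀ s : Finset ι, IsEModule (s.sup M) := by
    intro s
    induction s using Finset.induction_on with
    | empty => exact isEModule_bot
    | insert a s ha ih => rw [Finset.sup_insert]; exact (hM a).sup ih
  exact ⟨_, this Finset.univ, fun i => (Finset.le_sup (f := M) (Finset.mem_univ i)) (hfM i)⟩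

/-- Integer polynomials inside rational polynomials. -/
def zq : ℤ[X] →+* ℚ[X] := Polynomial.mapRingHom (Int.castRingHom ℚ)

theorem zq_injective : Function.Injective zq :=
  Polynomial.map_injective _ (RingHom.injective_int _)

theorem zq_coeff (P : ℤ[X]) (n : ℕ) : (zq P).coeff n = P.coeff n := by
  simp [zq]

theorem exists_integer_multiple (Q : ℚ[X]) : ∃ (c : ℤ) (P : ℤ[X]), c ≠ 0 ∧
    zq P = Polynomial.C (c : ℚ) * Q := by
  obtain ⟨b, hbM, hb⟩ := IsLocalization.integerNormalization_spec (nonZeroDivisors ℤ) Q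
  refine ⟨b, IsLocalization.integerNormalization (nonZeroDivisors ℤ) Q,
    nonZeroDivisors.ne_zero hbM, ?_⟩
  change Polynomial.map _ _ = _
  rw [← Polynomial.smul_eq_C_mul]
  rw [Int.cast_smul_eq_zsmul]
  exact hb

theorem exists_common_integer_multiple {ι : Type*} [Fintype ι] (Q : ι → ℚ[X]) :
    ∃ (c : ℤ) (P : ι → ℤ[X]), c ≠ 0 ∧ ∀ i, zq (P i) = Polynomial.C (c : ℚ) * Q i := by
  classical
  choose c P hc hP using fun i => exists_integer_multiple (Q i)
  refine ⟨∏ i, c i, fun i => Polynomial.C (∏ j ∈ Finset.univ.erase i, c j) * P i,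
    Finset.prod_ne_zero_iff.mpr fun i _ => hc i, fun i => ?_⟩
  rw [← Finset.prod_erase_mul _ _ (Finset.mem_univ i), map_mul, hP]
  have : ∀ z : ℤ, zq (Polynomial.C z) = Polynomial.C (z : ℚ) := fun z => by simp [zq]
  rw [this]
  push_cast
  simp only [map_mul]
  ring

/-- A system of E-functions, linearly independent over polynomials, closed under `T d/dz`. -/
structure ESys (N : ℕ) where
  /-- the functions -/
  y : Fin N → ℚ⟦X⟧
  gr : ∀ j, Gr (y j)
  indep : LinearIndependent ℚ[X] y
  /-- the denominator of the system -/
  T : ℤ[X]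
  T_ne : T ≠ 0
  /-- the matrix of the system -/
  A : Matrix (Fin N) (Fin N) ℤ[X]
  hD : ∀ j, zq T • D (y j) = ∑ l, zq (A j l) • y l

theorem exists_eSys {M : Submodule ℚ[X] ℚ⟦X⟧} (hM : IsEModule M) :
    ∃ (N : ℕ) (S : ESys N), Submodule.span ℚ[X] (Set.range S.y) = M := by
  obtain ⟨h1, h2, T, h3, h4⟩ := hM
  have : Module.Finite ℚ[X] M := Module.Finite.iff_fg.mpr h1
  have : Module.IsTorsionFree ℚ[X] ℚ⟦X⟧ := by
    refine ⟨fun r hr a b hab => ?_⟩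
    have hab' : (r : ℚ⟦X⟧) * a = (r : ℚ⟦X⟧) * b := by
      simpa only [smul_eq_coe_mul] using hab
    exact mul_left_cancel₀ (by simpa using hr.ne_zero) hab'
  have : Module.Free ℚ[X] M := Module.free_of_finite_type_torsion_free'
  let b := Module.finBasis ℚ[X] M
  have hT : ∀ j, ∃ B : Fin (Module.finrank ℚ[X] M) → ℚ[X],
      T • D (b j : ℚ⟦X⟧) = ∑ l, B l • (b l : ℚ⟦X⟧) := by
    intro j
    let x : M := ⟨T • D (b j : ℚ⟦X⟧), h4 _ (b j).2⟩
    refine ⟨fun l => b.repr x l, ?_⟩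
    have := congrArg Subtype.val (b.sum_repr x)
    rw [AddSubmonoidClass.coe_finsetSum] at this
    exact this.symm
  choose B hB using hT
  obtain ⟨c, P, hc, hP⟩ := exists_common_integer_multiple
    (fun o : Option (Fin (Module.finrank ℚ[X] M) × Fin (Module.finrank ℚ[X] M)) =>
      o.elim T fun p => B p.1 p.2)
  have hspan : Submodule.span ℚ[X] (Set.range fun j => (b j : ℚ⟦X⟧)) = M := by
    have := congrArg (Submodule.map M.subtype) b.span_eq
    rw [Submodule.map_span, ← Set.range_comp, Submodule.map_top, Submodule.range_subtype] at this
    exact this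
  refine ⟨_, ⟨fun j => (b j : ℚ⟦X⟧), fun j => h2 _ (b j).2,
    b.linearIndependent.map' M.subtype (Submodule.ker_subtype M), P none, ?_,
    fun j l => P (some (j, l)), fun j => ?_⟩, hspan⟩
  · intro h
    have := hP none
    rw [h, map_zero, eq_comm, mul_eq_zero] at this
    rcases this with h | h
    · exact hc (by simpa using h)
    · exact h3 h
  · rw [hP none]
    simp only [hP, Option.elim, mul_smul, hB, Finset.smul_sum]

/-- The value at `z` of a rational power series. -/
def evz (f : ℚ⟦X⟧) (z : ℂ) : ℂ := ∑' n, ((PowerSeries.coeff n f : ℚ) : ℂ) * z ^ n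

theorem Gr.summable {f : ℚ⟦X⟧} (hf : Gr f) (z : ℂ) :
    Summable fun n => ‖((PowerSeries.coeff n f : ℚ) : ℂ) * z ^ n‖ := by
  obtain ⟨C, d, hd⟩ := hf
  refine Summable.of_nonneg_of_le (fun _ => norm_nonneg _) (fun n => ?_)
    ((Real.summable_pow_div_factorial (C * ‖z‖)).mul_left (C : ℝ))
  have h := (hd n).2.2.1
  have h' : (n.factorial : ℝ) * ‖((PowerSeries.coeff n f : ℚ) : ℂ)‖ ≤ (C : ℝ) ^ (n + 1) := by
    rw [abs_mul, Nat.abs_cast] at h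
    have h2 : (n.factorial : ℝ) * |((PowerSeries.coeff n f : ℚ) : ℝ)| ≤ (C : ℝ) ^ (n + 1) := by
      exact_mod_cast h
    have h3 : ‖((PowerSeries.coeff n f : ℚ) : ℂ)‖ = |((PowerSeries.coeff n f : ℚ) : ℝ)| := by
      rw [← Complex.ofReal_ratCast, Complex.norm_real, Real.norm_eq_abs]
    rwa [h3]
  have hn : (0 : ℝ) < n.factorial := by exact_mod_cast n.factorial_pos
  rw [norm_mul, norm_pow, mul_pow, mul_div_assoc']
  rw [le_div_iff₀ hn]
  calc _ = ((n.factorial : ℝ) * ‖((PowerSeries.coeff n f : ℚ) : ℂ)‖) * ‖z‖ ^ n := by ring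
    _ ≤ (C : ℝ) ^ (n + 1) * ‖z‖ ^ n := by gcongr
    _ = _ := by ring

theorem evz_add {f g : ℚ⟦X⟧} (hf : Gr f) (hg : Gr g) (z : ℂ) :
    evz (f + g) z = evz f z + evz g z := by
  rw [evz, evz, evz, ← Summable.tsum_add (hf.summable z).of_norm (hg.summable z).of_norm]
  refine tsum_congr fun n => ?_
  rw [map_add]; push_cast; ring

theorem evz_mul {f g : ℚ⟦X⟧} (hf : Gr f) (hg : Gr g) (z : ℂ) :
    evz (f * g) z = evz f z * evz g z := by
  rw [evz, evz, evz, tsum_mul_tsum_eq_tsum_sum_antidiagonal_of_summable_norm (hf.summable z)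
    (hg.summable z)]
  refine tsum_congr fun n => ?_
  rw [PowerSeries.coeff_mul]
  push_cast
  rw [Finset.sum_mul]
  refine Finset.sum_congr rfl fun p hp => ?_
  rw [← Finset.HasAntidiagonal.mem_antidiagonal.mp hp, pow_add]
  ring

theorem evz_coe (P : ℚ[X]) (z : ℂ) : evz (P : ℚ⟦X⟧) z = P.aeval z := by
  rw [evz, Polynomial.aeval_eq_sum_range, tsum_eq_sum (s := Finset.range (P.natDegree + 1))]
  · refine Finset.sum_congr rfl fun n _ => ?_
    rw [Polynomial.coeff_coe, Algebra.smul_def]; rfl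
  · intro n hn
    rw [Polynomial.coeff_coe, Polynomial.coeff_eq_zero_of_natDegree_lt (by simpa using hn)]
    simp

/-- The Taylor expansion at `1` of a rational power series, as a power series in `t = z - 1`. -/
def tau (f : ℚ⟦X⟧) : ℂ⟦X⟧ := PowerSeries.mk fun l => evz (D^[l] f) 1 / (l.factorial : ℂ)

theorem coeff_tau (f : ℚ⟦X⟧) (l : ℕ) :
    PowerSeries.coeff l (tau f) = evz (D^[l] f) 1 / (l.factorial : ℂ) := by
  simp [tau]

theorem coeff_tau_succ (f : ℚ⟦X⟧) (l : ℕ) :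
    PowerSeries.coeff (l + 1) (tau f) * (l + 1) = PowerSeries.coeff l (tau (D f)) := by
  rw [coeff_tau, coeff_tau, Function.iterate_succ_apply, Nat.factorial_succ]
  have h1 : ((l : ℂ) + 1) ≠ 0 := by exact_mod_cast Nat.succ_ne_zero l
  have h2 : (l.factorial : ℂ) ≠ 0 := by exact_mod_cast l.factorial_ne_zero
  push_cast
  field_simp

theorem tau_D (f : ℚ⟦X⟧) : tau (D f) = PowerSeries.derivative ℂ (tau f) := by
  ext l
  rw [PowerSeries.coeff_derivative, coeff_tau_succ]

theorem iterate_D_add (l : ℕ) (f g : ℚ⟦X⟧) : D^[l] (f + g) = D^[l] f + D^[l] g := by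
  induction l generalizing f g with
  | zero => rfl
  | succ l ih => rw [Function.iterate_succ_apply, D, map_add, ih]; rfl

theorem tau_add {f g : ℚ⟦X⟧} (hf : Gr f) (hg : Gr g) : tau (f + g) = tau f + tau g := by
  ext l
  rw [map_add, coeff_tau, coeff_tau, coeff_tau, iterate_D_add,
    evz_add (hf.iterate_D l) (hg.iterate_D l), add_div]

theorem tau_mul {f g : ℚ⟦X⟧} (hf : Gr f) (hg : Gr g) : tau (f * g) = tau f * tau g := by
  ext l
  induction l generalizing f g with
  | zero => simp [coeff_tau, evz_mul hf hg, PowerSeries.coeff_mul]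
  | succ l ih =>
    have h1 : ((l : ℂ) + 1) ≠ 0 := by exact_mod_cast Nat.succ_ne_zero l
    apply mul_right_cancel₀ h1
    rw [coeff_tau_succ, D_mul, tau_add (hf.D.mul hg) (hf.mul hg.D), map_add, ih hf.D hg,
      ih hf hg.D, ← PowerSeries.coeff_derivative, Derivation.leibniz, ← tau_D, ← tau_D, map_add,
      smul_eq_mul, smul_eq_mul, mul_comm (tau g), add_comm]

/-- The Taylor expansion at `1` of a rational polynomial. -/
def rtau : ℚ[X] →+* ℚ⟦X⟧ :=
  Polynomial.coeToPowerSeries.ringHom.comp (Polynomial.taylorAlgHom (1 : ℚ)).toRingHom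

theorem rtau_apply (P : ℚ[X]) : rtau P = ((Polynomial.taylor 1 P : ℚ[X]) : ℚ⟦X⟧) := rfl

theorem rtau_injective : Function.Injective rtau := by
  intro P Q h
  rw [rtau_apply, rtau_apply, Polynomial.coe_inj] at h
  exact Polynomial.taylor_injective _ h

/-- Extension of scalars from `ℚ⟦t⟧` to `ℂ⟦t⟧`. -/
abbrev qc : ℚ⟦X⟧ →+* ℂ⟦X⟧ := PowerSeries.map (algebraMap ℚ ℂ)

theorem qc_injective : Function.Injective qc :=
  PowerSeries.map_injective _ (algebraMap ℚ ℂ).injective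

theorem iterate_D_coe (l : ℕ) (P : ℚ[X]) :
    D^[l] (P : ℚ⟦X⟧) = ((Polynomial.derivative^[l] P : ℚ[X]) : ℚ⟦X⟧) := by
  induction l with
  | zero => rfl
  | succ l ih => rw [Function.iterate_succ_apply', ih, Function.iterate_succ_apply', D,
      PowerSeries.derivative_coe]

theorem tau_coe (P : ℚ[X]) : tau (P : ℚ⟦X⟧) = qc (rtau P) := by
  ext l
  have h2 : (l.factorial : ℂ) ≠ 0 := by exact_mod_cast l.factorial_ne_zero
  rw [coeff_tau, iterate_D_coe, evz_coe, rtau_apply, PowerSeries.coeff_map, Polynomial.coeff_coe,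
    Polynomial.taylor_coeff, ← Polynomial.factorial_smul_hasseDeriv, div_eq_iff h2]
  simp [Polynomial.aeval_def]
  exact mul_comm _ _

theorem tau_smul (P : ℚ[X]) {f : ℚ⟦X⟧} (hf : Gr f) : tau (P • f) = qc (rtau P) * tau f := by
  rw [smul_eq_coe_mul, tau_mul (gr_coe P) hf, tau_coe]

theorem tau_zero : tau 0 = 0 := by
  have := tau_coe 0
  simpa using this

theorem Gr.sum {ι : Type*} (s : Finset ι) (f : ι → ℚ⟦X⟧) (hf : ∀ i ∈ s, Gr (f i)) :
    Gr (∑ i ∈ s, f i) := by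
  exact grAlg.sum_mem hf

theorem tau_sum {ι : Type*} (s : Finset ι) (f : ι → ℚ⟦X⟧) (hf : ∀ i ∈ s, Gr (f i)) :
    tau (∑ i ∈ s, f i) = ∑ i ∈ s, tau (f i) := by
  classical
  induction s using Finset.induction_on with
  | empty => simp [tau_zero]
  | insert a s ha ih =>
    rw [Finset.sum_insert ha, Finset.sum_insert ha, tau_add (hf a (Finset.mem_insert_self a s))
      (Gr.sum s f fun i hi => hf i (Finset.mem_insert_of_mem hi)),
      ih fun i hi => hf i (Finset.mem_insert_of_mem hi)]

theorem D_sum {ι : Type*} (s : Finset ι) (f : ι → ℚ⟦X⟧) :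
    D (∑ i ∈ s, f i) = ∑ i ∈ s, D (f i) :=
  map_sum (PowerSeries.derivative ℚ) _ _

theorem order_eq_of_wronskian {V W : ℚ⟦X⟧} (hV : V ≠ 0) (hW : W ≠ 0) (h : V * D W = W * D V) :
    V.order = W.order := by
  have key : ∀ {A B : ℚ⟦X⟧} {a b : ℕ}, A.order = a → B.order = b →
      PowerSeries.coeff (a + b) (PowerSeries.X * (A * D B)) =
        b * (PowerSeries.coeff a A * PowerSeries.coeff b B) := by
    intro A B a b ha hb
    have hXD : PowerSeries.X * (A * D B) = A * (PowerSeries.X * D B) := by ring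
    rw [hXD, PowerSeries.coeff_mul, Finset.sum_eq_single (a, b)]
    · rcases b with _ | b
      · simp
      · rw [PowerSeries.coeff_succ_X_mul, coeff_D]
        push_cast
        ring
    · rintro ⟨i, j⟩ hij hne
      rw [Finset.HasAntidiagonal.mem_antidiagonal] at hij
      simp only at hij
      rcases lt_or_ge i a with h1 | h1
      · rw [PowerSeries.coeff_of_lt_order i (by rw [ha]; exact_mod_cast h1), zero_mul]
      · have h2 : j < b := by
          rcases eq_or_lt_of_le h1 with h3 | h3
          · exact absurd (by ext <;> simp <;> omega) hne
          · omega
        rcases j with _ | j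
        · simp
        · rw [PowerSeries.coeff_succ_X_mul, coeff_D,
            PowerSeries.coeff_of_lt_order (j + 1) (by rw [hb]; exact_mod_cast h2)]
          simp
    · intro h
      exact absurd (by simp [Finset.HasAntidiagonal.mem_antidiagonal]) h
  obtain ⟨v, hv⟩ := ENat.ne_top_iff_exists.mp (fun h => hV (PowerSeries.order_eq_top.mp h))
  obtain ⟨w, hw⟩ := ENat.ne_top_iff_exists.mp (fun h => hW (PowerSeries.order_eq_top.mp h))
  have h1 := key hv.symm hw.symm
  have h2 := key hw.symm hv.symm
  rw [h, add_comm, h2] at h1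
  have hv' := (PowerSeries.order_eq_nat.mp hv.symm).1
  have hw' := (PowerSeries.order_eq_nat.mp hw.symm).1
  rw [mul_comm (PowerSeries.coeff w W)] at h1
  have h3 := mul_right_cancel₀ (mul_ne_zero hv' hw') h1
  rw [← hv, ← hw]
  exact_mod_cast h3

theorem exists_const_of_wronskian {U V : ℚ⟦X⟧} (hV : V ≠ 0) (h : V * D U = U * D V) :
    ∃ c : ℚ, U = PowerSeries.C c * V := by
  obtain ⟨v, hv⟩ := ENat.ne_top_iff_exists.mp (fun h => hV (PowerSeries.order_eq_top.mp h))
  have hv' := (PowerSeries.order_eq_nat.mp hv.symm).1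
  set c := PowerSeries.coeff v U / PowerSeries.coeff v V with hc
  refine ⟨c, ?_⟩
  by_contra hne
  have hW : U - PowerSeries.C c * V ≠ 0 := sub_ne_zero.mpr hne
  have hDC : D (PowerSeries.C c * V) = PowerSeries.C c * D V := by
    rw [← PowerSeries.smul_eq_C_mul, ← PowerSeries.smul_eq_C_mul]
    exact (PowerSeries.derivative ℚ).map_smul c V
  have h1 := order_eq_of_wronskian hV hW (by
    have : D (U - PowerSeries.C c * V) = D U - PowerSeries.C c * D V := by
      rw [← hDC]; exact map_sub _ _ _
    rw [this, mul_sub, h]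
    ring)
  rw [← hv] at h1
  apply (PowerSeries.order_eq_nat.mp h1.symm).1
  rw [map_sub, PowerSeries.coeff_C_mul, hc, div_mul_cancel₀ _ hv', sub_self]

theorem exists_order_bound (H : Submodule ℚ ℚ⟦X⟧) [FiniteDimensional ℚ H] :
    ∃ c : ℕ, ∀ x ∈ H, x ≠ 0 → ∃ m ≤ c, PowerSeries.coeff m x ≠ 0 := by
  let F : ℕ → Submodule ℚ H := fun k =>
    ⨅ m : Fin k, LinearMap.ker ((PowerSeries.coeff (R := ℚ) (m : ℕ)).comp H.subtype)
  have hF : ∀ k x, x ∈ F k ↔ ∀ m < k, PowerSeries.coeff m (x : ℚ⟦X⟧) = 0 := by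
    intro k x
    simp only [F, Submodule.mem_iInf, LinearMap.mem_ker]
    exact ⟨fun h m hm => h ⟨m, hm⟩, fun h m => h m m.2⟩
  obtain ⟨n, hn⟩ := IsArtinian.monotone_stabilizes (R := ℚ) (M := H)
    ⟨fun k => OrderDual.toDual (F k), fun a b hab => by
      have hle : F b ≤ F a := fun x hx => (hF _ _).mpr fun m hm =>
        (hF _ _).mp hx m (lt_of_lt_of_le hm hab)
      exact hle⟩
  refine ⟨n, fun x hx hx0 => ?_⟩
  by_contra! hcon
  have h1 : (⟨x, hx⟩ : H) ∈ F n := (hF _ _).mpr fun m hm => hcon m hm.le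
  apply hx0
  ext m
  rcases le_or_gt n m with h | h
  · have h2 : F n = F (m + 1) := hn (m + 1) (by omega)
    rw [h2, hF] at h1
    simpa using h1 m (by omega)
  · simpa using hcon m h.le

/-- Vectors spanning a line stable under the connection `T d/dz + 𝒜`. -/
def IsStableLine {I : Type} (T : ℚ⟦X⟧) (𝒜 : (I → ℚ⟦X⟧) →ₗ[ℚ⟦X⟧] (I → ℚ⟦X⟧)) (ω : I → ℚ⟦X⟧) :
    Prop :=
  ω ≠ 0 ∧ ∃ β α : ℚ⟦X⟧, β ≠ 0 ∧ ∀ J, β * (T * D (ω J) + 𝒜 ω J) = α * ω J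

theorem exists_reference_solution (b γ T : ℚ⟦X⟧) (hb : b ≠ 0) (hT : T ≠ 0) :
    ∃ h k : ℚ⟦X⟧, k ≠ 0 ∧ ∀ p q : ℚ⟦X⟧, q ≠ 0 →
      b * (q * (T * D p) - p * (T * D q)) = γ * (p * q) →
      ∃ c : ℚ, p * k = PowerSeries.C c * (h * q) := by
  by_cases hex : ∃ h k : ℚ⟦X⟧, h ≠ 0 ∧ k ≠ 0 ∧
      b * (k * (T * D h) - h * (T * D k)) = γ * (h * k)
  · obtain ⟨h, k, hh, hk, hhk⟩ := hex
    refine ⟨h, k, hk, fun p q hq hpq => exists_const_of_wronskian (mul_ne_zero hh hq) ?_⟩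
    rw [← sub_eq_zero]
    apply mul_left_cancel₀ (mul_ne_zero hb hT)
    rw [mul_zero, D_mul, D_mul]
    linear_combination h * k * hpq - p * q * hhk
  · push Not at hex
    refine ⟨0, 1, one_ne_zero, fun p q hq hpq => ⟨0, ?_⟩⟩
    by_cases hp : p = 0
    · simp [hp]
    · exact absurd hpq (hex p q hp hq)

theorem exists_stableLine_space {I : Type} [Fintype I] (T : ℚ⟦X⟧) (hT : T ≠ 0)
    (𝒜 : (I → ℚ⟦X⟧) →ₗ[ℚ⟦X⟧] (I → ℚ⟦X⟧)) :
    ∃ H : Submodule ℚ (I → ℚ⟦X⟧), FiniteDimensional ℚ H ∧ ∀ ω, IsStableLine T 𝒜 ω →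
      ∃ η ∈ H, η ≠ 0 ∧ ∀ J J', ω J * η J' = ω J' * η J := by
  classical
  obtain ⟨s, hs, hmax⟩ := exists_maximal_linearIndepOn ℚ⟦X⟧
    (fun ω : {ω // IsStableLine T 𝒜 ω} => ω.1)
  have hsfin : Finite s := LinearIndependent.finite_of_isNoetherian hs
  have := Fintype.ofFinite s
  choose β₀ α₀ hβ₀ hαβ₀ using fun i : s => i.1.2.2
  let b := ∏ i, β₀ i
  have hb : b ≠ 0 := Finset.prod_ne_zero_iff.mpr fun i _ => hβ₀ i
  let α : s → ℚ⟦X⟧ := fun i => (∏ j ∈ Finset.univ.erase i, β₀ j) * α₀ i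
  have hα : ∀ i J, b * (T * D (i.1.1 J) + 𝒜 i.1.1 J) = α i * i.1.1 J := by
    intro i J
    simp only [b, α]
    rw [← Finset.prod_erase_mul _ _ (Finset.mem_univ i), mul_assoc, hαβ₀ i J, mul_assoc]
  choose h k hk href using fun i i' : s =>
    exists_reference_solution b (α i' - α i) T hb hT
  let K : s → s → ℚ⟦X⟧ := fun i0 i => ∏ j ∈ Finset.univ.erase i, k j i0
  let e : s × s → I → ℚ⟦X⟧ := fun p => (K p.2 p.1 * h p.1 p.2) • p.1.1.1
  refine ⟨Submodule.span ℚ (Set.range e), FiniteDimensional.span_of_finite _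
    (Set.finite_range e), fun ω hω => ?_⟩
  obtain ⟨g0, g, hg0, hg⟩ : ∃ (g0 : ℚ⟦X⟧) (g : s → ℚ⟦X⟧), g0 ≠ 0 ∧
      g0 • ω = ∑ i, g i • i.1.1 := by
    by_cases hmem : (⟨ω, hω⟩ : {ω // IsStableLine T 𝒜 ω}) ∈ s
    · refine ⟨1, fun i => if i = ⟨_, hmem⟩ then 1 else 0, one_ne_zero, ?_⟩
      simp
    · obtain ⟨a, ha, hspan⟩ := hmax _ hmem
      rw [Set.image_eq_range] at hspan
      obtain ⟨g, hg⟩ := (Submodule.mem_span_range_iff_exists_fun _).mp hspan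
      exact ⟨a, g, ha, hg.symm⟩
  obtain ⟨hω0, β, αω, hβ, hαω⟩ := hω
  have hgJ : ∀ J, g0 * ω J = ∑ i, g i * i.1.1 J := by
    intro J
    have := congrFun hg J
    simpa [Finset.sum_apply] using this
  have hcoef : ∀ i, β * g0 * (b * (T * D (g i)) + g i * α i) =
      b * (β * (T * D g0) + αω * g0) * g i := by
    have hsum : ∑ i, (β * g0 * (b * (T * D (g i)) + g i * α i) -
        b * (β * (T * D g0) + αω * g0) * g i) • (i.1.1 : I → ℚ⟦X⟧) = 0 := by
      funext J
      have h𝒜 : g0 * 𝒜 ω J = ∑ i, g i * 𝒜 i.1.1 J := by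
        have := congrFun (congrArg 𝒜 hg) J
        simpa [Finset.sum_apply] using this
      have hDJ : D g0 * ω J + g0 * D (ω J) = ∑ i, (D (g i) * i.1.1 J + g i * D (i.1.1 J)) := by
        have := congrArg D (hgJ J)
        rw [D_mul, D_sum] at this
        rw [this]
        exact Finset.sum_congr rfl fun i _ => D_mul _ _
      have h1 : ∑ i, (β * g0 * (b * (T * D (g i)) + g i * α i)) * i.1.1 J =
          β * g0 * b * (T * (D g0 * ω J + g0 * D (ω J)) + g0 * 𝒜 ω J) := by
        rw [hDJ, h𝒜, Finset.mul_sum, ← Finset.sum_add_distrib, Finset.mul_sum]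
        refine Finset.sum_congr rfl fun i _ => ?_
        linear_combination (-β * g0 * g i) * hα i J
      simp only [Finset.sum_apply, Pi.smul_apply, smul_eq_mul, Pi.zero_apply, sub_mul,
        Finset.sum_sub_distrib]
      rw [h1, sub_eq_zero]
      have h2 : ∑ i, b * (β * (T * D g0) + αω * g0) * g i * i.1.1 J =
          b * (β * (T * D g0) + αω * g0) * (g0 * ω J) := by
        rw [hgJ, Finset.mul_sum]
        exact Finset.sum_congr rfl fun i _ => by ring
      rw [h2]
      linear_combination g0 * g0 * b * hαω J
    intro i
    exact sub_eq_zero.mp (Fintype.linearIndependent_iff.mp hs _ hsum i)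
  obtain ⟨i0, hi0⟩ : ∃ i0, g i0 ≠ 0 := by
    by_contra! hcon
    simp only [hcon, zero_smul, Finset.sum_const_zero] at hg
    exact hω0 ((smul_eq_zero.mp hg).resolve_left hg0)
  have hc : ∀ i, ∃ c : ℚ, g i * k i i0 = PowerSeries.C c * (h i i0 * g i0) := by
    intro i
    apply href i i0 _ _ hi0
    apply mul_left_cancel₀ (mul_ne_zero hβ hg0)
    linear_combination g i0 * hcoef i - g i * hcoef i0
  choose c hc using hc
  let η : I → ℚ⟦X⟧ := ∑ i, c i • e (i, i0)
  have hη : ∀ J, g0 * (∏ j, k j i0) * ω J = g i0 * η J := by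
    intro J
    have : η J = ∑ i, PowerSeries.C (c i) * (K i0 i * h i i0 * i.1.1 J) := by
      simp [η, e, Finset.sum_apply, PowerSeries.smul_eq_C_mul]
    rw [this, mul_right_comm, hgJ, Finset.sum_mul, Finset.mul_sum]
    refine Finset.sum_congr rfl fun i _ => ?_
    rw [← Finset.prod_erase_mul _ _ (Finset.mem_univ i)]
    simp only [K]
    linear_combination ((∏ j ∈ Finset.univ.erase i, k j i0) * i.1.1 J) * hc i
  have hP : g0 * (∏ j, k j i0) ≠ 0 :=
    mul_ne_zero hg0 (Finset.prod_ne_zero_iff.mpr fun i _ => hk i i0)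
  refine ⟨η, Submodule.sum_mem _ fun i _ => Submodule.smul_mem _ _
    (Submodule.subset_span ⟨_, rfl⟩), ?_, fun J J' => ?_⟩
  · intro h0
    apply hω0
    funext J
    have := hη J
    rw [h0, Pi.zero_apply, mul_zero, mul_eq_zero] at this
    exact this.resolve_left hP
  · apply mul_left_cancel₀ hi0
    linear_combination ω J' * hη J - ω J * hη J'

theorem D_prod {ι : Type*} [DecidableEq ι] (s : Finset ι) (f : ι → ℚ⟦X⟧) :
    D (∏ i ∈ s, f i) = ∑ i ∈ s, ∏ j ∈ s, (if j = i then D (f j) else f j) := by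
  induction s using Finset.induction_on with
  | empty => simp [D]
  | insert a s ha ih =>
    rw [Finset.prod_insert ha, D_mul, ih, Finset.sum_insert ha, Finset.prod_insert ha, if_pos rfl,
      Finset.mul_sum]
    congr 1
    · congr 1
      exact Finset.prod_congr rfl fun j hj => by rw [if_neg (by rintro rfl; exact ha hj)]
    · refine Finset.sum_congr rfl fun i hi => ?_
      rw [Finset.prod_insert ha, if_neg (by rintro rfl; exact ha hi)]

theorem D_det {ρ : ℕ} (M : Matrix (Fin ρ) (Fin ρ) ℚ⟦X⟧) :
    D M.det = ∑ i, (M.updateRow i fun b => D (M i b)).det := by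
  have hsmul : ∀ (u : ℤˣ) (f : ℚ⟦X⟧), D (u • f) = u • D f := by
    intro u f
    rw [Units.smul_def, Units.smul_def]
    exact map_zsmul (PowerSeries.derivative ℚ) _ _
  rw [← Matrix.det_transpose, Matrix.det_apply, D_sum]
  simp only [hsmul, D_prod, Finset.smul_sum]
  rw [Finset.sum_comm]
  refine Finset.sum_congr rfl fun i _ => ?_
  rw [← Matrix.det_transpose, Matrix.det_apply]
  refine Finset.sum_congr rfl fun σ _ => ?_
  congr 1
  refine Finset.prod_congr rfl fun j _ => ?_
  simp only [Matrix.transpose_apply, Matrix.updateRow_apply]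
  split_ifs with h
  · rw [h]
  · rfl

theorem sum_det_updateRow_eq_sum_det_updateCol {R : Type*} [CommRing R] {n : Type*} [Fintype n]
    [DecidableEq n] (X Y : Matrix n n R) :
    ∑ i, (X.updateRow i (Y i)).det = ∑ b, (X.updateCol b fun i => Y i b).det := by
  have h1 : ∀ i, (X.updateRow i (Y i)).det = ∑ b, X.adjugate b i * Y i b := by
    intro i
    rw [← Matrix.cramer_transpose_apply, Matrix.cramer_eq_adjugate_mulVec,
      ← Matrix.adjugate_transpose]
    rfl
  have h2 : ∀ b, (X.updateCol b fun i => Y i b).det = ∑ i, X.adjugate b i * Y i b := by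
    intro b
    rw [← Matrix.cramer_apply, Matrix.cramer_eq_adjugate_mulVec]
    rfl
  simp only [h1, h2]
  exact Finset.sum_comm

/-- Maximal minors of the first `ρ` rows of `x`. -/
def minors {N : ℕ} (x : ℕ → Fin N → ℚ⟦X⟧) (ρ : ℕ) (J : Fin ρ → Fin N) : ℚ⟦X⟧ :=
  (Matrix.of fun i b : Fin ρ => x i (J b)).det

/-- The connection induced on minors by the matrix `a`. -/
def minorConn {N : ℕ} (a : Fin N → Fin N → ℚ⟦X⟧) (ρ : ℕ) :
    ((Fin ρ → Fin N) → ℚ⟦X⟧) →ₗ[ℚ⟦X⟧] ((Fin ρ → Fin N) → ℚ⟦X⟧) where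
  toFun ω J := ∑ b, ∑ l, a l (J b) * ω (Function.update J b l)
  map_add' ω ω' := by
    funext J
    simp [mul_add, Finset.sum_add_distrib]
  map_smul' c ω := by
    funext J
    simp [Finset.mul_sum, mul_left_comm]

theorem minorConn_apply {N : ℕ} (a : Fin N → Fin N → ℚ⟦X⟧) (ρ : ℕ)
    (ω : (Fin ρ → Fin N) → ℚ⟦X⟧) (J : Fin ρ → Fin N) :
    minorConn a ρ ω J = ∑ b, ∑ l, a l (J b) * ω (Function.update J b l) := rfl

theorem sum_mul_minors_update {N : ℕ} (x : ℕ → Fin N → ℚ⟦X⟧) (ρ : ℕ) (J : Fin ρ → Fin N)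
    (b : Fin ρ) (v : Fin N → ℚ⟦X⟧) :
    ∑ l, v l * minors x ρ (Function.update J b l) =
      ((Matrix.of fun i b : Fin ρ => x i (J b)).updateCol b fun i => ∑ l, x i l * v l).det := by
  have : (fun i : Fin ρ => ∑ l, x i l * v l) = ∑ l, v l • fun i : Fin ρ => x i l := by
    funext i
    simp [Finset.sum_apply, mul_comm]
  rw [this, ← Matrix.cramer_apply, map_sum, Finset.sum_apply]
  refine Finset.sum_congr rfl fun l _ => ?_
  rw [map_smul, Pi.smul_apply, smul_eq_mul, Matrix.cramer_apply, minors]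
  congr 2
  ext i c
  rw [Matrix.updateCol_apply, Matrix.of_apply, Matrix.of_apply, Function.update_apply]
  split_ifs <;> rfl

theorem minors_connection {N : ℕ} (x : ℕ → Fin N → ℚ⟦X⟧) (a : Fin N → Fin N → ℚ⟦X⟧) (T : ℚ⟦X⟧)
    (hx : ∀ i l, T * D (x i l) = x (i + 1) l - ∑ j, x i j * a j l) (ρ : ℕ)
    (J : Fin (ρ + 1) → Fin N) :
    T * D (minors x (ρ + 1) J) + minorConn a (ρ + 1) (minors x (ρ + 1)) J =
      ((Matrix.of fun i b : Fin (ρ + 1) => x i (J b)).updateRow (Fin.last ρ)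
        fun b => x (ρ + 1) (J b)).det := by
  set X : Matrix (Fin (ρ + 1)) (Fin (ρ + 1)) ℚ⟦X⟧ := Matrix.of fun i b => x i (J b) with hX
  let Y : Matrix (Fin (ρ + 1)) (Fin (ρ + 1)) ℚ⟦X⟧ := fun i b => ∑ j, x i j * a j (J b)
  have h1 : T * D (minors x (ρ + 1) J) =
      ∑ i, ((X.updateRow i fun b => x (i + 1) (J b)).det - (X.updateRow i (Y i)).det) := by
    rw [minors, D_det, Finset.mul_sum]
    refine Finset.sum_congr rfl fun i _ => ?_
    rw [← Matrix.det_updateRow_smul, eq_sub_iff_add_eq, ← Matrix.det_updateRow_add]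
    congr 2
    funext b
    simp only [Pi.add_apply, Pi.smul_apply, smul_eq_mul, Y, Matrix.of_apply]
    rw [hx]
    ring
  have h2 : minorConn a (ρ + 1) (minors x (ρ + 1)) J = ∑ i, (X.updateRow i (Y i)).det := by
    rw [sum_det_updateRow_eq_sum_det_updateCol, minorConn_apply]
    exact Finset.sum_congr rfl fun b _ =>
      sum_mul_minors_update x (ρ + 1) J b fun l => a l (J b)
  rw [h1, h2, Finset.sum_sub_distrib, sub_add_cancel, Finset.sum_eq_single (Fin.last ρ)]
  · rfl
  · intro i _ hi
    have hi' : (i : ℕ) < ρ := by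
      have := Fin.val_lt_last hi
      simpa using this
    refine Matrix.det_zero_of_row_eq (i := i) (j := ⟨i + 1, by omega⟩) ?_ ?_
    · intro h
      have := congrArg Fin.val h
      simp at this
    · funext b
      rw [Matrix.updateRow_self, Matrix.updateRow_ne]
      · rfl
      · intro h
        have := congrArg Fin.val h
        simp at this
  · simp

theorem isStableLine_minors {N : ℕ} (x : ℕ → Fin N → ℚ⟦X⟧) (a : Fin N → Fin N → ℚ⟦X⟧) (T : ℚ⟦X⟧)
    (hx : ∀ i l, T * D (x i l) = x (i + 1) l - ∑ j, x i j * a j l) (ρ : ℕ)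
    (h0 : minors x (ρ + 1) ≠ 0) (h1 : minors x (ρ + 2) = 0) :
    IsStableLine T (minorConn a (ρ + 1)) (minors x (ρ + 1)) := by
  refine ⟨h0, ?_⟩
  obtain ⟨J0, hJ0⟩ := Function.ne_iff.mp h0
  rw [Pi.zero_apply] at hJ0
  obtain ⟨e, he⟩ : ∃ e : Fin (ρ + 1) → ℚ⟦X⟧, ∀ l,
      minors x (ρ + 1) J0 * x (ρ + 1) l = ∑ i, e i * x i l := by
    let cof : Fin (ρ + 2) → ℚ⟦X⟧ := fun i => (-1) ^ ((i : ℕ) + (ρ + 1)) *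
      (Matrix.of fun (k c : Fin (ρ + 1)) => x (i.succAbove k) (J0 c)).det
    refine ⟨fun i => - cof i.castSucc, fun l => ?_⟩
    have h2 := congrFun h1 (Fin.snoc (α := fun _ => Fin N) J0 l)
    rw [minors, Matrix.det_succ_column _ (Fin.last (ρ + 1)), Pi.zero_apply] at h2
    have h3 : ∀ i : Fin (ρ + 2), ((Matrix.of fun (i b : Fin (ρ + 2)) =>
        x i (Fin.snoc (α := fun _ => Fin N) J0 l b)).submatrix i.succAbove
          (Fin.last (ρ + 1)).succAbove) =
        Matrix.of fun (k c : Fin (ρ + 1)) => x (i.succAbove k) (J0 c) := by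
      intro i
      ext k c
      simp
    simp only [h3, Matrix.of_apply, Fin.snoc_last, Fin.val_last] at h2
    rw [Fin.sum_univ_castSucc] at h2
    simp only [Fin.val_last, Fin.val_castSucc, Fin.succAbove_last] at h2
    have h4 : ((-1 : ℚ⟦X⟧)) ^ (ρ + 1 + (ρ + 1)) = 1 := Even.neg_one_pow ⟨_, rfl⟩
    rw [h4, one_mul] at h2
    simp only [neg_mul, Finset.sum_neg_distrib]
    rw [eq_neg_iff_add_eq_zero, ← h2, add_comm]
    congr 1
    · refine Finset.sum_congr rfl fun i _ => ?_
      simp only [cof, Fin.val_castSucc]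
      ring
    · rw [mul_comm]
      rfl
  refine ⟨minors x (ρ + 1) J0, e (Fin.last ρ), hJ0, fun J => ?_⟩
  rw [minors_connection x a T hx, ← Matrix.det_updateRow_smul]
  have : (minors x (ρ + 1) J0 • fun b => x (ρ + 1) (J b)) =
      ∑ i, e i • (Matrix.of fun (i b : Fin (ρ + 1)) => x i (J b)) i := by
    funext b
    simp [he, Finset.sum_apply]
  rw [this, Matrix.det_updateRow_sum]
  rfl

theorem natDegree_det_le {ρ : ℕ} {R : Type*} [CommRing R] (M : Matrix (Fin ρ) (Fin ρ) R[X]) (B : ℕ)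
    (hM : ∀ i j, (M i j).natDegree ≤ B) : M.det.natDegree ≤ ρ * B := by
  rw [Matrix.det_apply]
  refine Polynomial.natDegree_sum_le_of_forall_le _ _ fun σ _ => ?_
  have h1 : (∏ i, M (σ i) i).natDegree ≤ ρ * B := by
    refine (Polynomial.natDegree_prod_le _ _).trans ?_
    refine (Finset.sum_le_sum fun i _ => hM (σ i) i).trans ?_
    simp
  refine le_trans ?_ h1
  rw [Units.smul_def]
  exact Polynomial.natDegree_smul_le _ _

section

variable {N : ℕ}

/-- The operator on coefficient vectors induced by `T d/dz` on linear forms. -/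
def ESys.nab (S : ESys N) (P : Fin N → ℤ[X]) : Fin N → ℤ[X] := fun l =>
  S.T * Polynomial.derivative (P l) + ∑ j, P j * S.A j l

/-- The linear form with coefficients `P` in the functions of the system. -/
def ESys.form (S : ESys N) (P : Fin N → ℤ[X]) : ℚ⟦X⟧ := ∑ j, zq (P j) • S.y j

theorem D_coe (P : ℚ[X]) : D (P : ℚ⟦X⟧) = (Polynomial.derivative P : ℚ[X]) :=
  PowerSeries.derivative_coe P

theorem zq_derivative (P : ℤ[X]) :
    zq (Polynomial.derivative P) = Polynomial.derivative (zq P) := by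
  simp [zq, Polynomial.derivative_map]

theorem ESys.form_nab (S : ESys N) (P : Fin N → ℤ[X]) :
    S.form (S.nab P) = (zq S.T : ℚ⟦X⟧) * D (S.form P) := by
  have h1 : ∀ j, (zq S.T : ℚ⟦X⟧) * D (S.y j) = ∑ l, (zq (S.A j l) : ℚ⟦X⟧) * S.y l := by
    intro j
    simpa only [smul_eq_coe_mul] using S.hD j
  simp only [ESys.form, ESys.nab, smul_eq_coe_mul, D_mul, D_coe, map_add, map_mul,
    map_sum, zq_derivative, Polynomial.coe_add, Polynomial.coe_mul, mul_add, add_mul,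
    Finset.mul_sum, Finset.sum_add_distrib]
  congr 1
  · exact Finset.sum_congr rfl fun j _ => by ring
  · have h2 : ∀ j, (zq S.T : ℚ⟦X⟧) * ((zq (P j) : ℚ⟦X⟧) * D (S.y j)) =
        ∑ l, (zq (P j) : ℚ⟦X⟧) * (zq (S.A j l) : ℚ⟦X⟧) * S.y l := by
      intro j
      rw [mul_left_comm, h1, Finset.mul_sum]
      exact Finset.sum_congr rfl fun l _ => by ring
    simp only [h2]
    rw [Finset.sum_comm]
    refine Finset.sum_congr rfl fun l _ => ?_
    rw [← Finset.sum_mul]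
    congr 1
    rw [← Polynomial.coeToPowerSeries.ringHom_apply, map_sum]
    simp

/-- Bound for the growth of degrees under `nab`. -/
def ESys.deg (S : ESys N) : ℕ := S.T.natDegree + ∑ j, ∑ l, (S.A j l).natDegree

theorem ESys.natDegree_nab_le (S : ESys N) (P : Fin N → ℤ[X]) (n : ℕ)
    (hP : ∀ j, (P j).natDegree ≤ n) (l : Fin N) : (S.nab P l).natDegree ≤ n + S.deg := by
  refine (Polynomial.natDegree_add_le _ _).trans (max_le ?_ ?_)
  · refine Polynomial.natDegree_mul_le.trans ?_
    have := (Polynomial.natDegree_derivative_le (P l)).trans (Nat.sub_le_of_le_add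
      ((hP l).trans (Nat.le_add_right n 1)))
    unfold ESys.deg
    omega
  · refine Polynomial.natDegree_sum_le_of_forall_le _ _ fun j _ => ?_
    refine Polynomial.natDegree_mul_le.trans ?_
    have h1 : (S.A j l).natDegree ≤ ∑ l, (S.A j l).natDegree :=
      Finset.single_le_sum (f := fun l => (S.A j l).natDegree) (fun _ _ => Nat.zero_le _)
        (Finset.mem_univ l)
    have h2 : ∑ l, (S.A j l).natDegree ≤ ∑ j, ∑ l, (S.A j l).natDegree :=
      Finset.single_le_sum (f := fun j => ∑ l, (S.A j l).natDegree) (fun _ _ => Nat.zero_le _)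
        (Finset.mem_univ j)
    have := hP j
    unfold ESys.deg
    omega

theorem ESys.natDegree_nab_iterate_le (S : ESys N) (P : Fin N → ℤ[X]) (n : ℕ)
    (hP : ∀ j, (P j).natDegree ≤ n) (i : ℕ) (l : Fin N) :
    (S.nab^[i] P l).natDegree ≤ n + i * S.deg := by
  induction i generalizing l with
  | zero => simpa using hP l
  | succ i ih =>
    rw [Function.iterate_succ_apply']
    refine (S.natDegree_nab_le _ _ ih l).trans ?_
    rw [add_mul, one_mul]
    omega

theorem X_pow_dvd_D {f : ℚ⟦X⟧} {M : ℕ} (h : PowerSeries.X ^ (M + 1) ∣ f) :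
    PowerSeries.X ^ M ∣ D f := by
  rw [PowerSeries.X_pow_dvd_iff] at h ⊢
  intro m hm
  rw [coeff_D, h (m + 1) (by omega)]
  simp

theorem ESys.X_pow_dvd_form_nab_iterate (S : ESys N) (P : Fin N → ℤ[X]) (M i : ℕ)
    (h : PowerSeries.X ^ (M + i) ∣ S.form P) : PowerSeries.X ^ M ∣ S.form (S.nab^[i] P) := by
  induction i generalizing M with
  | zero => exact h
  | succ i ih =>
    rw [Function.iterate_succ_apply', ESys.form_nab]
    exact Dvd.dvd.mul_left (X_pow_dvd_D (ih (M + 1) (by convert h using 2; ring))) _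

theorem minors_eq_zero_of_det_eq_zero (x : ℕ → Fin N → ℚ⟦X⟧)
    (h : (Matrix.of fun i j : Fin N => x i j).det = 0) : minors x N = 0 := by
  obtain ⟨v, hv, hv0⟩ := Matrix.exists_vecMul_eq_zero_iff.mpr h
  funext J
  refine Matrix.exists_vecMul_eq_zero_iff.mp ⟨v, hv, ?_⟩
  funext b
  exact congrFun hv0 (J b)

theorem ESys.zero_estimate (S : ESys N) : ∃ c : ℕ, ∀ (n : ℕ) (P : Fin N → ℤ[X]), P ≠ 0 →
    (∀ j, (P j).natDegree ≤ n) → PowerSeries.X ^ ((N - 1) * n + c) ∣ S.form P →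
    (Matrix.of fun i j : Fin N => S.nab^[i] P j).det ≠ 0 := by
  classical
  let T : ℚ⟦X⟧ := (zq S.T : ℚ[X])
  have hT : T ≠ 0 := by
    have h1 : zq S.T ≠ 0 := fun h => S.T_ne (zq_injective (by rw [h, map_zero]))
    simpa [T] using h1
  let a : Fin N → Fin N → ℚ⟦X⟧ := fun j l => (zq (S.A j l) : ℚ[X])
  choose H hHfin hH using fun ρ : ℕ => exists_stableLine_space T hT (minorConn a (ρ + 1))
  let Φ : (ρ : ℕ) → (Fin (ρ + 1) → Fin N) → ((Fin (ρ + 1) → Fin N) → ℚ⟦X⟧) →ₗ[ℚ] ℚ⟦X⟧ :=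
    fun ρ J => ∑ l, (LinearMap.mulRight ℚ (S.y l)).comp
      (LinearMap.proj (Function.update J 0 l))
  have hΦ : ∀ ρ J ω, Φ ρ J ω = ∑ l, ω (Function.update J 0 l) * S.y l := by
    intro ρ J ω
    simp [Φ, LinearMap.sum_apply]
  choose c hc using fun (ρ : ℕ) (J : Fin (ρ + 1) → Fin N) =>
    exists_order_bound ((H ρ).map (Φ ρ J))
  refine ⟨∑ ρ ∈ Finset.range N, ∑ J, c ρ J + N + N * (N * S.deg) + 1,
    fun n P hP hdeg hvan hdet => ?_⟩
  let x : ℕ → Fin N → ℚ⟦X⟧ := fun i l => (zq (S.nab^[i] P l) : ℚ[X])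
  have hx : ∀ i l, T * D (x i l) = x (i + 1) l - ∑ j, x i j * a j l := by
    intro i l
    simp only [x, T, a, D_coe, Function.iterate_succ_apply']
    conv_rhs => rw [ESys.nab]
    simp only [map_add, map_mul, map_sum, zq_derivative, Polynomial.coe_add, Polynomial.coe_mul]
    rw [eq_sub_iff_add_eq, ← Polynomial.coeToPowerSeries.ringHom_apply (φ := ∑ j, _), map_sum]
    simp
  have hxpoly : ∀ (ρ : ℕ) (J : Fin ρ → Fin N), ∃ Q : ℚ[X], minors x ρ J = Q ∧
      Q.natDegree ≤ ρ * (n + ρ * S.deg) := by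
    intro ρ J
    refine ⟨(Matrix.of fun i b : Fin ρ => zq (S.nab^[i] P (J b))).det, ?_, ?_⟩
    · rw [← Polynomial.coeToPowerSeries.ringHom_apply, RingHom.map_det]
      rfl
    · refine natDegree_det_le _ _ fun i b => ?_
      refine (Polynomial.natDegree_map_le).trans ?_
      refine (S.natDegree_nab_iterate_le P n hdeg i (J b)).trans ?_
      gcongr
      exact i.2.le
  obtain ⟨j0, hj0⟩ := Function.ne_iff.mp hP
  have hN : 1 ≤ N := Nat.succ_le_of_lt (lt_of_le_of_lt (Nat.zero_le _) j0.2)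
  have hfull : minors x N = 0 := by
    apply minors_eq_zero_of_det_eq_zero
    have := congrArg (Polynomial.coeToPowerSeries.ringHom.comp zq) hdet
    rw [RingHom.map_det, map_zero] at this
    exact this
  have hex : ∃ ρ, minors x (ρ + 1) = 0 := ⟨N - 1, by
    rw [show N - 1 + 1 = N by omega]
    exact hfull⟩
  have hfind0 : Nat.find hex ≠ 0 := by
    intro h
    have := Nat.find_spec hex
    rw [h] at this
    have h1 := congrFun this (fun _ => j0)
    rw [minors, Matrix.det_fin_one] at h1
    simp only [Pi.zero_apply, Matrix.of_apply, x, Fin.val_zero, Function.iterate_zero, id] at h1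
    rw [Polynomial.coe_eq_zero_iff] at h1
    exact hj0 (zq_injective (by rw [h1, Pi.zero_apply, map_zero]))
  obtain ⟨ρ, hρ⟩ := Nat.exists_eq_succ_of_ne_zero hfind0
  have h0 : minors x (ρ + 1) ≠ 0 := Nat.find_min hex (m := ρ) (by omega)
  have h1 : minors x (ρ + 2) = 0 := by
    have := Nat.find_spec hex
    rw [hρ] at this
    exact this
  have hρN : ρ + 2 ≤ N := by
    have : Nat.find hex ≤ N - 1 := Nat.find_min' hex (by
      rw [show N - 1 + 1 = N by omega]
      exact hfull)
    omega
  obtain ⟨η, hηH, hη0, hη⟩ := hH ρ _ (isStableLine_minors x a T hx ρ h0 h1)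
  obtain ⟨J, hJ⟩ := Function.ne_iff.mp h0
  rw [Pi.zero_apply] at hJ
  obtain ⟨J', hJ'⟩ := Function.ne_iff.mp hη0
  rw [Pi.zero_apply] at hJ'
  have hηJ : η J ≠ 0 := by
    intro h
    have := hη J J'
    rw [h, mul_zero] at this
    exact (mul_ne_zero hJ hJ') this
  have hSω : Φ ρ J (minors x (ρ + 1)) ≠ 0 := by
    choose Q hQ _ using hxpoly (ρ + 1)
    intro h
    rw [hΦ] at h
    simp only [hQ, ← smul_eq_coe_mul] at h
    have := Fintype.linearIndependent_iff.mp S.indep _ h (J 0)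
    rw [Function.update_eq_self] at this
    apply hJ
    rw [hQ, this, Polynomial.coe_zero]
  have hrel : Φ ρ J (minors x (ρ + 1)) * η J = minors x (ρ + 1) J * Φ ρ J η := by
    rw [hΦ, hΦ, Finset.sum_mul, Finset.mul_sum]
    refine Finset.sum_congr rfl fun l _ => ?_
    linear_combination (S.y l) * hη (Function.update J 0 l) J
  have hSη : Φ ρ J η ≠ 0 := by
    intro h
    rw [h, mul_zero] at hrel
    exact (mul_ne_zero hSω hηJ) hrel
  obtain ⟨m, hm, hcoeff⟩ := hc ρ J _ (Submodule.mem_map_of_mem hηH) hSη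
  have hdvd : PowerSeries.X ^ ((N - 1) * n + (∑ ρ ∈ Finset.range N, ∑ J, c ρ J) +
      N * (N * S.deg) + 1) ∣ Φ ρ J (minors x (ρ + 1)) := by
    rw [hΦ]
    have := sum_mul_minors_update x (ρ + 1) J 0 S.y
    simp only [mul_comm (S.y _)] at this
    rw [this, ← Matrix.cramer_apply, Matrix.cramer_eq_adjugate_mulVec]
    rw [Matrix.mulVec, dotProduct]
    refine Finset.dvd_sum fun i _ => Dvd.dvd.mul_left ?_ _
    have := S.X_pow_dvd_form_nab_iterate P ((N - 1) * n + (∑ ρ ∈ Finset.range N, ∑ J, c ρ J) +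
      N * (N * S.deg) + 1) i ((pow_dvd_pow _ (by have := i.2; omega)).trans hvan)
    simpa only [ESys.form, smul_eq_coe_mul] using this
  obtain ⟨Q, hQ, hQdeg⟩ := hxpoly (ρ + 1) J
  have hQ0 : Q ≠ 0 := by
    rintro rfl
    exact hJ (by rw [hQ, Polynomial.coe_zero])
  have hord1 : (minors x (ρ + 1) J).order ≤ ((ρ + 1) * (n + (ρ + 1) * S.deg) : ℕ) := by
    rw [hQ]
    refine (PowerSeries.order_le Q.natDegree ?_).trans (by exact_mod_cast hQdeg)
    rw [Polynomial.coeff_coe]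
    simpa using hQ0
  have hord2 : (Φ ρ J η).order ≤ (m : ℕ) := PowerSeries.order_le m hcoeff
  have hord3 : ((((N - 1) * n + (∑ ρ ∈ Finset.range N, ∑ J, c ρ J) +
      N * (N * S.deg) + 1 : ℕ)) : ℕ∞) ≤ (minors x (ρ + 1) J * Φ ρ J η).order := by
    rw [← hrel]
    exact PowerSeries.le_order _ _ fun i hi =>
      PowerSeries.X_pow_dvd_iff.mp (hdvd.mul_right _) i (by exact_mod_cast hi)
  rw [PowerSeries.order_mul] at hord3
  have hfin := hord3.trans (add_le_add hord1 hord2)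
  have hfin' : (N - 1) * n + (∑ ρ ∈ Finset.range N, ∑ J, c ρ J) +
      N * (N * S.deg) + 1 ≤ (ρ + 1) * (n + (ρ + 1) * S.deg) + m := by exact_mod_cast hfin
  have hc1 : c ρ J ≤ ∑ J, c ρ J :=
    Finset.single_le_sum (f := fun J => c ρ J) (fun _ _ => Nat.zero_le _) (Finset.mem_univ J)
  have hc2 : ∑ J, c ρ J ≤ ∑ ρ ∈ Finset.range N, ∑ J, c ρ J :=
    Finset.single_le_sum (f := fun ρ => ∑ J, c ρ J) (fun _ _ => Nat.zero_le _)
      (Finset.mem_range.mpr (by omega))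
  have hn1 : (ρ + 1) * n ≤ (N - 1) * n := Nat.mul_le_mul_right _ (by omega)
  have hn2 : (ρ + 1) * ((ρ + 1) * S.deg) ≤ N * (N * S.deg) := by
    gcongr <;> omega
  rw [mul_add] at hfin'
  omega

end

/-- Factorial growth of coefficients and of their common denominators. -/
def Ctl (f : ℕ → ℚ) : Prop := ∃ (C : ℝ) (c : ℕ), 1 ≤ C ∧ ∀ b : ℕ, ∃ d : ℕ, 0 < d ∧
  (d : ℝ) ≤ C ^ (b + 1) * ((b : ℝ) + 1) ^ (c * b) ∧ ∀ i ≤ b, ∃ z : ℤ, (d : ℚ) * f i = z ∧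
    |(z : ℝ)| ≤ C ^ (b + 1) * ((b : ℝ) + 1) ^ (c * b)

theorem exists_eval_bound (q : ℤ[X]) : ∃ (B : ℝ) (c : ℕ), 1 ≤ B ∧
    ∀ x : ℕ, |((q.eval (x : ℤ) : ℤ) : ℝ)| ≤ B * ((x : ℝ) + 1) ^ c := by
  refine ⟨1 + ∑ i ∈ Finset.range (q.natDegree + 1), |(q.coeff i : ℝ)|, q.natDegree, ?_,
    fun x => ?_⟩
  · have : 0 ≤ ∑ i ∈ Finset.range (q.natDegree + 1), |(q.coeff i : ℝ)| :=
      Finset.sum_nonneg fun i _ => abs_nonneg _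
    linarith
  · rw [Polynomial.eval_eq_sum_range]
    push_cast
    refine (Finset.abs_sum_le_sum_abs _ _).trans ?_
    rw [add_mul, Finset.sum_mul]
    refine le_add_of_nonneg_of_le (by positivity) (Finset.sum_le_sum fun i hi => ?_)
    rw [abs_mul, abs_pow, Nat.abs_cast]
    gcongr
    refine (pow_le_pow_left₀ (by positivity) (by linarith : (x : ℝ) ≤ x + 1) i).trans ?_
    exact pow_le_pow_right₀ (by linarith [(Nat.cast_nonneg x : (0 : ℝ) ≤ x)])
      (by simpa [Nat.lt_succ_iff] using hi)

theorem ctl_of_recurrence (f : ℕ → ℚ) (h : ℕ) (q : ℕ → ℤ[X]) (hq : q 0 ≠ 0)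
    (hrec : ∀ x, h ≤ x → ∑ e ∈ Finset.range (h + 1),
      (((q e).eval ((x - e : ℕ) : ℤ) : ℤ) : ℚ) * f (x - e) = 0) : Ctl f := by
  classical
  choose B c hB hBc using fun e => exists_eval_bound (q e)
  let B0 : ℝ := ∑ e ∈ Finset.range (h + 1), B e
  let c0 : ℕ := ∑ e ∈ Finset.range (h + 1), c e
  have hBle : ∀ e ∈ Finset.range (h + 1), B e ≤ B0 := fun e he =>
    Finset.single_le_sum (f := B) (fun i _ => by linarith [hB i]) he
  have hcle : ∀ e ∈ Finset.range (h + 1), c e ≤ c0 := fun e he =>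
    Finset.single_le_sum (f := c) (fun i _ => Nat.zero_le _) he
  have hB0 : 1 ≤ B0 := (hB 0).trans (hBle 0 (by simp))
  have hbd : ∀ e ∈ Finset.range (h + 1), ∀ x y : ℕ, x ≤ y →
      |(((q e).eval (x : ℤ) : ℤ) : ℝ)| ≤ B0 * ((y : ℝ) + 1) ^ c0 := by
    intro e he x y hxy
    refine (hBc e x).trans ?_
    have hxy' : (x : ℝ) ≤ y := by exact_mod_cast hxy
    have h0 : (0 : ℝ) ≤ x := Nat.cast_nonneg x
    calc B e * ((x : ℝ) + 1) ^ c e ≤ B0 * ((y : ℝ) + 1) ^ c e := by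
          have := hBle e he
          gcongr
      _ ≤ B0 * ((y : ℝ) + 1) ^ c0 := by
          have := hcle e he
          gcongr
          linarith
  obtain ⟨x0, hx0h, hx0⟩ : ∃ x0, h ≤ x0 ∧ ∀ x : ℕ, x0 ≤ x → (q 0).eval (x : ℤ) ≠ 0 := by
    have hfin := (Polynomial.finite_setOfPred_isRoot hq).preimage
      (f := fun x : ℕ => (x : ℤ)) (Nat.cast_injective.injOn)
    obtain ⟨m, hm⟩ := hfin.bddAbove
    refine ⟨max h (m + 1), le_max_left _ _, fun x hx hroot => ?_⟩
    have := hm (show x ∈ _ from hroot)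
    have := (le_max_right h (m + 1)).trans hx
    omega
  let d0 : ℕ := ∏ i ∈ Finset.range (x0 + 1), (f i).den
  have hd0 : 0 < d0 := Finset.prod_pos fun i _ => (f i).den_pos
  have hd0i : ∀ i ≤ x0, ∃ z : ℤ, (d0 : ℚ) * f i = z := by
    intro i hi
    obtain ⟨k, hk⟩ := Finset.dvd_prod_of_mem (fun i => (f i).den)
      (Finset.mem_range.mpr (Nat.lt_succ_of_le hi))
    refine ⟨k * (f i).num, ?_⟩
    rw [show d0 = (f i).den * k from hk]
    push_cast
    rw [mul_comm ((f i).den : ℚ), mul_assoc, Rat.den_mul_eq_num]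
  let H0 : ℝ := d0 + ∑ i ∈ Finset.range (x0 + 1), |((d0 * f i : ℚ) : ℝ)|
  have hd0H : (d0 : ℝ) ≤ H0 :=
    le_add_of_nonneg_right (Finset.sum_nonneg fun i _ => abs_nonneg _)
  have hH0 : 1 ≤ H0 := le_trans (by exact_mod_cast hd0) hd0H
  let B1 : ℝ := ((h : ℝ) + 1) * B0
  have hB1 : B0 ≤ B1 := by
    have : (0 : ℝ) ≤ h := Nat.cast_nonneg h
    simp only [B1]
    nlinarith
  have hbase : ∀ i ≤ x0, ∃ z : ℤ, (d0 : ℚ) * f i = z ∧ |(z : ℝ)| ≤ H0 := by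
    intro i hi
    obtain ⟨z, hz⟩ := hd0i i hi
    refine ⟨z, hz, ?_⟩
    have h1 : |((d0 * f i : ℚ) : ℝ)| ≤ ∑ i ∈ Finset.range (x0 + 1), |((d0 * f i : ℚ) : ℝ)| :=
      Finset.single_le_sum (f := fun i => |((d0 * f i : ℚ) : ℝ)|) (fun _ _ => abs_nonneg _)
        (Finset.mem_range.mpr (Nat.lt_succ_of_le hi))
    rw [hz] at h1
    have h2 : (0 : ℝ) ≤ d0 := Nat.cast_nonneg _
    simp only [H0]
    push_cast at h1 ⊢
    linarith
  have hmain : ∀ n : ℕ, ∃ d : ℕ, 0 < d ∧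
      (d : ℝ) ≤ H0 * (B1 * (((x0 + n : ℕ) : ℝ) + 1) ^ c0) ^ n ∧
      ∀ i ≤ x0 + n, ∃ z : ℤ, (d : ℚ) * f i = z ∧
        |(z : ℝ)| ≤ H0 * (B1 * (((x0 + n : ℕ) : ℝ) + 1) ^ c0) ^ n := by
    intro n
    induction n with
    | zero => exact ⟨d0, hd0, by simpa using hd0H, fun i hi => by simpa using hbase i hi⟩
    | succ n ih =>
      obtain ⟨d, hd, hdle, hdi⟩ := ih
      set x := x0 + (n + 1) with hx
      set w : ℤ := (q 0).eval (x : ℤ) with hw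
      have hw0 : w ≠ 0 := hx0 x (by omega)
      set G : ℝ := H0 * (B1 * (((x0 + n : ℕ) : ℝ) + 1) ^ c0) ^ n with hG
      set Z : ℝ := B1 * ((x : ℝ) + 1) ^ c0 with hZ
      have hG0 : 0 ≤ G := by positivity
      have hZG : Z * G ≤ H0 * Z ^ (n + 1) := by
        have : G ≤ H0 * Z ^ n := by
          rw [hG, hZ, hx]
          gcongr
          omega
        calc Z * G ≤ Z * (H0 * Z ^ n) := by gcongr
          _ = _ := by ring
      have hwZ' : |(w : ℝ)| ≤ B0 * ((x : ℝ) + 1) ^ c0 := hbd 0 (by simp) x x le_rfl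
      have hwZ : |(w : ℝ)| ≤ Z := hwZ'.trans (by rw [hZ]; gcongr)
      obtain ⟨v, hv0, hwnat, hvw⟩ : ∃ v : ℕ, 0 < v ∧ (v : ℝ) = |(w : ℝ)| ∧
          ((v : ℤ) = w ∨ (v : ℤ) = -w) := by
        refine ⟨w.natAbs, Int.natAbs_pos.mpr hw0, ?_, by omega⟩
        rw [← Int.cast_abs, Nat.cast_natAbs]
      refine ⟨v * d, Nat.mul_pos hv0 hd, ?_, fun i hi => ?_⟩
      · push_cast [hwnat]
        exact (mul_le_mul hwZ hdle (Nat.cast_nonneg _) ((abs_nonneg _).trans hwZ)).trans hZG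
      · rcases Nat.lt_or_ge i x with hlt | hge
        · obtain ⟨z, hz, hzle⟩ := hdi i (by omega)
          refine ⟨v * z, ?_, ?_⟩
          · push_cast
            rw [mul_assoc, hz]
          · push_cast
            rw [abs_mul, hwnat, abs_abs]
            exact (mul_le_mul hwZ hzle (abs_nonneg _) ((abs_nonneg _).trans hwZ)).trans hZG
        · obtain rfl : i = x := le_antisymm hi hge
          have hr := hrec x (by omega)
          rw [Finset.sum_range_succ'] at hr
          simp only [Nat.sub_zero] at hr
          have hz : ∀ e : ℕ, ∃ z : ℤ, e < h → (d : ℚ) * f (x - (e + 1)) = z ∧ |(z : ℝ)| ≤ G := by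
            intro e
            by_cases he : e < h
            · obtain ⟨z, hz⟩ := hdi (x - (e + 1)) (by omega)
              exact ⟨z, fun _ => hz⟩
            · exact ⟨0, fun h => absurd h he⟩
          choose z hz using hz
          set s : ℤ := ∑ e ∈ Finset.range h,
            (q (e + 1)).eval ((x - (e + 1) : ℕ) : ℤ) * z e with hs
          have hs' : (w : ℚ) * (d * f x) = -s := by
            have h1 : (s : ℚ) = d * ∑ e ∈ Finset.range h,
                (((q (e + 1)).eval ((x - (e + 1) : ℕ) : ℤ) : ℤ) : ℚ) * f (x - (e + 1)) := by
              rw [hs, Finset.mul_sum]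
              push_cast
              refine Finset.sum_congr rfl fun e he => ?_
              rw [← (hz e (Finset.mem_range.mp he)).1]
              ring
            rw [h1]
            linear_combination (d : ℚ) * hr
          have hsle : |(s : ℝ)| ≤ Z * G := by
            rw [hs]
            push_cast
            refine (Finset.abs_sum_le_sum_abs _ _).trans ?_
            have h2 : ∀ e ∈ Finset.range h,
                |(((q (e + 1)).eval ((x - (e + 1) : ℕ) : ℤ) : ℤ) : ℝ) * (z e : ℝ)| ≤
                  (B0 * ((x : ℝ) + 1) ^ c0) * G := by
              intro e he
              rw [abs_mul]
              rw [Finset.mem_range] at he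
              exact mul_le_mul (hbd (e + 1) (by simpa using he) _ x (by omega))
                (hz e he).2 (abs_nonneg _) (by positivity)
            have h3 := Finset.sum_le_sum h2
            rw [Finset.sum_const, Finset.card_range, nsmul_eq_mul] at h3
            refine le_trans (by simpa using h3) ?_
            rw [hZ]
            simp only [B1]
            have : 0 ≤ B0 * ((x : ℝ) + 1) ^ c0 * G := by positivity
            nlinarith
          rcases hvw with hpos | hneg
          · refine ⟨-s, ?_, ?_⟩
            · push_cast
              rw [← hs', mul_assoc]
              congr 1
              exact_mod_cast hpos
            · push_cast
              rw [abs_neg]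
              exact hsle.trans hZG
          · refine ⟨s, ?_, hsle.trans hZG⟩
            have : (v : ℚ) = -(w : ℚ) := by exact_mod_cast hneg
            push_cast
            rw [this]
            linear_combination - hs'
  refine ⟨H0 * B1, c0, one_le_mul_of_one_le_of_one_le hH0 (hB0.trans hB1), fun b => ?_⟩
  have hB11 : 1 ≤ B1 := hB0.trans hB1
  have hb1 : (1 : ℝ) ≤ (b : ℝ) + 1 := by linarith [(Nat.cast_nonneg b : (0 : ℝ) ≤ b)]
  have hHB : 1 ≤ H0 * B1 := one_le_mul_of_one_le_of_one_le hH0 hB11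
  rcases le_total b x0 with hbx | hbx
  · have hle : H0 ≤ (H0 * B1) ^ (b + 1) * ((b : ℝ) + 1) ^ (c0 * b) := by
      calc H0 ≤ H0 * B1 := le_mul_of_one_le_right (by linarith) hB11
        _ ≤ (H0 * B1) ^ (b + 1) := le_self_pow₀ hHB (by omega)
        _ ≤ _ := le_mul_of_one_le_right (by positivity) (one_le_pow₀ hb1)
    refine ⟨d0, hd0, hd0H.trans hle, fun i hi => ?_⟩
    obtain ⟨z, hz, hz'⟩ := hbase i (hi.trans hbx)
    exact ⟨z, hz, hz'.trans hle⟩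
  · obtain ⟨n, rfl⟩ := Nat.exists_eq_add_of_le hbx
    obtain ⟨d, hd, hdle, hdi⟩ := hmain n
    have hle : H0 * (B1 * (((x0 + n : ℕ) : ℝ) + 1) ^ c0) ^ n ≤
        (H0 * B1) ^ (x0 + n + 1) * (((x0 + n : ℕ) : ℝ) + 1) ^ (c0 * (x0 + n)) := by
      clear_value B1 H0
      rw [mul_pow, ← pow_mul, mul_pow H0, mul_assoc]
      have e1 : H0 ≤ H0 ^ (x0 + n + 1) := le_self_pow₀ hH0 (by omega)
      have e2 : B1 ^ n ≤ B1 ^ (x0 + n + 1) := pow_le_pow_right₀ hB11 (by omega)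
      have e3 : (((x0 + n : ℕ) : ℝ) + 1) ^ (c0 * n) ≤
          (((x0 + n : ℕ) : ℝ) + 1) ^ (c0 * (x0 + n)) :=
        pow_le_pow_right₀ hb1 (Nat.mul_le_mul_left _ (by omega))
      gcongr
    refine ⟨d, hd, hdle.trans hle, fun i hi => ?_⟩
    obtain ⟨z, hz, hz'⟩ := hdi i hi
    exact ⟨z, hz, hz'.trans hle⟩

theorem coeff_iterate_D (f : ℚ⟦X⟧) (i n : ℕ) : PowerSeries.coeff n (D^[i] f) =
    ((n + i).descFactorial i : ℚ) * PowerSeries.coeff (n + i) f := by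
  have := PowerSeries.coeff_iterate_derivative f i n
  rw [← Nat.add_descFactorial_eq_ascFactorial] at this
  exact this

theorem ctl_of_ode_int (f : ℚ⟦X⟧) (m : ℕ) (p : ℕ → ℤ[X]) (hp : p m ≠ 0)
    (h : ∑ i ∈ Finset.range (m + 1), (zq (p i) : ℚ⟦X⟧) * D^[i] f = 0) :
    Ctl fun n => PowerSeries.coeff n f := by
  classical
  let E : ℕ := ∑ i ∈ Finset.range (m + 1), (p i).natDegree
  have hE : ∀ i ∈ Finset.range (m + 1), ∀ e, E < e → (p i).coeff e = 0 := by
    intro i hi e he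
    apply Polynomial.coeff_eq_zero_of_natDegree_lt
    exact lt_of_le_of_lt (Finset.single_le_sum (f := fun i => (p i).natDegree)
      (fun _ _ => Nat.zero_le _) hi) he
  let Q : ℕ → ℤ[X] := fun s => ∑ i ∈ Finset.range (m + 1),
    Polynomial.C (if m ≤ s + i then (p i).coeff (s + i - m) else 0) * descPochhammer ℤ i
  have hQrec : ∀ n, E ≤ n → ∑ s ∈ Finset.range (E + m + 1),
      (((Q s).eval ((n + m - s : ℕ) : ℤ) : ℤ) : ℚ) * PowerSeries.coeff (n + m - s) f = 0 := by
    intro n hn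
    have hc := congrArg (PowerSeries.coeff n) h
    rw [map_sum, map_zero] at hc
    rw [← hc]
    simp only [Q, Polynomial.eval_finsetSum, Polynomial.eval_mul, Polynomial.eval_C,
      descPochhammer_eval_eq_descFactorial, Int.cast_sum, Finset.sum_mul]
    rw [Finset.sum_comm]
    refine Finset.sum_congr rfl fun i hi => ?_
    have him : i ≤ m := by simpa [Nat.lt_succ_iff] using hi
    rw [PowerSeries.coeff_mul, Finset.Nat.sum_antidiagonal_eq_sum_range_succ_mk]
    rw [show E + m + 1 = (m - i) + (E + i + 1) by omega, Finset.sum_range_add]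
    rw [Finset.sum_eq_zero (s := Finset.range (m - i)), zero_add]
    · have h1 : ∀ (a : ℕ), E + 1 ≤ a → a ≤ n + i + 1 → ∑ e ∈ Finset.range a,
          ((p i).coeff e : ℚ) * (((n + i - e).descFactorial i : ℚ) *
            PowerSeries.coeff (n + i - e) f) =
          ∑ e ∈ Finset.range (E + 1), ((p i).coeff e : ℚ) *
            (((n + i - e).descFactorial i : ℚ) * PowerSeries.coeff (n + i - e) f) := by
        intro a ha _
        symm
        refine Finset.sum_subset (fun x hx => ?_) fun x hx hx' => ?_
        · simp only [Finset.mem_range] at hx ⊢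
          omega
        · rw [hE i hi x (by simpa [Nat.lt_succ_iff] using hx')]
          simp
      trans ∑ e ∈ Finset.range (E + i + 1), ((p i).coeff e : ℚ) *
            (((n + i - e).descFactorial i : ℚ) * PowerSeries.coeff (n + i - e) f)
      · refine Finset.sum_congr rfl fun e _ => ?_
        rw [if_pos (by omega), show m - i + e + i - m = e by omega,
          show n + m - (m - i + e) = n + i - e by omega]
        push_cast
        ring
      · rw [h1 _ (by omega) (by omega), ← h1 (n + 1) (by omega) (by omega)]
        refine Finset.sum_congr rfl fun e he => ?_
        have : e ≤ n := by simpa [Nat.lt_succ_iff] using he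
        rw [coeff_iterate_D, Polynomial.coeff_coe, zq_coeff,
          show n - e + i = n + i - e by omega]
    · intro s hs
      rw [Finset.mem_range] at hs
      rw [if_neg (by omega)]
      simp
  obtain ⟨s1, hs1⟩ : ∃ s, Q s ≠ 0 := by
    obtain ⟨e, he⟩ : ∃ e, (p m).coeff e ≠ 0 := by
      by_contra! hcon
      exact hp (Polynomial.ext hcon)
    refine ⟨e, fun h0 => he ?_⟩
    have h1 := congrArg (fun q : ℤ[X] => q.coeff m) h0
    simp only [Q, Polynomial.finsetSum_coeff, Polynomial.coeff_C_mul, Polynomial.coeff_zero] at h1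
    rw [Finset.sum_range_succ, Finset.sum_eq_zero, zero_add, if_pos (by omega),
      Nat.add_sub_cancel] at h1
    · have h2 : (descPochhammer ℤ m).coeff m = 1 := by
        have := (monic_descPochhammer ℤ m).coeff_natDegree
        rwa [descPochhammer_natDegree] at this
      rwa [h2, mul_one] at h1
    · intro i hi
      have h2 : (descPochhammer ℤ i).coeff m = 0 := by
        apply Polynomial.coeff_eq_zero_of_natDegree_lt
        rw [descPochhammer_natDegree]
        exact Finset.mem_range.mp hi
      rw [h2, mul_zero]
  have hex : ∃ s, Q s ≠ 0 := ⟨s1, hs1⟩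
  set s0 := Nat.find hex with hs0
  have hs0ne : Q s0 ≠ 0 := Nat.find_spec hex
  have hs0min : ∀ s < s0, Q s = 0 := fun s hs => by
    by_contra hne
    exact Nat.find_min hex hs hne
  have hs0le : s0 ≤ E + m := by
    by_contra! hlt
    apply hs0ne
    simp only [Q]
    refine Finset.sum_eq_zero fun i hi => ?_
    have him : i ≤ m := by simpa [Nat.lt_succ_iff] using hi
    rw [if_pos (by omega)]
    rcases Nat.lt_or_ge E (s0 + i - m) with h1 | h1
    · rw [hE i hi _ h1]
      simp
    · omega
  refine ctl_of_recurrence _ (E + m - s0) (fun e => Q (s0 + e)) hs0ne fun x hx => ?_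
  have h1 := hQrec (x + s0 - m) (by omega)
  rw [show E + m + 1 = s0 + (E + m - s0 + 1) by omega, Finset.sum_range_add,
    Finset.sum_eq_zero, zero_add] at h1
  · rw [← h1]
    refine Finset.sum_congr rfl fun e he => ?_
    rw [show x + s0 - m + m - (s0 + e) = x - e by omega]
  · intro s hs
    rw [hs0min s (Finset.mem_range.mp hs)]
    simp

theorem pow_smul_iterate_D_mem {M : Submodule ℚ[X] ℚ⟦X⟧} {T : ℚ[X]}
    (hT : ∀ f ∈ M, T • D f ∈ M) {f : ℚ⟦X⟧} (hf : f ∈ M) (i : ℕ) : T ^ i • D^[i] f ∈ M := by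
  induction i with
  | zero => simpa using hf
  | succ i ih =>
    have h1 := M.sub_mem (hT _ ih)
      (M.smul_mem ((i : ℚ[X]) * Polynomial.derivative T) ih)
    convert h1 using 1
    rw [Function.iterate_succ_apply', smul_eq_coe_mul, smul_eq_coe_mul, smul_eq_coe_mul,
      smul_eq_coe_mul, D_mul, D_coe, Polynomial.derivative_pow]
    rcases i with _ | i
    · simp
    · push_cast
      have : (PowerSeries.C ((i : ℚ) + 1) : ℚ⟦X⟧) = (i : ℚ⟦X⟧) + 1 := by simp
      rw [this]
      have h2 : ((i : ℚ[X]) : ℚ⟦X⟧) = (i : ℚ⟦X⟧) :=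
        map_natCast (Polynomial.coeToPowerSeries.ringHom (R := ℚ)) i
      rw [h2]
      ring

theorem exists_ode {M : Submodule ℚ[X] ℚ⟦X⟧} (hM : IsEModule M) {f : ℚ⟦X⟧} (hf : f ∈ M) :
    ∃ (m : ℕ) (p : ℕ → ℤ[X]), p m ≠ 0 ∧
      ∑ i ∈ Finset.range (m + 1), (zq (p i) : ℚ⟦X⟧) * D^[i] f = 0 := by
  classical
  obtain ⟨hfg, -, T, hT0, hT⟩ := hM
  have : Module.Finite ℚ[X] M := Module.Finite.iff_fg.mpr hfg
  let g : ℕ → M := fun i => ⟨T ^ i • D^[i] f, pow_smul_iterate_D_mem hT hf i⟩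
  have hg : ¬ LinearIndependent ℚ[X] g := fun h => by
    have := h.finite
    exact not_finite ℕ
  rw [linearIndependent_iff] at hg
  push Not at hg
  obtain ⟨l, hl, hl0⟩ := hg
  have hne : l.support.Nonempty := Finsupp.support_nonempty_iff.mpr hl0
  obtain ⟨m, hlm, hmax⟩ : ∃ m, l m ≠ 0 ∧ ∀ i ∈ l.support, i ≤ m :=
    ⟨_, Finsupp.mem_support_iff.mp (l.support.max'_mem hne), fun i hi => l.support.le_max' i hi⟩
  have hsum : ∑ i ∈ Finset.range (m + 1), (l i * T ^ i) • D^[i] f = 0 := by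
    have h1 := congrArg (Submodule.subtype M) hl
    rw [Finsupp.linearCombination_apply, Finsupp.sum, map_sum, map_zero] at h1
    rw [← h1]
    symm
    trans ∑ i ∈ l.support, (l i * T ^ i) • D^[i] f
    · refine Finset.sum_congr rfl fun i _ => ?_
      simp [g, mul_smul]
    · refine Finset.sum_subset (fun i hi => ?_) fun i _ hi => ?_
      · exact Finset.mem_range.mpr (Nat.lt_succ_of_le (hmax i hi))
      · rw [Finsupp.notMem_support_iff.mp hi]
        simp
  obtain ⟨c, P, hc, hP⟩ : ∃ (c : ℚ) (P : Fin (m + 1) → ℤ[X]), c ≠ 0 ∧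
      ∀ i, zq (P i) = Polynomial.C c * (l i * T ^ (i : ℕ)) := by
    obtain ⟨c, P, hc, hP⟩ := exists_common_integer_multiple
      (fun i : Fin (m + 1) => l i * T ^ (i : ℕ))
    exact ⟨c, P, Int.cast_ne_zero.mpr hc, hP⟩
  refine ⟨m, fun i => if h : i < m + 1 then P ⟨i, h⟩ else 0, ?_, ?_⟩
  · simp only [Nat.lt_succ_self, dif_pos]
    intro h0
    have h3 : Polynomial.C c * (l m * T ^ m) = 0 := by
      rw [← map_zero zq, ← h0]
      exact (hP ⟨m, Nat.lt_succ_self m⟩).symm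
    exact mul_ne_zero (Polynomial.C_ne_zero.mpr hc) (mul_ne_zero hlm (pow_ne_zero _ hT0)) h3
  · have h2 : ∑ i ∈ Finset.range (m + 1), Polynomial.C c • ((l i * T ^ i) • D^[i] f) = 0 := by
      rw [← Finset.smul_sum, hsum, smul_zero]
    rw [← h2]
    refine Finset.sum_congr rfl fun i hi => ?_
    have h4 : zq (if h : i < m + 1 then P ⟨i, h⟩ else 0) = Polynomial.C c * (l i * T ^ i) := by
      rw [dif_pos (Finset.mem_range.mp hi), hP]
    rw [h4, ← smul_eq_coe_mul, mul_smul]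

/-- Apply a `ℚ`-linear functional to all coefficients of a power series. -/
def comp (φ : ℂ →ₗ[ℚ] ℚ) : ℂ⟦X⟧ →ₗ[ℚ] ℚ⟦X⟧ where
  toFun F := PowerSeries.mk fun n => φ (PowerSeries.coeff n F)
  map_add' F G := by ext n; simp
  map_smul' c F := by ext n; simp

theorem coeff_comp (φ : ℂ →ₗ[ℚ] ℚ) (F : ℂ⟦X⟧) (n : ℕ) :
    PowerSeries.coeff n (comp φ F) = φ (PowerSeries.coeff n F) := by
  simp [comp]

theorem comp_qc_mul (φ : ℂ →ₗ[ℚ] ℚ) (P : ℚ⟦X⟧) (F : ℂ⟦X⟧) :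
    comp φ (qc P * F) = P * comp φ F := by
  ext n
  rw [coeff_comp, PowerSeries.coeff_mul, PowerSeries.coeff_mul, map_sum]
  refine Finset.sum_congr rfl fun i _ => ?_
  rw [PowerSeries.coeff_map, ← Algebra.smul_def, map_smul, coeff_comp, smul_eq_mul]

theorem comp_derivative (φ : ℂ →ₗ[ℚ] ℚ) (F : ℂ⟦X⟧) :
    comp φ (PowerSeries.derivative ℂ F) = D (comp φ F) := by
  ext n
  rw [coeff_comp, PowerSeries.coeff_derivative, coeff_D, coeff_comp]
  have : PowerSeries.coeff (n + 1) F * ((n : ℂ) + 1) =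
      ((n : ℚ) + 1) • PowerSeries.coeff (n + 1) F := by
    rw [Algebra.smul_def, mul_comm]; simp
  rw [this, map_smul, smul_eq_mul, mul_comm]

theorem comp_tau_iterate_D (φ : ℂ →ₗ[ℚ] ℚ) (f : ℚ⟦X⟧) (i : ℕ) :
    comp φ (tau (D^[i] f)) = D^[i] (comp φ (tau f)) := by
  induction i with
  | zero => rfl
  | succ i ih => rw [Function.iterate_succ_apply', tau_D, comp_derivative, ih,
      Function.iterate_succ_apply']

theorem rtau_zq (p : ℤ[X]) : rtau (zq p) = (zq (Polynomial.taylor 1 p) : ℚ⟦X⟧) := by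
  rw [rtau_apply]
  congr 1
  simp only [zq, Polynomial.coe_mapRingHom]
  have := Polynomial.map_taylor p 1 (Int.castRingHom ℚ)
  rw [map_one] at this
  exact this.symm

theorem ctl_comp_tau {f : ℚ⟦X⟧} (hf : f ∈ eAlg) (φ : ℂ →ₗ[ℚ] ℚ) :
    Ctl fun n => PowerSeries.coeff n (comp φ (tau f)) := by
  obtain ⟨M, hM, hfM⟩ := mem_eAlg.mp hf
  obtain ⟨m, p, hp, h⟩ := exists_ode hM hfM
  have hgr := gr_of_mem_eAlg hf
  refine ctl_of_ode_int _ m (fun i => Polynomial.taylor 1 (p i)) ?_ ?_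
  · intro h0
    exact hp (Polynomial.taylor_injective (1 : ℤ) (by simpa using h0))
  · have h1 := congrArg (fun g => comp φ (tau g)) h
    simp only [tau_zero, map_zero] at h1
    rw [tau_sum _ _ fun i _ => (gr_coe _).mul (hgr.iterate_D i), map_sum] at h1
    rw [← h1]
    refine Finset.sum_congr rfl fun i _ => ?_
    rw [tau_mul (gr_coe _) (hgr.iterate_D i), tau_coe, comp_qc_mul, comp_tau_iterate_D, rtau_zq]

/-- Siegel's lemma with a natural number exponent. -/
theorem exists_small_int_solution {α β : Type*} [Fintype α] [Fintype β] (A : Matrix α β ℤ)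
    (B : ℝ) (e : ℕ) (hB : 1 ≤ B) (hA : ∀ i j, |(A i j : ℝ)| ≤ B)
    (hcard : Fintype.card α < Fintype.card β) (hpos : 0 < Fintype.card α)
    (he : Fintype.card α ≤ e * (Fintype.card β - Fintype.card α)) :
    ∃ t : β → ℤ, t ≠ 0 ∧ A.mulVec t = 0 ∧ ∀ j, |(t j : ℝ)| ≤ (Fintype.card β * B) ^ e := by
  obtain ⟨t, ht0, ht, hle⟩ := Int.Matrix.exists_ne_zero_int_vec_norm_le A hcard hpos
  refine ⟨t, ht0, ht, fun j => ?_⟩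
  let : SeminormedAddCommGroup (Matrix α β ℤ) := Matrix.seminormedAddCommGroup
  have h1 : |(t j : ℝ)| ≤ ‖t‖ := by
    have := norm_le_pi_norm t j
    rwa [Int.norm_eq_abs] at this
  have hAB : max 1 ‖A‖ ≤ B := by
    refine max_le hB ((Matrix.norm_le_iff (by linarith)).mpr fun i j => ?_)
    rw [Int.norm_eq_abs]
    exact hA i j
  have hcβ : (1 : ℝ) ≤ Fintype.card β := by exact_mod_cast (by omega : 1 ≤ Fintype.card β)
  refine (h1.trans hle).trans ?_
  have h2 : (1 : ℝ) ≤ max 1 ‖A‖ := le_max_left _ _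
  calc _ ≤ ((Fintype.card β : ℝ) * max 1 ‖A‖) ^ (e : ℝ) := by
        apply Real.rpow_le_rpow_of_exponent_le
        · nlinarith
        · have h3 : (0 : ℝ) < (Fintype.card β : ℝ) - Fintype.card α := by
            rw [sub_pos]; exact_mod_cast hcard
          rw [div_le_iff₀ h3]
          rw [← Nat.cast_sub hcard.le]
          exact_mod_cast he
    _ = ((Fintype.card β : ℝ) * max 1 ‖A‖) ^ e := Real.rpow_natCast _ _
    _ ≤ _ := by gcongr

/-- The power series `R` vanishes to order `M` and `|Rₘ| ≤ B Cᵐ / m!`. -/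
def Bd (B C : ℝ) (M : ℕ) (R : ℚ⟦X⟧) : Prop :=
  (∀ m < M, PowerSeries.coeff m R = 0) ∧
    ∀ m, |((PowerSeries.coeff m R : ℚ) : ℝ)| ≤ B * C ^ m / m.factorial

/-- All coefficients of the polynomial `P` are bounded by `B`. -/
def Bo (B : ℝ) (P : ℤ[X]) : Prop := ∀ i, |(P.coeff i : ℝ)| ≤ B

/-- The polynomials attached to the unknowns of the Padé approximation problem. -/
def padePoly {N n : ℕ} (p : Fin N × Fin (n + 1) → ℤ) (j : Fin N) : ℤ[X] :=
  ∑ i : Fin (n + 1), Polynomial.C ((n.descFactorial (n - i) : ℤ) * p (j, i)) *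
    Polynomial.X ^ (i : ℕ)

theorem padePoly_coeff {N n : ℕ} (p : Fin N × Fin (n + 1) → ℤ) (j : Fin N) (m : ℕ) :
    (padePoly p j).coeff m =
      if h : m < n + 1 then (n.descFactorial (n - m) : ℤ) * p (j, ⟨m, h⟩) else 0 := by
  simp only [padePoly, Polynomial.finsetSum_coeff, Polynomial.coeff_C_mul_X_pow]
  split_ifs with h
  · rw [Finset.sum_eq_single ⟨m, h⟩]
    · simp
    · intro b _ hb
      rw [if_neg]
      rintro rfl
      exact hb rfl
    · simp
  · refine Finset.sum_eq_zero fun i _ => ?_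
    rw [if_neg]
    rintro rfl
    exact h i.2

theorem coeff_form_padePoly {N n : ℕ} (S : ESys N) (p : Fin N × Fin (n + 1) → ℤ) (m : ℕ) :
    (m.factorial : ℚ) * PowerSeries.coeff m (S.form (padePoly p)) =
      n.factorial * ∑ x : Fin N × Fin (n + 1), (m.choose x.2 : ℚ) *
        (((m - x.2).factorial : ℚ) * PowerSeries.coeff (m - x.2) (S.y x.1)) * p x := by
  rw [ESys.form, map_sum, Finset.mul_sum, Fintype.sum_prod_type, Finset.mul_sum]
  refine Finset.sum_congr rfl fun j _ => ?_
  rw [padePoly, map_sum, Finset.sum_smul, map_sum, Finset.mul_sum, Finset.mul_sum]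
  refine Finset.sum_congr rfl fun i _ => ?_
  have h1 : ((zq (Polynomial.C ((n.descFactorial (n - i) : ℤ) * p (j, i)) *
      Polynomial.X ^ (i : ℕ)) : ℚ[X]) : ℚ⟦X⟧) =
      PowerSeries.C ((n.descFactorial (n - i) : ℚ) * p (j, i)) * PowerSeries.X ^ (i : ℕ) := by
    have h0 : zq (Polynomial.C ((n.descFactorial (n - i) : ℤ) * p (j, i)) *
        Polynomial.X ^ (i : ℕ)) =
        Polynomial.C ((n.descFactorial (n - i) : ℚ) * p (j, i)) * Polynomial.X ^ (i : ℕ) := by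
      rw [map_mul, map_pow, zq, Polynomial.coe_mapRingHom, Polynomial.map_C, Polynomial.map_X]
      simp
    rw [h0, Polynomial.coe_mul, Polynomial.coe_C, Polynomial.coe_pow, Polynomial.coe_X]
  rw [smul_eq_coe_mul, h1, mul_assoc, PowerSeries.coeff_C_mul, PowerSeries.coeff_X_pow_mul']
  split_ifs with h
  · have h2 : (m.factorial : ℚ) = m.choose i * (i : ℕ).factorial * (m - i).factorial := by
      exact_mod_cast (Nat.choose_mul_factorial_mul_factorial h).symm
    have h3 : (n.factorial : ℚ) = (i : ℕ).factorial * n.descFactorial (n - i) := by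
      have := Nat.factorial_mul_descFactorial (Nat.sub_le n i)
      rw [Nat.sub_sub_self (Nat.lt_succ_iff.mp i.2)] at this
      exact_mod_cast this.symm
    rw [h2, h3]
    ring
  · rw [Nat.choose_eq_zero_of_lt (not_le.mp h)]
    simp

theorem ESys.exists_grBy {N : ℕ} (S : ESys N) : ∃ C : ℕ, 1 ≤ C ∧ ∀ j, GrBy C (S.y j) := by
  choose C hC using S.gr
  refine ⟨1 + ∑ j, C j, by omega, fun j => (hC j).mono ?_⟩
  have := Finset.single_le_sum (f := C) (fun _ _ => Nat.zero_le _) (Finset.mem_univ j)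
  omega

theorem sum_choose_fin_le (n m : ℕ) : ∑ i : Fin (n + 1), (m.choose i : ℝ) ≤ 2 ^ m := by
  have h1 : ∑ i : Fin (n + 1), m.choose i ≤ 2 ^ m := by
    rw [Fin.sum_univ_eq_sum_range (fun i => m.choose i)]
    rw [← Nat.sum_range_choose m]
    rcases le_total n m with h | h
    · exact Finset.sum_le_sum_of_subset (Finset.range_subset_range.mpr (by omega))
    · refine le_of_eq (Finset.sum_subset (Finset.range_subset_range.mpr (by omega))
        fun i _ hi => ?_).symm
      exact Nat.choose_eq_zero_of_lt (by simpa using hi)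
  exact_mod_cast h1

theorem ESys.exists_pade {N : ℕ} (S : ESys N) (hN : 1 ≤ N) (q : ℕ) (hq : 1 ≤ q) :
    ∃ C : ℝ, 1 ≤ C ∧ ∀ k, 1 ≤ k → ∃ P : Fin N → ℤ[X], P ≠ 0 ∧
      (∀ j, (P j).natDegree ≤ q * k) ∧ (∀ j, Bo ((q * k).factorial * C ^ k) (P j)) ∧
      Bd ((q * k).factorial * C ^ k) C ((N * q - 1) * k + N) (S.form P) := by
  classical
  obtain ⟨C0, hC0, hgr⟩ := S.exists_grBy
  choose d hd using hgr
  set a := N * q + N + 1 with ha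
  set e := N * q + N with he
  set C1 : ℝ := (2 ^ (N * (q + 1)) * (2 * (C0 : ℝ) ^ (N + 1)) ^ a) ^ e with hC1
  have hC0' : (1 : ℝ) ≤ C0 := by exact_mod_cast hC0
  have hC0p : ∀ n, (1 : ℝ) ≤ (C0 : ℝ) ^ n := fun n => one_le_pow₀ hC0'
  have hC1' : 1 ≤ C1 := by
    apply one_le_pow₀
    have h1 : (1 : ℝ) ≤ 2 ^ (N * (q + 1)) := one_le_pow₀ (by norm_num)
    have h2 : (1 : ℝ) ≤ (2 * (C0 : ℝ) ^ (N + 1)) ^ a := one_le_pow₀ (by linarith [hC0p (N + 1)])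
    nlinarith
  have hN' : (1 : ℝ) ≤ N := by exact_mod_cast hN
  have hNC : (1 : ℝ) ≤ N * C0 := by nlinarith
  refine ⟨2 * (N * C0) * C1, by nlinarith, fun k hk => ?_⟩
  set n := q * k with hn
  set M := (N * q - 1) * k + N with hM
  have hNq : 1 ≤ N * q := Nat.mul_pos hN hq
  have hMk : N * (n + 1) = M + k := by
    rw [hM, hn]
    obtain ⟨x, hx⟩ : ∃ x, N * q = x + 1 := ⟨N * q - 1, by omega⟩
    have : N * (q * k) = (x + 1) * k := by rw [← hx]; ring
    rw [Nat.mul_add, this, hx]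
    simp only [Nat.add_sub_cancel]
    ring
  let Dn : ℕ := ∏ j, d j M
  have hu : ∀ (j : Fin N) (b : ℕ), b ≤ M → ∃ z : ℤ, (Dn : ℚ) *
      ((b.factorial : ℚ) * PowerSeries.coeff b (S.y j)) = z := by
    intro j b hb
    obtain ⟨z, hz⟩ := (hd j M).2.2.2 b hb
    refine ⟨(∏ i ∈ Finset.univ.erase j, d i M : ℕ) * z, ?_⟩
    have : Dn = (∏ i ∈ Finset.univ.erase j, d i M) * d j M :=
      (Finset.prod_erase_mul _ _ (Finset.mem_univ j)).symm
    rw [this]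
    push_cast
    rw [← hz]
    ring
  have hu' : ∀ (j : Fin N) (b : ℕ), |(((b.factorial : ℚ) * PowerSeries.coeff b (S.y j) : ℚ) : ℝ)| ≤
      (C0 : ℝ) ^ (b + 1) := fun j b => by
    have := (hd j b).2.2.1
    exact_mod_cast this
  have hDn : 0 < Dn := Finset.prod_pos fun j _ => (hd j M).1
  have hDn' : (Dn : ℝ) ≤ (C0 : ℝ) ^ ((M + 1) * N) := by
    have : Dn ≤ ∏ _j : Fin N, C0 ^ (M + 1) := Finset.prod_le_prod' fun j _ => (hd j M).2.1
    rw [Finset.prod_const, Finset.card_univ, Fintype.card_fin, ← pow_mul] at this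
    exact_mod_cast this
  choose! U hU using hu
  let A : Matrix (Fin M) (Fin N × Fin (n + 1)) ℤ := fun m x =>
    ((m : ℕ).choose x.2 : ℤ) * U x.1 (m - x.2)
  have hMa : M + 1 ≤ a * k := by
    rw [hM, ha]
    have : (N * q - 1) * k ≤ N * q * k := Nat.mul_le_mul_right _ (Nat.sub_le _ _)
    nlinarith
  have hA : ∀ i j, |(A i j : ℝ)| ≤ (2 * (C0 : ℝ) ^ (N + 1)) ^ (a * k) := by
    intro m x
    have h1 : ((U x.1 (m - x.2) : ℤ) : ℝ) = (Dn : ℝ) * ((((m - x.2 : ℕ).factorial : ℚ) *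
        PowerSeries.coeff (m - x.2) (S.y x.1) : ℚ) : ℝ) := by
      have := hU x.1 (m - x.2) (by omega)
      exact_mod_cast this.symm
    have h2 : |((U x.1 (m - x.2) : ℤ) : ℝ)| ≤ (C0 : ℝ) ^ ((M + 1) * N) * (C0 : ℝ) ^ (M + 1) := by
      rw [h1, abs_mul, Nat.abs_cast]
      refine mul_le_mul hDn' ((hu' _ _).trans ?_) (abs_nonneg _) (by positivity)
      exact pow_le_pow_right₀ hC0' (by omega)
    have h3 : (((m : ℕ).choose x.2 : ℕ) : ℝ) ≤ 2 ^ (M + 1) := by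
      have : ((m : ℕ).choose x.2 : ℕ) ≤ 2 ^ (M + 1) :=
        (Nat.choose_le_two_pow _ _).trans (Nat.pow_le_pow_right (by norm_num) (by omega))
      exact_mod_cast this
    have h4 : |(A m x : ℝ)| ≤ (2 * (C0 : ℝ) ^ (N + 1)) ^ (M + 1) := by
      simp only [A]
      push_cast
      rw [abs_mul, Nat.abs_cast]
      refine (mul_le_mul h3 h2 (abs_nonneg _) (by positivity)).trans (le_of_eq ?_)
      ring
    exact h4.trans (pow_le_pow_right₀ (by linarith [hC0p (N + 1)]) hMa)
  have hcβ : Fintype.card (Fin N × Fin (n + 1)) = M + k := by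
    rw [Fintype.card_prod, Fintype.card_fin, Fintype.card_fin, hMk]
  obtain ⟨p, hp0, hpA, hple⟩ := exists_small_int_solution A _ e
    (one_le_pow₀ (by linarith [hC0p (N + 1)])) hA (by rw [hcβ, Fintype.card_fin]; omega)
    (by rw [Fintype.card_fin, hM]; omega) (by
      rw [hcβ, Fintype.card_fin, Nat.add_sub_cancel_left, hM, he]
      have : (N * q - 1) * k ≤ N * q * k := Nat.mul_le_mul_right _ (Nat.sub_le _ _)
      nlinarith)
  replace hple : ∀ x, |(p x : ℝ)| ≤ C1 ^ k := by
    intro x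
    refine (hple x).trans ?_
    have h1 : ((Fintype.card (Fin N × Fin (n + 1)) : ℕ) : ℝ) ≤ 2 ^ (N * (q + 1) * k) := by
      have h2 : M + k ≤ 2 ^ (N * (q + 1) * k) := by
        have h3 : M + k ≤ N * (q + 1) * k := by
          rw [← hMk, hn]; nlinarith
        exact h3.trans Nat.lt_two_pow_self.le
      rw [hcβ]
      exact_mod_cast h2
    have h4 : C1 ^ k = ((2 ^ (N * (q + 1)) * (2 * (C0 : ℝ) ^ (N + 1)) ^ a) ^ k) ^ e := by
      rw [hC1, ← pow_mul, ← pow_mul, Nat.mul_comm e k]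
    rw [h4]
    refine pow_le_pow_left₀ (by positivity) ?_ e
    rw [mul_pow (2 ^ (N * (q + 1))), ← pow_mul, ← pow_mul]
    gcongr
  refine ⟨padePoly p, ?_, ?_, ?_, ?_, ?_⟩
  · intro h0
    apply hp0
    funext x
    have h1 := padePoly_coeff p x.1 x.2
    rw [h0, dif_pos x.2.2] at h1
    simp only [Pi.zero_apply, Polynomial.coeff_zero, Fin.eta, Prod.mk.eta] at h1
    have h2 : (n.descFactorial (n - x.2) : ℤ) ≠ 0 := by
      rw [Nat.cast_ne_zero, Ne, Nat.descFactorial_eq_zero_iff_lt]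
      omega
    exact (mul_eq_zero.mp h1.symm).resolve_left h2
  · intro j
    rw [Polynomial.natDegree_le_iff_coeff_eq_zero]
    intro m hm
    rw [padePoly_coeff, dif_neg (by omega)]
  · intro j i
    have hb : (0 : ℝ) ≤ (n.factorial : ℝ) * (2 * (N * C0) * C1) ^ k := by positivity
    rw [padePoly_coeff]
    split_ifs with h
    · push_cast
      rw [abs_mul, Nat.abs_cast]
      have h1 : n.descFactorial (n - i) ≤ n.factorial := by
        rw [← Nat.factorial_mul_descFactorial (Nat.sub_le n i)]
        exact Nat.le_mul_of_pos_left _ (Nat.factorial_pos _)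
      have h2 : (n.descFactorial (n - i) : ℝ) ≤ n.factorial := by exact_mod_cast h1
      refine mul_le_mul h2 ((hple _).trans ?_) (abs_nonneg _) (by positivity)
      exact pow_le_pow_left₀ (by linarith) (by nlinarith) k
    · simpa using hb
  · intro m hm
    have h1 := coeff_form_padePoly S p m
    have h2 := congrFun hpA ⟨m, hm⟩
    simp only [Matrix.mulVec, dotProduct, A, Pi.zero_apply] at h2
    have h3 : (Dn : ℚ) * ∑ x : Fin N × Fin (n + 1), (m.choose x.2 : ℚ) *
        (((m - x.2).factorial : ℚ) * PowerSeries.coeff (m - x.2) (S.y x.1)) * p x = 0 := by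
      rw [Finset.mul_sum]
      have h4 : ((∑ x : Fin N × Fin (n + 1), (m.choose x.2 : ℤ) * U x.1 (m - x.2) * p x : ℤ) : ℚ)
          = 0 := by rw [h2]; simp
      rw [← h4]
      push_cast
      refine Finset.sum_congr rfl fun x _ => ?_
      rw [← hU x.1 (m - x.2) (by omega)]
      ring
    have h5 : (Dn : ℚ) ≠ 0 := by exact_mod_cast hDn.ne'
    rw [(mul_eq_zero.mp h3).resolve_left h5, mul_zero] at h1
    exact (mul_eq_zero.mp h1).resolve_left (by exact_mod_cast m.factorial_ne_zero)
  · intro m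
    have h1 := coeff_form_padePoly S p m
    have hm : (0 : ℝ) < m.factorial := by exact_mod_cast m.factorial_pos
    rw [le_div_iff₀ hm, mul_comm]
    have h2 : (m.factorial : ℝ) * |((PowerSeries.coeff m (S.form (padePoly p)) : ℚ) : ℝ)| =
        |(n.factorial : ℝ) * ∑ x : Fin N × Fin (n + 1), (m.choose x.2 : ℝ) *
        ((((m - x.2).factorial : ℚ) * PowerSeries.coeff (m - x.2) (S.y x.1) : ℚ) : ℝ) * p x| := by
      rw [← Nat.abs_cast m.factorial, ← abs_mul]
      congr 1
      exact_mod_cast h1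
    rw [h2, abs_mul, Nat.abs_cast, mul_assoc]
    refine mul_le_mul_of_nonneg_left ?_ (by positivity)
    calc _ ≤ ∑ x : Fin N × Fin (n + 1), (m.choose x.2 : ℝ) * (C0 : ℝ) ^ (m + 1) * C1 ^ k := by
          refine (Finset.abs_sum_le_sum_abs _ _).trans (Finset.sum_le_sum fun x _ => ?_)
          rw [abs_mul, abs_mul, Nat.abs_cast]
          refine mul_le_mul (mul_le_mul_of_nonneg_left ((hu' _ _).trans ?_) (by positivity))
            (hple x) (abs_nonneg _) (by positivity)
          exact pow_le_pow_right₀ hC0' (by omega)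
      _ = N * (∑ i : Fin (n + 1), (m.choose i : ℝ)) * (C0 : ℝ) ^ (m + 1) * C1 ^ k := by
          rw [Fintype.sum_prod_type]
          simp only [Finset.sum_const, Finset.card_univ, Fintype.card_fin, nsmul_eq_mul]
          rw [Finset.mul_sum, Finset.mul_sum, Finset.sum_mul, Finset.sum_mul]
          exact Finset.sum_congr rfl fun i _ => by ring
      _ ≤ N * 2 ^ m * (C0 : ℝ) ^ (m + 1) * C1 ^ k := by
          gcongr
          exact sum_choose_fin_le n m
      _ = (N * C0 * C1 ^ k) * (2 * C0) ^ m := by ring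
      _ ≤ _ := by
          refine mul_le_mul ?_ (pow_le_pow_left₀ (by linarith) (by
            nlinarith [mul_nonneg (sub_nonneg.2 hC0') (sub_nonneg.2 hN'),
              mul_nonneg (sub_nonneg.2 hNC) (sub_nonneg.2 hC1')]) m) (by positivity)
            (by positivity)
          rw [mul_pow]
          refine mul_le_mul_of_nonneg_right ?_ (by positivity)
          calc (N : ℝ) * C0 ≤ 2 * (N * C0) := by linarith
            _ ≤ _ := le_self_pow₀ (by linarith) (by omega)

theorem Bd.mono {B B' C C' : ℝ} {M M' : ℕ} {R : ℚ⟦X⟧} (h : Bd B C M R) (hB : 0 ≤ B) (hC : 0 ≤ C)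
    (hBB : B ≤ B') (hCC : C ≤ C') (hM : M' ≤ M) : Bd B' C' M' R :=
  ⟨fun m hm => h.1 m (by omega), fun m => (h.2 m).trans (by
    have := hB.trans hBB
    gcongr)⟩

theorem inv_factorial_sub_le {m e : ℕ} (he : e ≤ m) :
    ((m - e).factorial : ℝ)⁻¹ ≤ e.factorial * 2 ^ m / m.factorial := by
  have h1 : (0 : ℝ) < m.factorial := by exact_mod_cast m.factorial_pos
  have h2 : (0 : ℝ) < (m - e).factorial := by exact_mod_cast (m - e).factorial_pos
  rw [le_div_iff₀ h1, inv_mul_le_iff₀ h2]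
  have h3 : (m.factorial : ℝ) = m.choose e * e.factorial * (m - e).factorial := by
    exact_mod_cast (Nat.choose_mul_factorial_mul_factorial he).symm
  have h4 : (m.choose e : ℝ) ≤ 2 ^ m := by exact_mod_cast Nat.choose_le_two_pow m e
  rw [h3]
  calc (m.choose e : ℝ) * e.factorial * (m - e).factorial
      ≤ 2 ^ m * e.factorial * (m - e).factorial := by gcongr
    _ = _ := by ring

theorem exists_bd_mul_D (T : ℤ[X]) (C : ℝ) (hC : 1 ≤ C) : ∃ K : ℝ, 1 ≤ K ∧
    ∀ (B : ℝ) (M : ℕ) (R : ℚ⟦X⟧), 0 ≤ B → Bd B C (M + 1) R →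
      Bd (K * B) (2 * C) M ((zq T : ℚ⟦X⟧) * D R) := by
  set K0 : ℝ := ∑ e ∈ Finset.range (T.natDegree + 1), |(T.coeff e : ℝ)| * e.factorial with hK0
  have hK0' : 0 ≤ K0 := Finset.sum_nonneg fun _ _ => by positivity
  refine ⟨C * K0 + 1, by nlinarith, fun B M R hB hR => ⟨fun m hm => ?_, fun m => ?_⟩⟩
  · rw [PowerSeries.coeff_mul]
    refine Finset.sum_eq_zero fun x hx => ?_
    have := Finset.HasAntidiagonal.mem_antidiagonal.mp hx
    rw [coeff_D, hR.1 (x.2 + 1) (by omega)]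
    simp
  · rw [PowerSeries.coeff_mul, Finset.Nat.sum_antidiagonal_eq_sum_range_succ_mk]
    push_cast
    have hm0 : (0 : ℝ) < m.factorial := by exact_mod_cast m.factorial_pos
    calc _ ≤ ∑ e ∈ Finset.range (m + 1),
            (|(T.coeff e : ℝ)| * e.factorial) * (B * C ^ (m + 1) * 2 ^ m / m.factorial) := by
          refine (Finset.abs_sum_le_sum_abs _ _).trans (Finset.sum_le_sum fun e he => ?_)
          have hem : e ≤ m := by simpa [Nat.lt_succ_iff] using he
          rw [zq_coeff, abs_mul, mul_assoc]
          simp only [Rat.cast_intCast]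
          refine mul_le_mul_of_nonneg_left ?_ (abs_nonneg _)
          rw [coeff_D]
          push_cast
          rw [abs_mul]
          have h1 := hR.2 (m - e + 1)
          have hpos : (0 : ℝ) < ((m - e : ℕ) : ℝ) + 1 := by positivity
          rw [abs_of_pos hpos]
          calc _ ≤ B * C ^ (m - e + 1) / (m - e + 1).factorial * (((m - e : ℕ) : ℝ) + 1) := by
                gcongr
            _ = B * C ^ (m - e + 1) * ((m - e).factorial : ℝ)⁻¹ := by
                rw [Nat.factorial_succ]
                push_cast
                have h2 : ((m - e).factorial : ℝ) ≠ 0 := by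
                  exact_mod_cast (m - e).factorial_ne_zero
                field_simp
            _ ≤ B * C ^ (m + 1) * (e.factorial * 2 ^ m / m.factorial) := by
                refine mul_le_mul ?_ (inv_factorial_sub_le hem) (by positivity) (by positivity)
                exact mul_le_mul_of_nonneg_left (pow_le_pow_right₀ hC (by omega)) hB
            _ = _ := by ring
      _ = (∑ e ∈ Finset.range (m + 1), |(T.coeff e : ℝ)| * e.factorial) *
            (B * C ^ (m + 1) * 2 ^ m / m.factorial) := by rw [Finset.sum_mul]
      _ ≤ K0 * (B * C ^ (m + 1) * 2 ^ m / m.factorial) := by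
          refine mul_le_mul_of_nonneg_right ?_ (by positivity)
          rw [hK0]
          rcases le_total m T.natDegree with h | h
          · exact Finset.sum_le_sum_of_subset_of_nonneg
              (Finset.range_subset_range.mpr (by omega)) fun _ _ _ => by positivity
          · refine le_of_eq (Finset.sum_subset (Finset.range_subset_range.mpr (by omega))
              fun e _ he => ?_).symm
            rw [Polynomial.coeff_eq_zero_of_natDegree_lt (by simpa using he)]
            simp
      _ = (C * K0) * B * (2 * C) ^ m / m.factorial := by ring
      _ ≤ _ := by gcongr; linarith

theorem ESys.exists_bd_nab {N : ℕ} (S : ESys N) (C : ℝ) (hC : 1 ≤ C) (i : ℕ) :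
    ∃ K C' : ℝ, 1 ≤ K ∧ 1 ≤ C' ∧ ∀ i' ≤ i, ∀ (B : ℝ) (M : ℕ) (P : Fin N → ℤ[X]), 0 ≤ B →
      Bd B C (M + i) (S.form P) → Bd (K * B) C' M (S.form (S.nab^[i'] P)) := by
  induction i with
  | zero =>
    refine ⟨1, C, le_rfl, hC, fun i' hi' B M P _ h => ?_⟩
    obtain rfl : i' = 0 := by omega
    simpa using h
  | succ i ih =>
    obtain ⟨K, C', hK, hC', h⟩ := ih
    obtain ⟨K2, hK2, h2⟩ := exists_bd_mul_D S.T C' hC'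
    refine ⟨K2 * K, 2 * C', by nlinarith, by linarith, fun i' hi' B M P hB hP => ?_⟩
    rw [← add_assoc, add_right_comm] at hP
    rcases Nat.lt_or_ge i i' with hlt | hle
    · obtain rfl : i' = i + 1 := by omega
      rw [Function.iterate_succ_apply', S.form_nab, mul_assoc]
      exact h2 _ _ _ (by positivity) (h i le_rfl B (M + 1) P hB hP)
    · refine (h i' hle B (M + 1) P hB hP).mono (by positivity) (by linarith) ?_ (by linarith)
        (by omega)
      nlinarith [mul_nonneg (by linarith : (0:ℝ) ≤ K) hB]

theorem Bd.norm_coeff_tau_le {B C : ℝ} {M : ℕ} {R : ℚ⟦X⟧} (hB : 0 ≤ B) (hC : 0 ≤ C)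
    (h : Bd B C M R) (hR : Gr R) {l : ℕ} (hl : l ≤ M) :
    ‖PowerSeries.coeff l (tau R)‖ ≤ B * (2 * C) ^ M * Real.exp C / M.factorial := by
  have hs := ((hR.iterate_D l).summable 1).of_norm
  have hl0 : (0 : ℝ) < l.factorial := by exact_mod_cast l.factorial_pos
  rw [coeff_tau, evz, ← hs.sum_add_tsum_nat_add (M - l), Finset.sum_eq_zero, zero_add, norm_div,
    Complex.norm_natCast, div_le_iff₀ hl0]
  · have hexp0 : HasSum (fun s => C ^ s / (s.factorial : ℝ)) (Real.exp C) := by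
      rw [Real.exp_eq_exp_ℝ]
      exact NormedSpace.expSeries_div_hasSum_exp C
    have hexp := hexp0.mul_left (B * (2 * C) ^ M / M.factorial * l.factorial)
    have := tsum_of_norm_bounded hexp (f := fun i => (((PowerSeries.coeff (i + (M - l)))
      (D^[l] R) : ℚ) : ℂ) * 1 ^ (i + (M - l))) fun s => ?_
    · refine this.trans (le_of_eq ?_)
      ring
    · rw [one_pow, mul_one, coeff_iterate_D, ← Complex.ofReal_ratCast, Complex.norm_real,
        Real.norm_eq_abs]
      rw [show s + (M - l) + l = s + M by omega]
      push_cast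
      rw [abs_mul, Nat.abs_cast]
      have h1 := h.2 (s + M)
      have h3 : ((s + M).factorial : ℝ) = (s + (M - l)).factorial * (s + M).descFactorial l := by
        have := Nat.factorial_mul_descFactorial (show l ≤ s + M by omega)
        rw [show s + M - l = s + (M - l) by omega] at this
        exact_mod_cast this.symm
      have hd : (0 : ℝ) < (s + M).descFactorial l := by
        exact_mod_cast Nat.descFactorial_pos.mpr (show l ≤ s + M by omega)
      have hsm : (0 : ℝ) < (s + (M - l)).factorial := by exact_mod_cast Nat.factorial_pos _
      calc _ ≤ ((s + M).descFactorial l : ℝ) * (B * C ^ (s + M) / (s + M).factorial) := by gcongr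
        _ = B * C ^ (s + M) * ((s + (M - l)).factorial : ℝ)⁻¹ := by
            rw [h3]; field_simp
        _ ≤ B * C ^ (s + M) * ((s.factorial : ℝ)⁻¹ * (l.factorial * 2 ^ M / M.factorial)) := by
            refine mul_le_mul_of_nonneg_left ?_ (by positivity)
            refine le_trans ?_ (mul_le_mul_of_nonneg_left (inv_factorial_sub_le hl)
              (by positivity))
            rw [← mul_inv]
            have h5 : (0 : ℝ) < (s.factorial : ℝ) * (M - l).factorial := by
              exact_mod_cast Nat.mul_pos s.factorial_pos (M - l).factorial_pos
            refine inv_anti₀ h5 ?_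
            exact_mod_cast Nat.le_of_dvd (Nat.factorial_pos _)
              (Nat.factorial_mul_factorial_dvd_factorial_add s (M - l))
        _ = _ := by
            rw [pow_add, mul_pow]
            field_simp
  · intro m hm
    rw [coeff_iterate_D, h.1 (m + l) (by rw [Finset.mem_range] at hm; omega)]
    simp

/-- The sum of the absolute values of the coefficients. -/
def len (Q : ℤ[X]) : ℝ := ∑ e ∈ Finset.range (Q.natDegree + 1), |(Q.coeff e : ℝ)|

theorem len_nonneg (Q : ℤ[X]) : 0 ≤ len Q := Finset.sum_nonneg fun _ _ => abs_nonneg _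

theorem Bo.add {B B' : ℝ} {P Q : ℤ[X]} (h : Bo B P) (h' : Bo B' Q) : Bo (B + B') (P + Q) :=
  fun i => by
    rw [Polynomial.coeff_add]
    push_cast
    exact (abs_add_le _ _).trans (add_le_add (h i) (h' i))

theorem Bo.mono {B B' : ℝ} {P : ℤ[X]} (h : Bo B P) (hB : B ≤ B') : Bo B' P :=
  fun i => (h i).trans hB

theorem Bo.sum {ι : Type*} (s : Finset ι) (B : ι → ℝ) (P : ι → ℤ[X]) (h : ∀ i ∈ s, Bo (B i) (P i)) :
    Bo (∑ i ∈ s, B i) (∑ i ∈ s, P i) := fun n => by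
  rw [Polynomial.finsetSum_coeff]
  push_cast
  exact (Finset.abs_sum_le_sum_abs _ _).trans (Finset.sum_le_sum fun i hi => h i hi n)

theorem Bo.mul_left {B : ℝ} {P : ℤ[X]} (hB : 0 ≤ B) (h : Bo B P) (Q : ℤ[X]) :
    Bo (len Q * B) (Q * P) := fun m => by
  rw [Polynomial.coeff_mul, Finset.Nat.sum_antidiagonal_eq_sum_range_succ_mk]
  push_cast
  calc _ ≤ ∑ e ∈ Finset.range (m + 1), |(Q.coeff e : ℝ)| * B := by
        refine (Finset.abs_sum_le_sum_abs _ _).trans (Finset.sum_le_sum fun e _ => ?_)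
        rw [abs_mul]
        exact mul_le_mul_of_nonneg_left (h _) (abs_nonneg _)
    _ = (∑ e ∈ Finset.range (m + 1), |(Q.coeff e : ℝ)|) * B := by rw [Finset.sum_mul]
    _ ≤ _ := by
        refine mul_le_mul_of_nonneg_right ?_ hB
        rw [len]
        rcases le_total m Q.natDegree with h | h
        · exact Finset.sum_le_sum_of_subset_of_nonneg
            (Finset.range_subset_range.mpr (by omega)) fun _ _ _ => by positivity
        · refine le_of_eq (Finset.sum_subset (Finset.range_subset_range.mpr (by omega))
            fun e _ he => ?_).symm
          rw [Polynomial.coeff_eq_zero_of_natDegree_lt (by simpa using he)]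
          simp

theorem Bo.derivative {B : ℝ} {P : ℤ[X]} (hB : 0 ≤ B) (h : Bo B P) {n : ℕ}
    (hn : P.natDegree ≤ n) : Bo (n * B) (Polynomial.derivative P) := fun m => by
  rw [Polynomial.coeff_derivative]
  push_cast
  rw [abs_mul, mul_comm]
  rcases Nat.lt_or_ge n (m + 1) with h1 | h1
  · rw [Polynomial.coeff_eq_zero_of_natDegree_lt (by omega)]
    simp
    positivity
  · refine mul_le_mul ?_ (h _) (abs_nonneg _) (by positivity)
    rw [abs_of_pos (by positivity)]
    exact_mod_cast h1

theorem Bo.taylor {B : ℝ} {P : ℤ[X]} (h : Bo B P) {n : ℕ}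
    (hn : P.natDegree ≤ n) : Bo ((n + 1) * 2 ^ n * B) (Polynomial.taylor 1 P) := fun m => by
  rw [Polynomial.taylor_coeff, Polynomial.hasseDeriv_apply, Polynomial.sum_over_range' _ _ (n + 1)
    (by omega)]
  · rw [Polynomial.eval_finsetSum]
    push_cast
    simp only [Polynomial.eval_monomial, one_pow, mul_one]
    push_cast
    calc _ ≤ ∑ _i ∈ Finset.range (n + 1), (2 : ℝ) ^ n * B := by
          refine (Finset.abs_sum_le_sum_abs _ _).trans (Finset.sum_le_sum fun e he => ?_)
          rw [abs_mul, Nat.abs_cast]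
          refine mul_le_mul ?_ (h _) (abs_nonneg _) (by positivity)
          have h1 : e.choose m ≤ 2 ^ n := (Nat.choose_le_two_pow _ _).trans
            (Nat.pow_le_pow_right (by norm_num) (by simpa [Nat.lt_succ_iff] using he))
          exact_mod_cast h1
      _ = _ := by
          rw [Finset.sum_const, Finset.card_range, nsmul_eq_mul]
          push_cast
          ring
  · simp

theorem ESys.exists_bo_nab {N : ℕ} (S : ESys N) : ∃ K : ℝ, 1 ≤ K ∧
    ∀ (n : ℕ) (B : ℝ) (P : Fin N → ℤ[X]), 0 ≤ B → (∀ j, (P j).natDegree ≤ n) →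
      (∀ j, Bo B (P j)) → ∀ l, Bo (K * (n + 1) * B) (S.nab P l) := by
  set K : ℝ := len S.T + ∑ j, ∑ l, len (S.A j l) with hK
  have h1 := len_nonneg S.T
  have h2 : 0 ≤ ∑ j, ∑ l, len (S.A j l) :=
    Finset.sum_nonneg fun _ _ => Finset.sum_nonneg fun _ _ => len_nonneg _
  refine ⟨1 + K, by linarith, fun n B P hB hn hP l => ?_⟩
  refine Bo.mono (Bo.add (((hP l).derivative hB (hn l)).mul_left (by positivity) S.T)
    (Bo.sum _ (fun j => len (S.A j l) * B) _ fun j _ => ?_)) ?_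
  · rw [mul_comm (P j)]
    exact (hP j).mul_left hB _
  · rw [← Finset.sum_mul]
    have h3 : ∑ j, len (S.A j l) ≤ ∑ j, ∑ l, len (S.A j l) :=
      Finset.sum_le_sum fun j _ => Finset.single_le_sum (f := fun l => len (S.A j l))
        (fun _ _ => len_nonneg _) (Finset.mem_univ l)
    have hn0 : (0 : ℝ) ≤ n := Nat.cast_nonneg n
    have h5 : len S.T * (n * B) ≤ len S.T * ((n + 1) * B) := by gcongr; linarith
    have h6 : (∑ j, len (S.A j l)) * B ≤ (∑ j, ∑ l, len (S.A j l)) * ((n + 1) * B) := by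
      refine mul_le_mul h3 ?_ hB h2
      nlinarith
    have h7 : 0 ≤ (n + 1) * B := by positivity
    rw [hK]
    nlinarith

theorem ESys.exists_bo_nab_iterate {N : ℕ} (S : ESys N) : ∃ K : ℝ, 1 ≤ K ∧
    ∀ (n : ℕ) (B : ℝ) (P : Fin N → ℤ[X]), 0 ≤ B → (∀ j, (P j).natDegree ≤ n) →
      (∀ j, Bo B (P j)) → ∀ i ≤ N, ∀ l, Bo ((K * (n + 1)) ^ N * B) (S.nab^[i] P l) := by
  obtain ⟨K, hK, h⟩ := S.exists_bo_nab
  refine ⟨K * (N * S.deg + 1), ?_, fun n B P hB hn hP i hi l => ?_⟩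
  · have : (0 : ℝ) ≤ N * S.deg := by positivity
    nlinarith
  set L : ℝ := K * (N * S.deg + 1) * (n + 1) with hL
  have hL1 : 1 ≤ L := by
    have h1 : (0 : ℝ) ≤ N * S.deg := by positivity
    have h2 : (0 : ℝ) ≤ n := by positivity
    have h3 : 1 ≤ K * (N * S.deg + 1) := by nlinarith
    nlinarith
  have key : ∀ i ≤ N, ∀ l, Bo (L ^ i * B) (S.nab^[i] P l) := by
    intro i
    induction i with
    | zero => intro _ l; simpa using hP l
    | succ i ih =>
      intro hi l
      rw [Function.iterate_succ_apply']
      refine (h (n + i * S.deg) (L ^ i * B) _ (by positivity)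
        (S.natDegree_nab_iterate_le P n hn i) (ih (by omega)) l).mono ?_
      rw [pow_succ', mul_assoc L]
      refine mul_le_mul_of_nonneg_right ?_ (by positivity)
      rw [hL, mul_assoc K]
      refine mul_le_mul_of_nonneg_left ?_ (by linarith)
      have h1 : n + i * S.deg + 1 ≤ (N * S.deg + 1) * (n + 1) := by
        have : i * S.deg ≤ N * S.deg := Nat.mul_le_mul_right _ (by omega)
        nlinarith [Nat.zero_le (N * S.deg * n)]
      exact_mod_cast h1
  refine (key i hi l).mono (mul_le_mul_of_nonneg_right ?_ hB)
  exact pow_le_pow_right₀ hL1 hi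

theorem ctl_family {ι : Type*} [Fintype ι] (f : ι → ℕ → ℚ) (hf : ∀ x, Ctl (f x)) :
    ∃ (C : ℝ) (c : ℕ), 1 ≤ C ∧ ∀ b : ℕ, ∃ d : ℕ, 0 < d ∧
      (d : ℝ) ≤ C ^ (b + 1) * ((b : ℝ) + 1) ^ (c * b) ∧ ∀ x, ∀ i ≤ b, ∃ z : ℤ,
        (d : ℚ) * f x i = z ∧ |(z : ℝ)| ≤ C ^ (b + 1) * ((b : ℝ) + 1) ^ (c * b) := by
  classical
  choose C c hC h using hf
  choose d hd0 hd hz using h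
  have hprod : ∀ b : ℕ, (∏ x, C x) ^ (b + 1) * ((b : ℝ) + 1) ^ ((∑ x, c x) * b) =
      ∏ x, (C x ^ (b + 1) * ((b : ℝ) + 1) ^ (c x * b)) := by
    intro b
    rw [Finset.prod_mul_distrib, Finset.prod_pow, Finset.sum_mul, Finset.prod_pow_eq_pow_sum]
  have hC1 : ∀ s : Finset ι, 1 ≤ ∏ x ∈ s, C x := by
    intro s
    induction s using Finset.induction_on with
    | empty => simp
    | insert a s ha ih =>
      rw [Finset.prod_insert ha]
      nlinarith [hC a]
  refine ⟨∏ x, C x, ∑ x, c x, hC1 _, fun b => ⟨∏ x, d x b,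
    Finset.prod_pos fun x _ => hd0 x b, ?_, fun x i hi => ?_⟩⟩
  · rw [hprod, Nat.cast_prod]
    exact Finset.prod_le_prod (fun _ _ => by positivity) fun x _ => hd x b
  · obtain ⟨z, hz1, hz2⟩ := hz x b i hi
    refine ⟨(∏ y ∈ Finset.univ.erase x, d y b : ℕ) * z, ?_, ?_⟩
    · rw [← Finset.prod_erase_mul _ _ (Finset.mem_univ x)]
      push_cast
      rw [← hz1]
      ring
    · rw [hprod, ← Finset.prod_erase_mul _ _ (Finset.mem_univ x)]
      push_cast
      rw [abs_mul, Finset.abs_prod]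
      refine mul_le_mul ?_ hz2 (abs_nonneg _) (Finset.prod_nonneg fun y _ => ?_)
      · refine Finset.prod_le_prod (fun _ _ => by positivity) fun y _ => ?_
        rw [Nat.abs_cast]
        exact hd y b
      · have := hC y
        positivity

theorem exists_det_ne_zero {I : Type*} [Fintype I] {r : ℕ} (ρ : I → Fin r → ℚ)
    (h : ∀ μ : Fin r → ℚ, (∀ i, ∑ a, μ a * ρ i a = 0) → μ = 0) :
    ∃ b : Fin r → I, (Matrix.of fun x a => ρ (b x) a).det ≠ 0 := by
  have hspan : Submodule.span ℚ (Set.range ρ) = ⊤ := by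
    by_contra hne
    obtain ⟨f, hf0, hf⟩ := Submodule.exists_le_ker_of_lt_top _ (lt_top_iff_ne_top.mpr hne)
    have hfa : ∀ v, f v = ∑ a, f (Pi.single a 1) * v a := by
      intro v
      conv_lhs => rw [← Finset.univ_sum_single v]
      rw [map_sum]
      refine Finset.sum_congr rfl fun a _ => ?_
      have : (Pi.single a (v a) : Fin r → ℚ) = v a • Pi.single a 1 := by
        rw [← Pi.single_smul, smul_eq_mul, mul_one]
      rw [this, map_smul, smul_eq_mul, mul_comm]
    have h0 := h (fun a => f (Pi.single a 1)) fun i => by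
      rw [← hfa]
      exact hf (Submodule.subset_span ⟨i, rfl⟩)
    apply hf0
    ext a
    simpa using congrFun h0 a
  obtain ⟨κ, a, -, hsp, hli⟩ := exists_linearIndependent' ℚ ρ
  let B := Module.Basis.mk hli (by rw [hsp, hspan])
  have : Finite κ := Module.Finite.finite_basis B
  have := Fintype.ofFinite κ
  have hcard : Fintype.card κ = r := by
    rw [← Module.finrank_eq_card_basis B, Module.finrank_fin_fun]
  let e : Fin r ≃ κ := (Fintype.equivFinOfCardEq hcard).symm
  refine ⟨fun x => a (e x), ?_⟩
  have h2 : LinearIndependent ℚ (Matrix.of fun x y => ρ (a (e x)) y : Matrix (Fin r) (Fin r) ℚ).row :=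
    hli.comp e e.injective
  rw [Matrix.linearIndependent_rows_iff_isUnit, Matrix.isUnit_iff_isUnit_det] at h2
  exact h2.ne_zero

theorem norm_le_of_mulVec_eq {r : ℕ} (G : Matrix (Fin r) (Fin r) ℤ) (hG : G.det ≠ 0)
    (ξ v : Fin r → ℂ) (h : ∀ x, ∑ a, (G x a : ℂ) * ξ a = v x) (E V : ℝ) (hE : 0 ≤ E)
    (hGE : ∀ x a, |(G x a : ℝ)| ≤ E) (hV : ∀ x, ‖v x‖ ≤ V) (a : Fin r) :
    ‖ξ a‖ ≤ r.factorial * E ^ (r - 1) * V := by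
  obtain ⟨s, rfl⟩ : ∃ s, r = s + 1 := ⟨r - 1, by have := a.2; omega⟩
  have hV0 : 0 ≤ V := (norm_nonneg _).trans (hV a)
  have hadj : ∀ x, |((G.adjugate a x : ℤ) : ℝ)| ≤ s.factorial * E ^ s := by
    intro x
    rw [Matrix.adjugate_fin_succ_eq_det_submatrix]
    rw [Int.cast_mul, Int.cast_pow, Int.cast_neg, Int.cast_one]
    rw [abs_mul, abs_pow, abs_neg, abs_one, one_pow, one_mul]
    have h1 : ((((G.submatrix x.succAbove a.succAbove).det : ℤ)) : ℝ) =
        ((G.submatrix x.succAbove a.succAbove).map (Int.castRingHom ℝ)).det := by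
      rw [← RingHom.mapMatrix_apply, ← RingHom.map_det]; rfl
    rw [h1]
    have := Matrix.det_le (A := (G.submatrix x.succAbove a.succAbove).map (Int.castRingHom ℝ))
      (abv := AbsoluteValue.abs) (x := E) fun i j => hGE _ _
    rw [Fintype.card_fin, nsmul_eq_mul] at this
    exact this
  have h2 : (G.det : ℂ) * ξ a = ∑ x, (G.adjugate a x : ℂ) * v x := by
    have h3 : ∀ b, ∑ x, G.adjugate a x * G x b = if a = b then G.det else 0 := by
      intro b
      have := congrFun (congrFun (Matrix.adjugate_mul G) a) b
      rw [Matrix.mul_apply] at this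
      rw [this, Matrix.smul_apply, Matrix.one_apply]
      simp
    simp only [← h, Finset.mul_sum]
    rw [Finset.sum_comm]
    trans ∑ b, ((∑ x, G.adjugate a x * G x b : ℤ) : ℂ) * ξ b
    · simp only [h3]
      rw [Finset.sum_eq_single a]
      · simp
      · intro b _ hb; simp [hb.symm]
      · simp
    · refine Finset.sum_congr rfl fun b _ => ?_
      push_cast
      rw [Finset.sum_mul]
      exact Finset.sum_congr rfl fun x _ => by ring
  have h4 : (1 : ℝ) ≤ ‖(G.det : ℂ)‖ := by
    rw [Complex.norm_intCast]
    exact_mod_cast Int.one_le_abs hG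
  calc ‖ξ a‖ ≤ ‖(G.det : ℂ)‖ * ‖ξ a‖ := le_mul_of_one_le_left (norm_nonneg _) h4
    _ = ‖∑ x, (G.adjugate a x : ℂ) * v x‖ := by rw [← norm_mul, h2]
    _ ≤ ∑ _x : Fin (s + 1), (s.factorial * E ^ s) * V := by
        refine (norm_sum_le _ _).trans (Finset.sum_le_sum fun x _ => ?_)
        rw [norm_mul, Complex.norm_intCast]
        exact mul_le_mul (hadj x) (hV x) (norm_nonneg _) (by positivity)
    _ = _ := by
        rw [Finset.sum_const, Finset.card_univ, Fintype.card_fin, nsmul_eq_mul, Nat.factorial_succ,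
          Nat.add_sub_cancel]
        push_cast
        ring

/-- The sequence `g` is bounded by `Cᵏ (kᵏ)ᵉ` for some constant `C`. -/
def EB (e : ℕ) (g : ℕ → ℝ) : Prop := ∃ C : ℝ, 1 ≤ C ∧ ∀ k, 1 ≤ k →
  0 ≤ g k ∧ g k ≤ C ^ k * ((k : ℝ) ^ k) ^ e

theorem EB.mul {e e' : ℕ} {g g' : ℕ → ℝ} (h : EB e g) (h' : EB e' g') :
    EB (e + e') fun k => g k * g' k := by
  obtain ⟨C, hC, h⟩ := h
  obtain ⟨C', hC', h'⟩ := h'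
  refine ⟨C * C', by nlinarith, fun k hk => ⟨mul_nonneg (h k hk).1 (h' k hk).1, ?_⟩⟩
  refine (mul_le_mul (h k hk).2 (h' k hk).2 (h' k hk).1 (by positivity)).trans (le_of_eq ?_)
  rw [mul_pow, pow_add]
  ring

theorem eb_geom (C : ℝ) (hC : 1 ≤ C) : EB 0 fun k => C ^ k :=
  ⟨C, hC, fun k _ => ⟨by positivity, by simp⟩⟩

theorem eb_const (c : ℝ) (hc : 0 ≤ c) : EB 0 fun _ => c :=
  ⟨1 + c, by linarith, fun k hk => ⟨hc, by
    rw [pow_zero, mul_one]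
    calc c ≤ 1 + c := by linarith
      _ ≤ (1 + c) ^ k := le_self_pow₀ (by linarith) (by omega)⟩⟩

theorem EB.pow {e : ℕ} {g : ℕ → ℝ} (h : EB e g) (m : ℕ) : EB (m * e) fun k => g k ^ m := by
  induction m with
  | zero => simpa using eb_const 1 zero_le_one
  | succ m ih =>
    have := ih.mul h
    rw [show (m + 1) * e = m * e + e by ring]
    simpa only [pow_succ] using this

theorem eb_linear (a b : ℕ) : EB 0 fun k => (a : ℝ) * k + b := by
  refine ⟨2 ^ (a + b), one_le_pow₀ (by norm_num), fun k hk => ⟨by positivity, ?_⟩⟩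
  rw [pow_zero, mul_one, ← pow_mul]
  have h1 : a * k + b ≤ 2 ^ ((a + b) * k) := by
    have : a * k + b ≤ (a + b) * k := by nlinarith
    exact this.trans Nat.lt_two_pow_self.le
  show (a : ℝ) * k + b ≤ _
  exact_mod_cast h1

theorem eb_pow_linear (C : ℝ) (hC : 1 ≤ C) (a b : ℕ) : EB 0 fun k => C ^ (a * k + b) := by
  have := (eb_geom (C ^ a) (one_le_pow₀ hC)).mul (eb_const (C ^ b) (by positivity))
  simpa only [← pow_mul, ← pow_add] using this

theorem eb_factorial (q : ℕ) (hq : 1 ≤ q) : EB q fun k => ((q * k).factorial : ℝ) := by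
  refine ⟨(q : ℝ) ^ q, one_le_pow₀ (by exact_mod_cast hq), fun k _ => ⟨by positivity, ?_⟩⟩
  have h1 : (q * k).factorial ≤ (q * k) ^ (q * k) := Nat.factorial_le_pow _
  calc ((q * k).factorial : ℝ) ≤ ((q : ℝ) * k) ^ (q * k) := by exact_mod_cast h1
    _ = _ := by rw [mul_pow, pow_mul, ← pow_mul (k : ℝ), mul_comm q k]

theorem eb_pow_self (c : ℕ) : EB (2 * c) fun k => (((2 * k : ℕ) : ℝ) + 1) ^ (c * (2 * k)) := by
  refine ⟨9 ^ c, one_le_pow₀ (by norm_num), fun k hk => ⟨by positivity, ?_⟩⟩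
  have hk' : (1 : ℝ) ≤ k := by exact_mod_cast hk
  calc (((2 * k : ℕ) : ℝ) + 1) ^ (c * (2 * k)) ≤ (3 * (k : ℝ)) ^ (c * (2 * k)) := by
        gcongr
        push_cast
        linarith
    _ = _ := by
        rw [mul_pow, ← pow_mul, ← pow_mul, show (9 : ℝ) = 3 ^ 2 by norm_num, ← pow_mul]
        congr 2 <;> ring

theorem eq_zero_of_forall_large (x C : ℝ) (hx : 0 ≤ x) (k0 : ℕ)
    (h : ∀ k, k0 ≤ k → 1 ≤ k → x * (k : ℝ) ^ k ≤ C ^ k) : x = 0 := by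
  by_contra hne
  have hpos : 0 < x := lt_of_le_of_ne hx (Ne.symm hne)
  obtain ⟨n, hn⟩ := exists_pow_lt_of_lt_one hpos (show (1 / 2 : ℝ) < 1 by norm_num)
  obtain ⟨m, hm⟩ := exists_nat_ge (2 * |C|)
  set k := k0 + n + m + 1 with hk
  have h1 := h k (by omega) (by omega)
  have h2 : |C| ≤ k / 2 := by
    have : (m : ℝ) ≤ k := by exact_mod_cast (by omega : m ≤ k)
    linarith
  have hk0 : (0 : ℝ) < (k : ℝ) ^ k := by
    have : (0 : ℝ) < k := by exact_mod_cast (by omega : 0 < k)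
    positivity
  have h3 : C ^ k ≤ (1 / 2) ^ k * (k : ℝ) ^ k := by
    rw [← mul_pow]
    calc C ^ k ≤ |C| ^ k := by rw [← abs_pow]; exact le_abs_self _
      _ ≤ _ := pow_le_pow_left₀ (abs_nonneg _) (by linarith) k
  have h4 : x ≤ (1 / 2) ^ k := le_of_mul_le_mul_right (h1.trans h3) hk0
  have h5 : (1 / 2 : ℝ) ^ k ≤ (1 / 2) ^ n :=
    pow_le_pow_of_le_one (by norm_num) (by norm_num) (by omega)
  linarith

theorem add_le_natDegree_of_X_pow_dvd {Q : ℚ[X]} (hQ : Q ≠ 0) {a s : ℕ}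
    (ha : (PowerSeries.X : ℚ⟦X⟧) ^ a ∣ (Q : ℚ⟦X⟧)) (hs : (PowerSeries.X : ℚ⟦X⟧) ^ s ∣ rtau Q) :
    a + s ≤ Q.natDegree := by
  have key : ∀ (P : ℚ[X]) (n : ℕ), (PowerSeries.X : ℚ⟦X⟧) ^ n ∣ (P : ℚ⟦X⟧) →
      (Polynomial.X : ℚ[X]) ^ n ∣ P := by
    intro P n h
    rw [PowerSeries.X_pow_dvd_iff] at h
    rw [Polynomial.X_pow_dvd_iff]
    intro d hd
    simpa using h d hd
  have h1 := key Q a ha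
  rw [rtau_apply] at hs
  obtain ⟨H, hH⟩ := key _ s hs
  have h2 : (Polynomial.X - Polynomial.C 1 : ℚ[X]) ^ s ∣ Q := by
    refine ⟨Polynomial.taylor (-1) H, ?_⟩
    have := congrArg (Polynomial.taylor (-1)) hH
    rw [Polynomial.taylor_taylor, Polynomial.taylor_mul, Polynomial.taylor_pow,
      Polynomial.taylor_X] at this
    simpa [sub_eq_add_neg] using this
  have h3 : IsCoprime ((Polynomial.X : ℚ[X]) ^ a) ((Polynomial.X - Polynomial.C 1) ^ s) := by
    refine IsCoprime.pow ?_
    exact ⟨1, -1, by simp⟩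
  have h4 := Polynomial.natDegree_le_of_dvd (h3.mul_dvd h1 h2) hQ
  have h5 : ((Polynomial.X : ℚ[X]) ^ a * (Polynomial.X - Polynomial.C 1) ^ s).natDegree = a + s := by
    rw [Polynomial.natDegree_mul (pow_ne_zero _ Polynomial.X_ne_zero)
      (pow_ne_zero _ (Polynomial.X_sub_C_ne_zero _)), Polynomial.natDegree_X_pow,
      Polynomial.natDegree_pow, Polynomial.natDegree_X_sub_C, mul_one]
  omega

theorem det_mul_eq_sum_adjugate {R : Type*} [CommRing R] {N : ℕ} (B : Matrix (Fin N) (Fin N) R)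
    (v : Fin N → R) (j : Fin N) :
    B.det * v j = ∑ i, B.adjugate j i * ∑ l, B i l * v l := by
  have h : B.adjugate.mulVec (B.mulVec v) = B.det • v := by
    rw [Matrix.mulVec_mulVec, Matrix.adjugate_mul, Matrix.smul_mulVec, Matrix.one_mulVec]
  exact (congrFun h j).symm

theorem dvd_det_mul {R : Type*} [CommRing R] {N : ℕ} (B : Matrix (Fin N) (Fin N) R)
    (v : Fin N → R) (d : R) (h : ∀ i, d ∣ ∑ j, B i j * v j) (j : Fin N) : d ∣ B.det * v j := by
  rw [det_mul_eq_sum_adjugate]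
  exact Finset.dvd_sum fun i _ => (h i).mul_left _

theorem X_pow_dvd_of_mul {Q f : ℚ⟦X⟧} {M m : ℕ} (hf : PowerSeries.coeff m f ≠ 0)
    (h : (PowerSeries.X : ℚ⟦X⟧) ^ (M + m) ∣ Q * f) : (PowerSeries.X : ℚ⟦X⟧) ^ M ∣ Q := by
  have key : ∀ (n : ℕ) (g : ℚ⟦X⟧), (PowerSeries.X : ℚ⟦X⟧) ^ n ∣ g ↔ (n : ℕ∞) ≤ g.order :=
    fun n g => PowerSeries.X_pow_dvd_iff.trans
      ⟨fun h => PowerSeries.nat_le_order _ _ h, fun h i hi => PowerSeries.coeff_of_lt_order i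
        (lt_of_lt_of_le (by exact_mod_cast hi) h)⟩
  rw [key] at h ⊢
  rw [PowerSeries.order_mul] at h
  have h1 : f.order ≤ m := PowerSeries.order_le m hf
  have h2 : ((M : ℕ∞) + m) ≤ Q.order + m := by
    push_cast at h
    exact h.trans (by gcongr)
  exact (ENat.add_le_add_iff_right (ENat.natCast_ne_top m)).mp h2

/-- A nonzero linear form close to a Padé approximation yields, after expansion at `z = 1`,
enough independent linear relations. -/
theorem ESys.exists_minor_ne_zero {N r : ℕ} (S : ESys N) (hN : 1 ≤ N)
    (Y : Fin N → Fin r → ℚ⟦X⟧)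
    (hY : ∀ μ : Fin r → ℚ, (∀ j, ∑ a, μ a • Y j a = 0) → μ = 0) :
    ∃ k0 : ℕ, ∀ q k M, 2 ≤ q → k0 ≤ k → M + k = N * q * k → ∀ P : Fin N → ℤ[X], P ≠ 0 →
      (∀ j, (P j).natDegree ≤ q * k) →
      (PowerSeries.X : ℚ⟦X⟧) ^ (M + N) ∣ S.form P →
      ∃ b : Fin r → Fin N × Fin (2 * k + 1),
        (Matrix.of fun x a => PowerSeries.coeff ((b x).2 : ℕ)
          (∑ j, rtau (zq (S.nab^[(b x).1] P j)) * Y j a)).det ≠ 0 := by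
  obtain ⟨c, hc⟩ := S.zero_estimate
  let j0 : Fin N := ⟨0, hN⟩
  have hy0 : S.y j0 ≠ 0 := S.indep.ne_zero j0
  obtain ⟨o, ho⟩ : ∃ o, PowerSeries.coeff o (S.y j0) ≠ 0 := by
    by_contra! h
    exact hy0 (PowerSeries.ext fun n => by simpa using h n)
  let H : Submodule ℚ ℚ⟦X⟧ := Submodule.span ℚ (Set.range fun p : Fin N × Fin r => Y p.1 p.2)
  have : FiniteDimensional ℚ H := FiniteDimensional.span_of_finite ℚ (Set.finite_range _)
  obtain ⟨L0, hL0⟩ := exists_order_bound H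
  refine ⟨c + o + N * (N * S.deg) + L0 + 1, fun q k M hq hk hM P hP hdeg hdvd => ?_⟩
  have hdet := hc (q * k) P hP hdeg ((pow_dvd_pow _ ?_).trans hdvd)
  swap
  · obtain ⟨N', rfl⟩ : ∃ N', N = N' + 1 := ⟨N - 1, by omega⟩
    simp only [Nat.add_sub_cancel]
    have h1 : (N' + 1) * q * k = N' * (q * k) + q * k := by ring
    have h2 : 2 * k ≤ q * k := Nat.mul_le_mul_right _ hq
    omega
  set B : Matrix (Fin N) (Fin N) ℤ[X] := Matrix.of fun i j : Fin N => S.nab^[i] P j with hB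
  have hBdeg : B.det.natDegree ≤ N * (q * k + N * S.deg) := by
    refine natDegree_det_le B _ fun i j => ?_
    refine (S.natDegree_nab_iterate_le P (q * k) hdeg i j).trans ?_
    have : (i : ℕ) * S.deg ≤ N * S.deg := Nat.mul_le_mul_right _ i.2.le
    omega
  have hQ0 : zq B.det ≠ 0 := fun h => hdet (zq_injective (by rw [h, map_zero]))
  have hQdeg : (zq B.det).natDegree ≤ N * (q * k + N * S.deg) :=
    (Polynomial.natDegree_map_le).trans hBdeg
  let coeZ : ℤ[X] →+* ℚ⟦X⟧ := (Polynomial.coeToPowerSeries.ringHom).comp zq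
  have hdivM : (PowerSeries.X : ℚ⟦X⟧) ^ M ∣ (zq B.det : ℚ⟦X⟧) * S.y j0 := by
    have h1 : (zq B.det : ℚ⟦X⟧) = (B.map coeZ).det := by
      rw [← RingHom.mapMatrix_apply, ← RingHom.map_det]; rfl
    rw [h1]
    refine dvd_det_mul _ S.y _ (fun i => ?_) j0
    have h2 := S.X_pow_dvd_form_nab_iterate P M i ((pow_dvd_pow _ (by omega)).trans hdvd)
    rw [ESys.form] at h2
    convert h2 using 2 with j
    rw [smul_eq_coe_mul]
    rfl
  have hbound : ∀ s, (PowerSeries.X : ℚ⟦X⟧) ^ s ∣ rtau (zq B.det) →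
      s ≤ k + o + N * (N * S.deg) := by
    intro s hs
    have h1 : (PowerSeries.X : ℚ⟦X⟧) ^ (M - o) ∣ (zq B.det : ℚ⟦X⟧) := by
      by_cases hMo : o ≤ M
      · exact X_pow_dvd_of_mul ho (by rwa [Nat.sub_add_cancel hMo])
      · rw [Nat.sub_eq_zero_of_le (by omega), pow_zero]
        exact one_dvd _
    have h2 := add_le_natDegree_of_X_pow_dvd hQ0 h1 hs
    have h3 : N * (q * k + N * S.deg) = N * q * k + N * (N * S.deg) := by ring
    omega
  refine exists_det_ne_zero (fun (p : Fin N × Fin (2 * k + 1)) a => PowerSeries.coeff (p.2 : ℕ)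
      (∑ j, rtau (zq (S.nab^[p.1] P j)) * Y j a)) fun μ hμ => hY μ fun j => ?_
  by_contra hne
  let Fv : Fin N → ℚ⟦X⟧ := fun j => ∑ a, μ a • Y j a
  obtain ⟨m, hm, hmne⟩ := hL0 (Fv j) (Submodule.sum_mem _ fun a _ => Submodule.smul_mem _ _
    (Submodule.subset_span ⟨(j, a), rfl⟩)) hne
  have hdiv2 : (PowerSeries.X : ℚ⟦X⟧) ^ (2 * k + 1) ∣ rtau (zq B.det) * Fv j := by
    have h1 : rtau (zq B.det) = (B.map (rtau.comp zq)).det := by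
      rw [← RingHom.mapMatrix_apply, ← RingHom.map_det]; rfl
    rw [h1]
    refine dvd_det_mul _ Fv _ (fun i => ?_) j
    rw [PowerSeries.X_pow_dvd_iff]
    intro l hl
    have h2 := hμ (i, ⟨l, hl⟩)
    have h3 : ∑ j, (B.map (rtau.comp zq)) i j * Fv j =
        ∑ a, μ a • ∑ j, rtau (zq (S.nab^[i] P j)) * Y j a := by
      simp only [Fv, Finset.mul_sum, Finset.smul_sum]
      rw [Finset.sum_comm]
      refine Finset.sum_congr rfl fun a _ => Finset.sum_congr rfl fun j _ => ?_
      rw [mul_smul_comm]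
      rfl
    rw [h3, map_sum]
    simpa using h2
  have h4 := hbound (2 * k + 1 - m) (X_pow_dvd_of_mul hmne (by
    rwa [Nat.sub_add_cancel (by omega)]))
  omega

theorem exists_int_coeff_sum {N : ℕ} (p : Fin N → ℤ[X]) (f : Fin N → ℚ⟦X⟧) (d b : ℕ) {B₁ B₂ : ℝ}
    (hB₁ : 0 ≤ B₁) (hB₂ : 0 ≤ B₂) (hp : ∀ j, Bo B₁ (p j))
    (hf : ∀ j, ∀ i ≤ b, ∃ z : ℤ, (d : ℚ) * PowerSeries.coeff i (f j) = z ∧ |(z : ℝ)| ≤ B₂)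
    {l : ℕ} (hl : l ≤ b) :
    ∃ z : ℤ, (d : ℚ) * PowerSeries.coeff l (∑ j, (zq (p j) : ℚ⟦X⟧) * f j) = z ∧
      |(z : ℝ)| ≤ N * ((b : ℝ) + 1) * (B₁ * B₂) := by
  choose! z hz hzB using hf
  refine ⟨∑ j, ∑ x ∈ Finset.HasAntidiagonal.antidiagonal l, (p j).coeff x.1 * z j x.2, ?_, ?_⟩
  · rw [map_sum, Finset.mul_sum]
    push_cast
    refine Finset.sum_congr rfl fun j _ => ?_
    rw [PowerSeries.coeff_mul, Finset.mul_sum]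
    refine Finset.sum_congr rfl fun x hx => ?_
    have hx2 : x.2 ≤ b := by
      have := Finset.HasAntidiagonal.mem_antidiagonal.mp hx
      omega
    rw [Polynomial.coeff_coe, zq_coeff, ← hz j x.2 hx2]
    ring
  · push_cast
    calc |∑ j, ∑ x ∈ Finset.HasAntidiagonal.antidiagonal l, ((p j).coeff x.1 : ℝ) * z j x.2|
        ≤ ∑ _j : Fin N, ∑ _x ∈ Finset.HasAntidiagonal.antidiagonal l, B₁ * B₂ := by
          refine (Finset.abs_sum_le_sum_abs _ _).trans (Finset.sum_le_sum fun j _ => ?_)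
          refine (Finset.abs_sum_le_sum_abs _ _).trans (Finset.sum_le_sum fun x hx => ?_)
          have hx2 : x.2 ≤ b := by
            have := Finset.HasAntidiagonal.mem_antidiagonal.mp hx
            omega
          rw [abs_mul]
          exact mul_le_mul (hp j _) (hzB j _ hx2) (abs_nonneg _) hB₁
      _ = N * ((l : ℝ) + 1) * (B₁ * B₂) := by
          simp only [Finset.sum_const, Finset.Nat.card_antidiagonal, Finset.card_univ,
            Fintype.card_fin, nsmul_eq_mul]
          push_cast
          ring
      _ ≤ _ := by gcongr

theorem EB.congr {e e' : ℕ} {g g' : ℕ → ℝ} (h : EB e g) (he : e = e') (hg : ∀ k, g' k = g k) :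
    EB e' g' := by
  obtain rfl : g' = g := funext hg
  rwa [← he]

theorem ESys.tau_form {N r : ℕ} (S : ESys N) (ξ : Fin r → ℂ) (Y : Fin N → Fin r → ℚ⟦X⟧)
    (hτ : ∀ j, tau (S.y j) = ∑ a, PowerSeries.C (ξ a) * qc (Y j a)) (P : Fin N → ℤ[X]) :
    tau (S.form P) = ∑ a, PowerSeries.C (ξ a) * qc (∑ j, rtau (zq (P j)) * Y j a) := by
  rw [ESys.form, tau_sum _ _ fun j _ => (S.gr j).smul _]
  simp only [tau_smul _ (S.gr _), hτ, Finset.mul_sum, map_sum, map_mul]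
  rw [Finset.sum_comm]
  exact Finset.sum_congr rfl fun a _ => Finset.sum_congr rfl fun j _ => by ring

theorem ESys.gr_form {N : ℕ} (S : ESys N) (P : Fin N → ℤ[X]) : Gr (S.form P) :=
  Gr.sum _ _ fun j _ => (S.gr j).smul _

/-- The values at `1` of all derivatives of the functions of a system of rank `N` span a
`ℚ`-vector space of dimension at least `N`. -/
theorem ESys.rank_le {N r : ℕ} (S : ESys N) (ξ : Fin r → ℂ) (a₀ : Fin r) (hξ : ξ a₀ ≠ 0)
    (Y : Fin N → Fin r → ℚ⟦X⟧)
    (hτ : ∀ j, tau (S.y j) = ∑ a, PowerSeries.C (ξ a) * qc (Y j a))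
    (hctl : ∀ j a, Ctl fun n => PowerSeries.coeff n (Y j a))
    (hY : ∀ μ : Fin r → ℚ, (∀ j, ∑ a, μ a • Y j a = 0) → μ = 0) : N ≤ r := by
  by_contra! hrN
  have hr1 : 1 ≤ r := by have := a₀.2; omega
  have hN : 1 ≤ N := by omega
  obtain ⟨C₀, c, hC₀, hden⟩ := ctl_family
    (fun (x : Fin N × Fin r) n => PowerSeries.coeff n (Y x.1 x.2)) fun x => hctl x.1 x.2
  set q := 2 * c * N + 2 with hq
  obtain ⟨C₁, hC₁, hpade⟩ := S.exists_pade hN q (by omega)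
  obtain ⟨K, hK, hbo⟩ := S.exists_bo_nab_iterate
  obtain ⟨K', C', hK', hC', hbd⟩ := S.exists_bd_nab C₁ hC₁ N
  obtain ⟨k0, hk0⟩ := S.exists_minor_ne_zero hN Y hY
  let Dk : ℕ → ℝ := fun k => C₀ ^ (2 * k + 1) * (((2 * k : ℕ) : ℝ) + 1) ^ (c * (2 * k))
  let Pk : ℕ → ℝ := fun k => ((q * k).factorial : ℝ) * C₁ ^ k
  let n' : ℕ → ℕ := fun k => q * k + N * S.deg
  let Tk : ℕ → ℝ := fun k => ((n' k : ℝ) + 1) * 2 ^ (n' k) *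
    ((K * (((q * k : ℕ) : ℝ) + 1)) ^ N * Pk k)
  let E : ℕ → ℝ := fun k => N * (((2 * k : ℕ) : ℝ) + 1) * (Tk k * Dk k)
  let W : ℕ → ℝ := fun k => Dk k * (K' * Pk k * (2 * C') ^ ((N * q - 1) * k) * Real.exp C')
  have hDk : EB (2 * c) Dk :=
    ((eb_pow_linear C₀ hC₀ 2 1).mul (eb_pow_self c)).congr (by omega) fun k => rfl
  have hPk : EB q Pk :=
    ((eb_factorial q (by omega)).mul (eb_geom C₁ hC₁)).congr (by omega) fun k => rfl
  have hTk : EB q Tk := by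
    refine (((eb_linear q (N * S.deg + 1)).mul (eb_pow_linear 2 (by norm_num) q (N * S.deg))).mul
      ((((eb_const K (by linarith)).mul (eb_linear q 1)).pow N).mul hPk)).congr (by omega)
      fun k => ?_
    simp only [Tk, n']
    push_cast
    ring
  have hE : EB (q + 2 * c) E := by
    refine (((eb_const N (by positivity)).mul (eb_linear 2 1)).mul (hTk.mul hDk)).congr (by omega)
      fun k => ?_
    simp only [E]
    push_cast
    ring
  have hW : EB (q + 2 * c) W := by
    refine (hDk.mul ((((eb_const K' (by linarith)).mul hPk).mul
      (eb_pow_linear (2 * C') (by linarith) (N * q - 1) 0)).mul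
      (eb_const (Real.exp C') (Real.exp_nonneg _)))).congr (by omega) fun k => rfl
  have hfin : EB (r * (q + 2 * c)) fun k => (r.factorial : ℝ) * E k ^ (r - 1) * W k := by
    refine (((eb_const (r.factorial : ℝ) (by positivity)).mul (hE.pow (r - 1))).mul hW).congr ?_
      fun k => rfl
    obtain ⟨s, rfl⟩ : ∃ s, r = s + 1 := ⟨r - 1, by omega⟩
    simp only [Nat.add_sub_cancel]
    ring
  have key : ∀ k, k0 ≤ k → 1 ≤ k → ‖ξ a₀‖ * (((N * q - 1) * k).factorial : ℝ) ≤
      (r.factorial : ℝ) * E k ^ (r - 1) * W k := by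
    intro k hk hk1
    obtain ⟨P, hP0, hPdeg, hPbo, hPbd⟩ := hpade k hk1
    obtain ⟨d, hd0, hd, hdz⟩ := hden (2 * k)
    have hPk0 : 0 ≤ Pk k := (hPk.choose_spec.2 k hk1).1
    have hDk0 : 0 ≤ Dk k := (hDk.choose_spec.2 k hk1).1
    have hTk0 : 0 ≤ Tk k := (hTk.choose_spec.2 k hk1).1
    have hE0 : 0 ≤ E k := (hE.choose_spec.2 k hk1).1
    have hNq : 4 ≤ N * q := by nlinarith
    have hM : (N * q - 1) * k + k = N * q * k := by
      obtain ⟨s, hs⟩ : ∃ s, N * q = s + 1 := ⟨N * q - 1, by omega⟩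
      rw [hs, Nat.add_sub_cancel]; ring
    have hMk : 2 * k ≤ (N * q - 1) * k := Nat.mul_le_mul_right _ (by omega)
    set M := (N * q - 1) * k with hMdef
    obtain ⟨b, hb⟩ := hk0 q k M (by omega) hk hM P hP0 hPdeg
      (PowerSeries.X_pow_dvd_iff.mpr fun m hm => hPbd.1 m hm)
    have hG : ∀ (x a : Fin r), ∃ z : ℤ, (d : ℚ) * PowerSeries.coeff ((b x).2 : ℕ)
        (∑ j, rtau (zq (S.nab^[(b x).1] P j)) * Y j a) = z ∧ |(z : ℝ)| ≤ E k := by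
      intro x a
      simp only [rtau_zq]
      refine exists_int_coeff_sum _ _ d (2 * k) hTk0 hDk0 (fun j => ?_) (fun j => hdz (j, a))
        (by have := (b x).2.2; omega)
      have h1 := hbo (q * k) (Pk k) P hPk0 hPdeg hPbo (b x).1 (b x).1.2.le j
      refine h1.taylor ((S.natDegree_nab_iterate_le P (q * k) hPdeg _ j).trans ?_)
      have : ((b x).1 : ℕ) * S.deg ≤ N * S.deg := Nat.mul_le_mul_right _ (b x).1.2.le
      exact Nat.add_le_add_left this _
    choose G hG hGE using hG
    have hdet : (Matrix.of G).det ≠ 0 := by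
      intro h0
      have h1 : ((Matrix.of G).map (Int.castRingHom ℚ)) = (d : ℚ) •
          (Matrix.of fun x a => PowerSeries.coeff ((b x).2 : ℕ)
          (∑ j, rtau (zq (S.nab^[(b x).1] P j)) * Y j a)) := by
        ext x a
        simpa using (hG x a).symm
      have h2 := congrArg Matrix.det h1
      rw [← RingHom.mapMatrix_apply, ← RingHom.map_det, h0, map_zero, Matrix.det_smul] at h2
      refine hb ((mul_eq_zero.mp h2.symm).resolve_left (pow_ne_zero _ ?_))
      exact_mod_cast hd0.ne'
    have h3 := norm_le_of_mulVec_eq (Matrix.of G) hdet ξ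
      (fun x => (d : ℂ) * PowerSeries.coeff ((b x).2 : ℕ) (tau (S.form (S.nab^[(b x).1] P))))
      (fun x => ?_) (E k) (W k / M.factorial) hE0 hGE (fun x => ?_) a₀
    · rw [mul_div_assoc'] at h3
      rwa [le_div_iff₀ (by positivity)] at h3
    · rw [S.tau_form ξ Y hτ, map_sum, Finset.mul_sum]
      refine Finset.sum_congr rfl fun a _ => ?_
      rw [PowerSeries.coeff_C_mul, PowerSeries.coeff_map]
      have h4 : ((G x a : ℚ) : ℂ) = (d : ℂ) * ((PowerSeries.coeff ((b x).2 : ℕ)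
        (∑ j, rtau (zq (S.nab^[(b x).1] P j)) * Y j a) : ℚ) : ℂ) := by
        rw [← hG]; push_cast; rfl
      rw [Matrix.of_apply]
      rw [show ((G x a : ℤ) : ℂ) = ((G x a : ℚ) : ℂ) by push_cast; rfl, h4, eq_ratCast]
      ring
    · have h5 := (hbd (b x).1 (b x).1.2.le _ M P hPk0 hPbd).norm_coeff_tau_le (by positivity)
        (by linarith) (S.gr_form _) (l := ((b x).2 : ℕ)) (by have := (b x).2.2; omega)
      rw [norm_mul, Complex.norm_natCast]
      refine (mul_le_mul hd h5 (norm_nonneg _) hDk0).trans (le_of_eq ?_)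
      simp only [W]
      rw [mul_div_assoc']
  obtain ⟨Cf, hCf, hfin⟩ := hfin
  refine hξ (norm_eq_zero.mp (eq_zero_of_forall_large ‖ξ a₀‖ (Real.exp 1 * Cf) (norm_nonneg _) k0
    fun k hk hk1 => ?_))
  have h1 := (key k hk hk1).trans (hfin k hk1).2
  have hk1' : (1 : ℝ) ≤ k := by exact_mod_cast hk1
  set e := r * (q + 2 * c) with he
  have hexp : e + 1 ≤ N * q - 1 := by
    have h2 : (r + 1) * q ≤ N * q := Nat.mul_le_mul_right _ hrN
    have h3 : c * r ≤ c * N := Nat.mul_le_mul_left _ hrN.le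
    have h4 : e + 2 ≤ (r + 1) * q := by rw [he]; nlinarith
    omega
  have hfac : ((k : ℝ) ^ k) ^ (e + 1) ≤ (((N * q - 1) * k).factorial : ℝ) * Real.exp 1 ^ k := by
    calc ((k : ℝ) ^ k) ^ (e + 1) ≤ ((k : ℝ) ^ k) ^ (N * q - 1) :=
          pow_le_pow_right₀ (one_le_pow₀ hk1') hexp
      _ = (k : ℝ) ^ ((N * q - 1) * k) := by rw [← pow_mul, mul_comm]
      _ ≤ _ := by
        have h5 := Real.pow_div_factorial_le_exp (k : ℝ) (by positivity) ((N * q - 1) * k)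
        rw [div_le_iff₀ (by positivity)] at h5
        rw [← Real.exp_nat_mul, mul_one]
        linarith
  have hpos : (0 : ℝ) < ((k : ℝ) ^ k) ^ e := by positivity
  refine le_of_mul_le_mul_right ?_ hpos
  calc ‖ξ a₀‖ * (k : ℝ) ^ k * ((k : ℝ) ^ k) ^ e = ‖ξ a₀‖ * ((k : ℝ) ^ k) ^ (e + 1) := by ring
    _ ≤ ‖ξ a₀‖ * ((((N * q - 1) * k).factorial : ℝ) * Real.exp 1 ^ k) := by gcongr
    _ = (‖ξ a₀‖ * (((N * q - 1) * k).factorial : ℝ)) * Real.exp 1 ^ k := by ring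
    _ ≤ (Cf ^ k * ((k : ℝ) ^ k) ^ e) * Real.exp 1 ^ k := by gcongr
    _ = _ := by rw [mul_pow]; ring

/-- Series whose constant coefficients are linearly independent over `ℚ` are linearly independent
over `ℚ⟦t⟧`. -/
theorem eq_zero_of_sum_qc_mul {ι : Type*} [Fintype ι] (u : ι → ℂ⟦X⟧)
    (hu : LinearIndependent ℚ fun i => PowerSeries.coeff 0 (u i)) (x : ι → ℚ⟦X⟧)
    (h : ∑ i, qc (x i) * u i = 0) : x = 0 := by
  have key : ∀ n, ∀ i, PowerSeries.coeff n (x i) = 0 := by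
    intro n
    induction n using Nat.strong_induction_on with
    | _ n ih =>
      have h1 := congrArg (PowerSeries.coeff n) h
      rw [map_sum, map_zero] at h1
      have h2 : ∀ i, PowerSeries.coeff n (qc (x i) * u i) =
          PowerSeries.coeff n (x i) • PowerSeries.coeff 0 (u i) := by
        intro i
        rw [PowerSeries.coeff_mul, Finset.sum_eq_single (n, 0)]
        · rw [PowerSeries.coeff_map, Algebra.smul_def]
        · intro p hp hne
          have hp' := Finset.HasAntidiagonal.mem_antidiagonal.mp hp
          have hlt : p.1 < n := by
            by_contra hcon
            exact hne (Prod.ext (by simp only; omega) (by simp only; omega))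
          rw [PowerSeries.coeff_map, ih _ hlt, map_zero, zero_mul]
        · intro hp
          exact absurd (Finset.HasAntidiagonal.mem_antidiagonal.mpr (by simp)) hp
      simp only [h2] at h1
      exact Fintype.linearIndependent_iff.mp hu _ h1
  exact funext fun i => PowerSeries.ext fun n => by simpa using key n i

/-- `u` lies in the `ℚ((t))`-span of the expansions at `1` of the functions of the system. -/
def ESys.Near {N : ℕ} (S : ESys N) (u : ℂ⟦X⟧) : Prop :=
  ∃ (c : ℚ⟦X⟧) (e : Fin N → ℚ⟦X⟧), c ≠ 0 ∧ qc c * u = ∑ j, qc (e j) * tau (S.y j)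

theorem ESys.near_zero {N : ℕ} (S : ESys N) : S.Near 0 := ⟨1, 0, one_ne_zero, by simp⟩

theorem ESys.near_tau {N : ℕ} (S : ESys N) (j : Fin N) : S.Near (tau (S.y j)) := by
  classical
  refine ⟨1, Pi.single j 1, one_ne_zero, ?_⟩
  rw [Finset.sum_eq_single j]
  · simp
  · intro b _ hb; simp [hb]
  · simp

theorem ESys.Near.add {N : ℕ} {S : ESys N} {u v : ℂ⟦X⟧} (hu : S.Near u) (hv : S.Near v) :
    S.Near (u + v) := by
  obtain ⟨c, e, hc, h⟩ := hu
  obtain ⟨c', e', hc', h'⟩ := hv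
  refine ⟨c * c', fun j => c' * e j + c * e' j, mul_ne_zero hc hc', ?_⟩
  have h1 : qc (c * c') * (u + v) = qc c' * (qc c * u) + qc c * (qc c' * v) := by
    rw [map_mul]; ring
  rw [h1, h, h', Finset.mul_sum, Finset.mul_sum, ← Finset.sum_add_distrib]
  refine Finset.sum_congr rfl fun j _ => ?_
  rw [map_add, map_mul, map_mul]; ring

theorem ESys.Near.qc_mul {N : ℕ} {S : ESys N} {u : ℂ⟦X⟧} (hu : S.Near u) (x : ℚ⟦X⟧) :
    S.Near (qc x * u) := by
  obtain ⟨c, e, hc, h⟩ := hu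
  refine ⟨c, fun j => x * e j, hc, ?_⟩
  rw [mul_left_comm, h, Finset.mul_sum]
  exact Finset.sum_congr rfl fun j _ => by rw [map_mul, mul_assoc]

theorem ESys.near_sum {N : ℕ} (S : ESys N) {ι : Type*} (s : Finset ι) (u : ι → ℂ⟦X⟧)
    (h : ∀ i ∈ s, S.Near (u i)) : S.Near (∑ i ∈ s, u i) := by
  classical
  induction s using Finset.induction_on with
  | empty => simpa using S.near_zero
  | insert a s ha ih =>
    rw [Finset.sum_insert ha]
    exact (h a (Finset.mem_insert_self _ _)).add (ih fun i hi => h i (Finset.mem_insert_of_mem hi))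

theorem ESys.Near.of_qc_mul {N : ℕ} {S : ESys N} {u : ℂ⟦X⟧} {x : ℚ⟦X⟧} (hx : x ≠ 0)
    (hu : S.Near (qc x * u)) : S.Near u := by
  obtain ⟨c, e, hc, h⟩ := hu
  exact ⟨c * x, e, mul_ne_zero hc hx, by rw [map_mul, mul_assoc, h]⟩

theorem derivative_qc (x : ℚ⟦X⟧) : PowerSeries.derivative ℂ (qc x) = qc (D x) := by
  ext n
  rw [PowerSeries.coeff_derivative, PowerSeries.coeff_map, PowerSeries.coeff_map, coeff_D]
  simp

theorem ESys.near_derivative_tau {N : ℕ} (S : ESys N) (j : Fin N) :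
    S.Near (PowerSeries.derivative ℂ (tau (S.y j))) := by
  rw [← tau_D]
  refine ESys.Near.of_qc_mul (x := rtau (zq S.T)) ?_ ?_
  · intro h
    exact S.T_ne (zq_injective (rtau_injective (by rw [h, map_zero, map_zero])))
  · rw [← tau_smul _ (S.gr j).D, S.hD, tau_sum _ _ fun l _ => (S.gr l).smul _]
    refine S.near_sum _ _ fun l _ => ?_
    rw [tau_smul _ (S.gr l)]
    exact (S.near_tau l).qc_mul _

theorem ESys.Near.derivative {N : ℕ} {S : ESys N} {u : ℂ⟦X⟧} (hu : S.Near u) :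
    S.Near (PowerSeries.derivative ℂ u) := by
  have hu' := hu
  obtain ⟨c, e, hc, h⟩ := hu'
  have h1 := congrArg (PowerSeries.derivative ℂ) h
  rw [Derivation.leibniz, map_sum] at h1
  simp only [Derivation.leibniz, derivative_qc, smul_eq_mul] at h1
  refine ESys.Near.of_qc_mul hc ?_
  rw [eq_sub_of_add_eq h1, sub_eq_add_neg]
  refine (S.near_sum _ _ fun j _ => ?_).add ?_
  · refine ((S.near_derivative_tau j).qc_mul _).add ?_
    rw [mul_comm]
    exact (S.near_tau j).qc_mul _
  · have := hu.qc_mul (-D c)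
    rw [map_neg, neg_mul, mul_comm] at this
    exact this

theorem ESys.near_tau_iterate {N : ℕ} (S : ESys N) (j : Fin N) (l : ℕ) :
    S.Near (tau (D^[l] (S.y j))) := by
  induction l with
  | zero => exact S.near_tau j
  | succ l ih => rw [Function.iterate_succ_apply', tau_D]; exact ih.derivative

/-- The `ℚ`-space of constant terms of the series in the span of the expansions at `1`. -/
def ESys.nearConst {N : ℕ} (S : ESys N) : Submodule ℚ ℂ where
  carrier := {v | ∃ u, S.Near u ∧ PowerSeries.coeff 0 u = v}
  zero_mem' := ⟨0, S.near_zero, by simp⟩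
  add_mem' := by
    rintro _ _ ⟨u, hu, rfl⟩ ⟨v, hv, rfl⟩
    exact ⟨u + v, hu.add hv, by simp⟩
  smul_mem' := by
    rintro x _ ⟨u, hu, rfl⟩
    refine ⟨_, hu.qc_mul (PowerSeries.C x), ?_⟩
    rw [PowerSeries.map_C, PowerSeries.coeff_C_mul, Algebra.smul_def]

theorem ESys.near_common {N : ℕ} (S : ESys N) {ι : Type*} [Fintype ι] (u : ι → ℂ⟦X⟧)
    (hu : ∀ i, S.Near (u i)) : ∃ (c : ℚ⟦X⟧) (e : ι → Fin N → ℚ⟦X⟧), c ≠ 0 ∧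
      ∀ i, qc c * u i = ∑ j, qc (e i j) * tau (S.y j) := by
  classical
  choose c e hc h using hu
  refine ⟨∏ i, c i, fun i j => (∏ i' ∈ Finset.univ.erase i, c i') * e i j,
    Finset.prod_ne_zero_iff.mpr fun i _ => hc i, fun i => ?_⟩
  rw [← Finset.prod_erase_mul _ _ (Finset.mem_univ i), map_mul, mul_assoc, h, Finset.mul_sum]
  exact Finset.sum_congr rfl fun j _ => by rw [map_mul, mul_assoc]

theorem qc_ne_zero {c : ℚ⟦X⟧} (hc : c ≠ 0) : qc c ≠ 0 := fun h =>
  hc (qc_injective (by rw [h, map_zero]))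

theorem ESys.rank_nearConst_le {N : ℕ} (S : ESys N) : Module.rank ℚ S.nearConst ≤ N := by
  classical
  refine _root_.rank_le fun s hs => ?_
  by_contra! hN
  choose u hu hu0 using fun v : s => v.1.2
  obtain ⟨c, e, hc, h⟩ := S.near_common u hu
  have hnot : ¬ LinearIndependent ℚ⟦X⟧ e := by
    intro hli
    have := hli.fintype_card_le_finrank
    rw [Module.finrank_fin_fun, Fintype.card_coe] at this
    omega
  rw [Fintype.linearIndependent_iff] at hnot
  push Not at hnot
  obtain ⟨x, hx, i, hi⟩ := hnot
  refine hi (congrFun (eq_zero_of_sum_qc_mul u ?_ x ?_) i)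
  · simp only [hu0]
    exact hs.map' S.nearConst.subtype (Submodule.ker_subtype _)
  · refine (mul_eq_zero.mp ?_).resolve_left (qc_ne_zero hc)
    rw [Finset.mul_sum]
    simp only [mul_left_comm (qc c), h, Finset.mul_sum]
    rw [Finset.sum_comm]
    refine Finset.sum_eq_zero fun j _ => ?_
    have h1 := congrFun hx j
    simp only [Finset.sum_apply, Pi.smul_apply, smul_eq_mul, Pi.zero_apply] at h1
    rw [← zero_mul (tau (S.y j)), ← map_zero qc, ← h1, map_sum, Finset.sum_mul]
    exact Finset.sum_congr rfl fun i _ => by rw [map_mul, mul_assoc]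

/-- The `ℚ`-space spanned by the values at `1` of all derivatives of the functions. -/
def ESys.values {N : ℕ} (S : ESys N) : Submodule ℚ ℂ :=
  Submodule.span ℚ (Set.range fun p : Fin N × ℕ => PowerSeries.coeff p.2 (tau (S.y p.1)))

theorem ESys.coeff_tau_mem_values {N : ℕ} (S : ESys N) (j : Fin N) (l : ℕ) :
    PowerSeries.coeff l (tau (S.y j)) ∈ S.values := Submodule.subset_span ⟨(j, l), rfl⟩

theorem ESys.values_le {N : ℕ} (S : ESys N) : S.values ≤ S.nearConst := by
  refine Submodule.span_le.mpr ?_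
  rintro _ ⟨⟨j, l⟩, rfl⟩
  have h : PowerSeries.coeff l (tau (S.y j)) =
      ((l.factorial : ℚ)⁻¹) • PowerSeries.coeff 0 (tau (D^[l] (S.y j))) := by
    rw [coeff_tau, coeff_tau, Algebra.smul_def]
    simp only [Function.iterate_zero, id, Nat.factorial_zero, Nat.cast_one, div_one]
    rw [div_eq_inv_mul]
    simp
  simp only [h]
  exact S.nearConst.smul_mem _ ⟨_, S.near_tau_iterate j l, rfl⟩

theorem ESys.finrank_nearConst {N : ℕ} (S : ESys N) :
    FiniteDimensional ℚ S.nearConst ∧ Module.finrank ℚ S.nearConst ≤ N :=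
  ⟨Module.rank_lt_aleph0_iff.mp (S.rank_nearConst_le.trans_lt Cardinal.natCast_lt_aleph0),
    Module.finrank_le_of_rank_le S.rank_nearConst_le⟩

/-- A basis of a finite-dimensional subspace together with extended coordinate functionals. -/
theorem exists_basis_dual (V : Submodule ℚ ℂ) [FiniteDimensional ℚ V] :
    ∃ (ξ : Fin (Module.finrank ℚ V) → ℂ) (φ : Fin (Module.finrank ℚ V) → ℂ →ₗ[ℚ] ℚ),
      LinearIndependent ℚ ξ ∧ Submodule.span ℚ (Set.range ξ) = V ∧
      (∀ v ∈ V, v = ∑ a, ξ a * ((φ a v : ℚ) : ℂ)) ∧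
      ∀ a b, φ a (ξ b) = if a = b then 1 else 0 := by
  classical
  let β := Module.finBasis ℚ V
  have hext : ∀ a, ∃ g : ℂ →ₗ[ℚ] ℚ, ∀ v : V, g v = β.repr v a := fun a => by
    obtain ⟨g, hg⟩ := LinearMap.exists_extend (β.coord a)
    exact ⟨g, fun v => by rw [← β.coord_apply, ← hg]; rfl⟩
  choose φ hφ' using hext
  have hli : LinearIndependent ℚ (V.subtype ∘ β) :=
    β.linearIndependent.map' V.subtype V.ker_subtype
  refine ⟨V.subtype ∘ β, φ, hli, ?_, ?_, ?_⟩
  · have := congrArg (Submodule.map V.subtype) β.span_eq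
    rw [Submodule.map_span, Submodule.map_top, Submodule.range_subtype, ← Set.range_comp] at this
    exact this
  · intro v hv
    have h2 := congrArg V.subtype (β.sum_repr ⟨v, hv⟩)
    rw [map_sum] at h2
    refine h2.symm.trans (Finset.sum_congr rfl fun a _ => ?_)
    rw [map_smul, ← hφ', Algebra.smul_def, mul_comm]
    rfl
  · intro a b
    have h3 := hφ' a (β b)
    rw [β.repr_self, Finsupp.single_apply] at h3
    refine h3.trans ?_
    simp only [eq_comm]

/-- Coordinates of the expansions at `1` in a `ℚ`-basis `ξ` of the space of values. -/
theorem ESys.exists_value_coords {N : ℕ} (S : ESys N) (hE : ∀ j, S.y j ∈ eAlg) :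
    ∃ (r : ℕ) (ξ : Fin r → ℂ) (Y : Fin N → Fin r → ℚ⟦X⟧), r ≤ N ∧ LinearIndependent ℚ ξ ∧
      Submodule.span ℚ (Set.range ξ) = S.values ∧
      (∀ j, tau (S.y j) = ∑ a, PowerSeries.C (ξ a) * qc (Y j a)) ∧
      (∀ j a, Ctl fun n => PowerSeries.coeff n (Y j a)) ∧
      ∀ μ : Fin r → ℚ, (∀ j, ∑ a, μ a • Y j a = 0) → μ = 0 := by
  obtain ⟨hfin', hle⟩ := S.finrank_nearConst
  have hfin : FiniteDimensional ℚ S.values := Submodule.finiteDimensional_of_le S.values_le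
  have hrN := (Submodule.finrank_mono S.values_le).trans hle
  obtain ⟨ξ, φ, hξ, hspan, hexp, hdual⟩ := exists_basis_dual S.values
  generalize Module.finrank ℚ S.values = r at *
  refine ⟨r, ξ, fun j a => comp (φ a) (tau (S.y j)), hrN, hξ, hspan, fun j => ?_,
    fun j a => ctl_comp_tau (hE j) _, fun μ hμ => ?_⟩
  · ext l
    rw [map_sum]
    refine (hexp _ (S.coeff_tau_mem_values j l)).trans (Finset.sum_congr rfl fun a _ => ?_)
    rw [PowerSeries.coeff_C_mul, PowerSeries.coeff_map, coeff_comp]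
    rfl
  · have hker : S.values ≤ LinearMap.ker (∑ a, μ a • φ a) := by
      refine Submodule.span_le.mpr ?_
      rintro _ ⟨⟨j, l⟩, rfl⟩
      have := congrArg (PowerSeries.coeff l) (hμ j)
      rw [map_sum, map_zero] at this
      simp only [SetLike.mem_coe, LinearMap.mem_ker, LinearMap.sum_apply, LinearMap.smul_apply]
      rw [← this]
      exact Finset.sum_congr rfl fun a _ => by rw [PowerSeries.coeff_smul, coeff_comp]
    ext a
    have h3 := hker (hspan ▸ Submodule.subset_span ⟨a, rfl⟩ : ξ a ∈ S.values)
    simpa [LinearMap.mem_ker, LinearMap.sum_apply, hdual] using h3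

/-- The coordinates of the expansions at `1` in a `ℚ`-basis `ξ` of the space of values form an
invertible square matrix. -/
theorem ESys.exists_value_basis {N : ℕ} (S : ESys N)
    (h1 : (1 : ℚ⟦X⟧) ∈ Submodule.span ℚ[X] (Set.range S.y)) (hE : ∀ j, S.y j ∈ eAlg) :
    ∃ (ξ : Fin N → ℂ) (Y : Matrix (Fin N) (Fin N) ℚ⟦X⟧), LinearIndependent ℚ ξ ∧
      Submodule.span ℚ (Set.range ξ) = S.values ∧ Y.det ≠ 0 ∧
      ∀ j, tau (S.y j) = ∑ a, PowerSeries.C (ξ a) * qc (Y j a) := by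
  obtain ⟨r, ξ, Y, hrN, hξ, hspan, hτ, hctl, hY⟩ := S.exists_value_coords hE
  have hr0 : 0 < r := by
    by_contra! hr0
    have hτ0 : ∀ j, tau (S.y j) = 0 := by
      intro j
      rw [hτ]
      exact Finset.sum_eq_zero fun a _ => by have := a.2; omega
    obtain ⟨P, hP⟩ := (Submodule.mem_span_range_iff_exists_fun _).mp h1
    have h6 := tau_coe 1
    rw [Polynomial.coe_one, map_one, map_one, ← hP, tau_sum _ _ fun j _ => (S.gr j).smul _,
      Finset.sum_eq_zero] at h6
    · exact zero_ne_one h6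
    · intro j _
      rw [tau_smul _ (S.gr j), hτ0, mul_zero]
  have hNr : N ≤ r := S.rank_le ξ ⟨0, hr0⟩ (hξ.ne_zero _) Y hτ hctl hY
  obtain rfl : r = N := le_antisymm hrN hNr
  refine ⟨ξ, Matrix.of Y, hξ, hspan, fun hdet => ?_, hτ⟩
  have hξmem : ∀ a, ξ a ∈ S.nearConst := fun a =>
    S.values_le (hspan ▸ Submodule.subset_span ⟨a, rfl⟩)
  choose u hu hu0 using hξmem
  obtain ⟨c, e, hc, h⟩ := S.near_common u hu
  obtain ⟨x, hx0, hx⟩ := Matrix.exists_vecMul_eq_zero_iff.mpr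
    (show (Matrix.of e * Matrix.of Y).det = 0 by rw [Matrix.det_mul, hdet, mul_zero])
  refine hx0 (eq_zero_of_sum_qc_mul u (by simp only [hu0]; exact hξ) x ?_)
  refine (mul_eq_zero.mp ?_).resolve_left (qc_ne_zero hc)
  have h7 : ∀ a, ∑ i, ∑ j, x i * (e i j * Y j a) = 0 := by
    intro a
    have := congrFun hx a
    simpa [Matrix.vecMul, dotProduct, Matrix.mul_apply, Finset.mul_sum] using this
  rw [Finset.mul_sum]
  simp only [mul_left_comm (qc c), h, hτ, Finset.mul_sum]
  trans ∑ a, PowerSeries.C (ξ a) * qc (∑ i, ∑ j, x i * (e i j * Y j a))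
  · simp only [map_sum, Finset.mul_sum]
    rw [Finset.sum_comm (s := Finset.univ (α := Fin r)) (t := Finset.univ (α := Fin r))
      (f := fun a i => ∑ j, PowerSeries.C (ξ a) * qc (x i * (e i j * Y j a)))]
    refine Finset.sum_congr rfl fun i _ => ?_
    rw [Finset.sum_comm]
    refine Finset.sum_congr rfl fun a _ => Finset.sum_congr rfl fun j _ => ?_
    rw [map_mul, map_mul]; ring
  · simp [h7]

theorem ESys.tau_indep {N : ℕ} (S : ESys N)
    (h1 : (1 : ℚ⟦X⟧) ∈ Submodule.span ℚ[X] (Set.range S.y)) (hE : ∀ j, S.y j ∈ eAlg)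
    (x : Fin N → ℚ⟦X⟧) (hx : ∑ j, qc (x j) * tau (S.y j) = 0) : x = 0 := by
  obtain ⟨ξ, Y, hξ, -, hY, hτ⟩ := S.exists_value_basis h1 hE
  have h3 := eq_zero_of_sum_qc_mul (fun a => PowerSeries.C (ξ a)) (by simpa using hξ)
    (fun a => ∑ j, x j * Y j a) (by
      rw [← hx]
      simp only [hτ, Finset.mul_sum, map_sum, Finset.sum_mul]
      rw [Finset.sum_comm]
      refine Finset.sum_congr rfl fun a _ => Finset.sum_congr rfl fun j _ => ?_
      rw [map_mul]; ring)
  exact Matrix.eq_zero_of_vecMul_eq_zero hY h3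

theorem ESys.near_const {N : ℕ} (S : ESys N)
    (h1 : (1 : ℚ⟦X⟧) ∈ Submodule.span ℚ[X] (Set.range S.y)) (hE : ∀ j, S.y j ∈ eAlg)
    (v : ℂ) (hv : v ∈ S.values) : S.Near (PowerSeries.C v) := by
  obtain ⟨ξ, Y, hξ, hsp, hY, hτ⟩ := S.exists_value_basis h1 hE
  have h3 : ∀ a, S.Near (PowerSeries.C (ξ a)) := by
    intro a
    refine ⟨Y.det, fun j => Y.adjugate a j, hY, ?_⟩
    have h4 := det_mul_eq_sum_adjugate (Y.map qc) (fun a => PowerSeries.C (ξ a)) a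
    rw [← RingHom.mapMatrix_apply, ← RingHom.map_det] at h4
    rw [h4]
    refine Finset.sum_congr rfl fun j _ => ?_
    rw [← RingHom.map_adjugate, hτ]
    congr 1
    exact Finset.sum_congr rfl fun b _ => mul_comm _ _
  rw [← hsp] at hv
  obtain ⟨c, rfl⟩ := (Submodule.mem_span_range_iff_exists_fun _).mp hv
  rw [map_sum]
  refine S.near_sum _ _ fun a _ => ?_
  have := (h3 a).qc_mul (PowerSeries.C (c a))
  rw [PowerSeries.map_C, ← map_mul] at this
  rwa [Algebra.smul_def]

theorem ESys.evz_mem_values {N : ℕ} (S : ESys N) {g : ℚ⟦X⟧}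
    (hg : g ∈ Submodule.span ℚ[X] (Set.range S.y)) : evz g 1 ∈ S.values := by
  obtain ⟨P, rfl⟩ := (Submodule.mem_span_range_iff_exists_fun _).mp hg
  have h0 : ∀ f, evz f 1 = PowerSeries.coeff 0 (tau f) := fun f => by simp [coeff_tau]
  rw [h0, tau_sum _ _ fun j _ => (S.gr j).smul _, map_sum]
  refine Submodule.sum_mem _ fun j _ => ?_
  rw [tau_smul _ (S.gr j), PowerSeries.coeff_zero_eq_constantCoeff_apply, map_mul,
    ← PowerSeries.coeff_zero_eq_constantCoeff_apply, ← PowerSeries.coeff_zero_eq_constantCoeff_apply,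
    PowerSeries.coeff_map, ← Algebra.smul_def]
  exact Submodule.smul_mem _ _ (S.coeff_tau_mem_values j 0)

open Filter

/-- The quotient of entire functions `F / G` is entire when `F` is dominated by `G`. -/
theorem exists_entire_quotient {F G : ℂ → ℂ} (hF : Differentiable ℂ F) (hG : Differentiable ℂ G)
    (hG0 : ∃ z, G z ≠ 0) {B : ℂ → ℝ} (hB : Continuous B) (h : ∀ z, ‖F z‖ ≤ B z * ‖G z‖) :
    ∃ ψ : ℂ → ℂ, Differentiable ℂ ψ ∧ (∀ z, F z = ψ z * G z) ∧ ∀ z, ‖ψ z‖ ≤ B z := by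
  have hFa : ∀ z, AnalyticAt ℂ F z := fun z => hF.analyticAt z
  have hGa : ∀ z, AnalyticAt ℂ G z := fun z => hG.analyticAt z
  have hne : ∀ z, ∀ᶠ w in 𝓝[≠] z, G w ≠ 0 := by
    intro z
    rcases (hGa z).eventually_eq_zero_or_eventually_ne_zero with h0 | h0
    · exfalso
      obtain ⟨z₁, hz₁⟩ := hG0
      apply hz₁
      have := AnalyticOnNhd.eqOn_zero_of_preconnected_of_eventuallyEq_zero
        (f := G) (U := Set.univ) (fun z _ => hGa z) isPreconnected_univ (Set.mem_univ z) h0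
      exact this (Set.mem_univ z₁)
    · exact h0
  have hmer : MeromorphicOn (F / G) Set.univ := fun z _ =>
    (hFa z).meromorphicAt.div (hGa z).meromorphicAt
  set ψ := toMeromorphicNFOn (F / G) Set.univ with hψ
  have heq : ∀ z, ∀ᶠ w in 𝓝[≠] z, ψ w = F w / G w := fun z =>
    (hmer.toMeromorphicNFOn_eq_self_on_nhdsNE (Set.mem_univ z))
  have hbd : ∀ z, ∀ᶠ w in 𝓝[≠] z, ‖ψ w‖ ≤ B w := by
    intro z
    filter_upwards [heq z, hne z] with w h1 h2
    rw [h1, norm_div, div_le_iff₀ (norm_pos_iff.mpr h2)]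
    exact h w
  have han : ∀ z, AnalyticAt ℂ ψ z := by
    intro z
    have hNF : MeromorphicNFAt ψ z :=
      meromorphicNFOn_toMeromorphicNFOn (F / G) Set.univ (Set.mem_univ z)
    rw [← hNF.meromorphicOrderAt_nonneg_iff_analyticAt]
    by_contra hlt
    have ht := (tendsto_cobounded_iff_meromorphicOrderAt_neg hNF.meromorphicAt).mpr
      (not_le.mp hlt)
    rw [← tendsto_norm_atTop_iff_cobounded] at ht
    have h1 := ht.eventually (eventually_gt_atTop (B z + 1))
    have h2 : ∀ᶠ w in 𝓝[≠] z, B w < B z + 1 :=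
      (hB.continuousAt.eventually (gt_mem_nhds (by linarith))).filter_mono nhdsWithin_le_nhds
    obtain ⟨w, hw⟩ := (h1.and (h2.and (hbd z))).exists
    linarith [hw.1, hw.2.1, hw.2.2]
  refine ⟨ψ, fun z => (han z).differentiableAt, fun z => ?_, fun z => ?_⟩
  · have h1 : Tendsto (fun w => F w - ψ w * G w) (𝓝[≠] z) (𝓝 (F z - ψ z * G z)) :=
      (((hFa z).continuousAt.sub ((han z).continuousAt.mul (hGa z).continuousAt)).tendsto).mono_left
        nhdsWithin_le_nhds
    have h2 : Tendsto (fun w => F w - ψ w * G w) (𝓝[≠] z) (𝓝 0) := by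
      refine tendsto_const_nhds.congr' ?_
      filter_upwards [heq z, hne z] with w h1 h2
      rw [h1, div_mul_cancel₀ _ h2, sub_self]
    exact sub_eq_zero.mp (tendsto_nhds_unique h1 h2)
  · exact le_of_tendsto_of_tendsto
      ((han z).continuousAt.norm.tendsto.mono_left nhdsWithin_le_nhds)
      (hB.continuousAt.tendsto.mono_left nhdsWithin_le_nhds) (hbd z)

/-- An entire function of polynomial growth is a polynomial. -/
theorem exists_polynomial_of_growth {ψ : ℂ → ℂ} (hψ : Differentiable ℂ ψ) (C : ℝ) (N : ℕ)
    (h : ∀ z, ‖ψ z‖ ≤ C * (1 + ‖z‖) ^ N) : ∃ Q : ℂ[X], ∀ z, ψ z = Q.eval z := by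
  have hC : 0 ≤ C := by
    have := (norm_nonneg _).trans (h 0)
    simpa using this
  have hz : ∀ n, N < n → iteratedDeriv n ψ 0 = 0 := by
    intro n hn
    have hb : ∀ R : ℝ, 1 ≤ R → ‖iteratedDeriv n ψ 0‖ ≤ n.factorial * C * 2 ^ N / R := by
      intro R hR
      have h1 := Complex.norm_iteratedDeriv_le_of_forall_mem_sphere_norm_le (c := 0)
        (C := C * (2 * R) ^ N) n (by linarith : 0 < R) hψ.diffContOnCl (fun z hz => by
          refine (h z).trans ?_
          have : ‖z‖ = R := by simpa using hz
          rw [this]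
          gcongr
          linarith)
      refine h1.trans ?_
      have hR0 : 0 < R := by linarith
      rw [div_le_div_iff₀ (by positivity) hR0, mul_pow]
      have h2 : R ^ N * R ≤ R ^ n := by
        rw [← pow_succ]
        exact pow_le_pow_right₀ hR hn
      calc _ = (n.factorial * C * 2 ^ N) * (R ^ N * R) := by ring
        _ ≤ _ := by gcongr
    have ht : Tendsto (fun R : ℝ => n.factorial * C * 2 ^ N / R) atTop (𝓝 0) :=
      tendsto_const_nhds.div_atTop tendsto_id
    have := ge_of_tendsto ht ((eventually_ge_atTop 1).mono hb)
    simpa using this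
  refine ⟨∑ n ∈ Finset.range (N + 1),
    Polynomial.monomial n ((n.factorial : ℂ)⁻¹ * iteratedDeriv n ψ 0), fun z => ?_⟩
  rw [← Complex.taylorSeries_eq_of_entire' 0 z hψ, tsum_eq_sum (s := Finset.range (N + 1)),
    Polynomial.eval_finsetSum]
  · simp
  · intro n hn
    rw [hz n (by simpa using hn)]
    simp

theorem norm_eval_le (P : ℂ[X]) (z : ℂ) :
    ‖P.eval z‖ ≤ (∑ i ∈ Finset.range (P.natDegree + 1), ‖P.coeff i‖) *
      (1 + ‖z‖) ^ P.natDegree := by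
  rw [Polynomial.eval_eq_sum_range, Finset.sum_mul]
  refine (norm_sum_le _ _).trans (Finset.sum_le_sum fun i hi => ?_)
  rw [norm_mul, norm_pow]
  gcongr
  have h1 : ‖z‖ ≤ 1 + ‖z‖ := by linarith
  calc ‖z‖ ^ i ≤ (1 + ‖z‖) ^ i := by gcongr
    _ ≤ _ := pow_le_pow_right₀ (by linarith [norm_nonneg z]) (by simpa [Nat.lt_succ_iff] using hi)

/-- A root of a monic relation `F ^ m + ∑ bᵢ Fⁱ G ^ (m - i) = 0` is dominated by
`1 + ∑ |bᵢ|`. -/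
theorem norm_le_of_monic_relation (m : ℕ) (b : ℕ → ℂ) (x y : ℂ)
    (h : x ^ m + ∑ i ∈ Finset.range m, b i * x ^ i * y ^ (m - i) = 0) :
    ‖x‖ ≤ (1 + ∑ i ∈ Finset.range m, ‖b i‖) * ‖y‖ := by
  set S := ∑ i ∈ Finset.range m, ‖b i‖ with hS
  have hS0 : 0 ≤ S := Finset.sum_nonneg fun i _ => norm_nonneg _
  by_contra hlt
  push Not at hlt
  have hm : m ≠ 0 := by
    rintro rfl
    simp at h
  have hxy : ‖y‖ ≤ ‖x‖ := by nlinarith [norm_nonneg y]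
  have hx : 0 < ‖x‖ := lt_of_le_of_lt (by positivity) hlt
  have h1 : ‖x‖ ^ m ≤ S * (‖x‖ ^ (m - 1) * ‖y‖) := by
    rw [← norm_pow, eq_neg_of_add_eq_zero_left h, norm_neg, hS, Finset.sum_mul]
    refine (norm_sum_le _ _).trans (Finset.sum_le_sum fun i hi => ?_)
    rw [Finset.mem_range] at hi
    rw [norm_mul, norm_mul, norm_pow, norm_pow, mul_assoc]
    refine mul_le_mul_of_nonneg_left ?_ (norm_nonneg _)
    obtain ⟨j, rfl⟩ : ∃ j, m = i + j + 1 := ⟨m - i - 1, by omega⟩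
    rw [show i + j + 1 - i = j + 1 by omega, show i + j + 1 - 1 = i + j by omega, pow_succ,
      pow_add, ← mul_assoc]
    gcongr
  have e : ‖x‖ ^ m = ‖x‖ ^ (m - 1) * ‖x‖ := by rw [← pow_succ]; congr 1; omega
  rw [e] at h1
  have h2 : ‖x‖ ≤ S * ‖y‖ := by
    have hp : 0 < ‖x‖ ^ (m - 1) := by positivity
    by_contra hc
    push Not at hc
    nlinarith
  nlinarith [norm_nonneg y]

/-- Power series over `ℂ` converging on the whole plane. -/
def Ent (h : ℂ⟦X⟧) : Prop := ∀ z : ℂ, Summable fun n => ‖PowerSeries.coeff n h * z ^ n‖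

/-- The value at `z` of a power series over `ℂ`. -/
def evc (h : ℂ⟦X⟧) (z : ℂ) : ℂ := ∑' n, PowerSeries.coeff n h * z ^ n

theorem Ent.sub {f g : ℂ⟦X⟧} (hf : Ent f) (hg : Ent g) : Ent (f - g) := fun z => by
  refine Summable.of_nonneg_of_le (fun _ => norm_nonneg _) (fun n => ?_) ((hf z).add (hg z))
  rw [map_sub, sub_mul]
  exact norm_sub_le _ _

theorem evc_sub {f g : ℂ⟦X⟧} (hf : Ent f) (hg : Ent g) (z : ℂ) :
    evc (f - g) z = evc f z - evc g z := by
  rw [evc, evc, evc, ← (hf z).of_norm.tsum_sub (hg z).of_norm]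
  simp [sub_mul]

theorem coeff_mul_mul_pow (f g : ℂ⟦X⟧) (z : ℂ) (n : ℕ) :
    PowerSeries.coeff n (f * g) * z ^ n = ∑ kl ∈ Finset.HasAntidiagonal.antidiagonal n,
      (PowerSeries.coeff kl.1 f * z ^ kl.1) * (PowerSeries.coeff kl.2 g * z ^ kl.2) := by
  rw [PowerSeries.coeff_mul, Finset.sum_mul]
  refine Finset.sum_congr rfl fun p hp => ?_
  rw [← Finset.HasAntidiagonal.mem_antidiagonal.mp hp, pow_add]
  ring

theorem Ent.mul {f g : ℂ⟦X⟧} (hf : Ent f) (hg : Ent g) : Ent (f * g) := fun z => by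
  refine Summable.congr ?_ fun n => congrArg norm (coeff_mul_mul_pow f g z n).symm
  have := summable_norm_sum_mul_antidiagonal_of_summable_norm
    (f := fun n => PowerSeries.coeff n f * z ^ n) (g := fun n => PowerSeries.coeff n g * z ^ n)
    (hf z) (hg z)
  exact this

theorem evc_mul {f g : ℂ⟦X⟧} (hf : Ent f) (hg : Ent g) (z : ℂ) :
    evc (f * g) z = evc f z * evc g z := by
  rw [evc, evc, evc, tsum_mul_tsum_eq_tsum_sum_antidiagonal_of_summable_norm (hf z) (hg z)]
  exact tsum_congr fun n => coeff_mul_mul_pow f g z n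

theorem ent_coe (P : ℂ[X]) : Ent (P : ℂ⟦X⟧) := fun z => by
  refine summable_of_ne_finset_zero (s := Finset.range (P.natDegree + 1)) fun n hn => ?_
  rw [Polynomial.coeff_coe, Polynomial.coeff_eq_zero_of_natDegree_lt (by simpa using hn)]
  simp

theorem evc_coe (P : ℂ[X]) (z : ℂ) : evc (P : ℂ⟦X⟧) z = P.eval z := by
  rw [evc, Polynomial.eval_eq_sum_range, tsum_eq_sum (s := Finset.range (P.natDegree + 1))]
  · simp
  · intro n hn
    rw [Polynomial.coeff_coe, Polynomial.coeff_eq_zero_of_natDegree_lt (by simpa using hn)]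
    simp

theorem Ent.differentiable {f : ℂ⟦X⟧} (hf : Ent f) : Differentiable ℂ (evc f) := by
  intro z
  have h := Complex.differentiableOn_tsum_of_summable_norm (U := Metric.ball (0 : ℂ) (‖z‖ + 1))
    (F := fun n w => PowerSeries.coeff n f * w ^ n) (hf ((‖z‖ + 1 : ℝ) : ℂ))
    (fun n => by fun_prop) Metric.isOpen_ball (fun n w hw => by
      have : ‖w‖ ≤ ‖z‖ + 1 := by
        have := Metric.mem_ball.mp hw
        rw [dist_zero_right] at this
        exact this.le
      rw [norm_mul, norm_mul, norm_pow, norm_pow, Complex.norm_real,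
        Real.norm_of_nonneg (by positivity)]
      gcongr)
  exact h.differentiableAt (Metric.isOpen_ball.mem_nhds (by simp))

theorem Ent.eq_zero {f : ℂ⟦X⟧} (hf : Ent f) (h : ∀ z, evc f z = 0) : f = 0 := by
  set c : ℕ → ℂ := fun n => PowerSeries.coeff n f
  have hr : (FormalMultilinearSeries.ofScalars ℂ c).radius = ⊤ := by
    refine ENNReal.eq_top_of_forall_nnreal_le fun r => ?_
    refine FormalMultilinearSeries.le_radius_of_summable_norm _ ?_
    refine (hf ((r : ℝ) : ℂ)).congr fun n => ?_
    rw [FormalMultilinearSeries.ofScalars_norm]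
    simp [c]
  have hp := (FormalMultilinearSeries.ofScalars ℂ c).hasFPowerSeriesOnBall (by rw [hr]; simp)
  have hs : (FormalMultilinearSeries.ofScalars ℂ c).sum = 0 := by
    funext z
    have := h z
    rw [evc] at this
    rw [FormalMultilinearSeries.sum]
    simp_rw [FormalMultilinearSeries.ofScalars_apply_eq, smul_eq_mul]
    exact this
  rw [hs] at hp
  have h0 := hp.hasFPowerSeriesAt.eq_zero
  rw [FormalMultilinearSeries.ofScalars_series_eq_zero] at h0
  ext n
  exact congrFun h0 n

theorem Gr.ent {f : ℚ⟦X⟧} (hf : Gr f) : Ent (qc f) := fun z => by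
  simpa [qc] using hf.summable z

theorem evc_qc (f : ℚ⟦X⟧) (z : ℂ) : evc (qc f) z = evz f z := by
  simp [evc, evz, qc]

/-- Evaluation at `z` on the algebra of series of growth type. -/
def evzHom (z : ℂ) : grAlg →+* ℂ where
  toFun f := evz f z
  map_one' := by simpa using evz_coe 1 z
  map_zero' := by simpa using evz_coe 0 z
  map_mul' f g := evz_mul f.2 g.2 z
  map_add' f g := evz_add f.2 g.2 z

theorem evzHom_apply (z : ℂ) (f : grAlg) : evzHom z f = evz f z := rfl

theorem exists_eq_coe_mul_of_monic_relation {f g : ℚ⟦X⟧} (hf : Gr f) (hg : Gr g) (hg0 : g ≠ 0)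
    (m : ℕ) (b : ℕ → ℚ[X])
    (h : f ^ m + ∑ i ∈ Finset.range m, (b i : ℚ⟦X⟧) * f ^ i * g ^ (m - i) = 0) :
    ∃ P : ℚ[X], f = (P : ℚ⟦X⟧) * g := by
  have hrel : ∀ z, evz f z ^ m + ∑ i ∈ Finset.range m,
      (b i).aeval z * evz f z ^ i * evz g z ^ (m - i) = 0 := by
    intro z
    have h1 : (⟨f, hf⟩ : grAlg) ^ m + ∑ i ∈ Finset.range m,
        (⟨(b i : ℚ⟦X⟧), gr_coe (b i)⟩ : grAlg) * ⟨f, hf⟩ ^ i * ⟨g, hg⟩ ^ (m - i) = 0 := by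
      apply Subtype.ext
      rw [AddMemClass.coe_add, AddSubmonoidClass.coe_finsetSum]
      exact h
    have h2 := congrArg (evzHom z) h1
    rw [map_add, map_sum, map_zero, map_pow] at h2
    simp_rw [map_mul, map_pow, evzHom_apply, evz_coe] at h2
    exact h2
  have hG0 : ∃ z, evc (qc g) z ≠ 0 := by
    by_contra hall
    push Not at hall
    exact hg0 (qc_injective (by rw [hg.ent.eq_zero hall, map_zero]))
  set bc : ℕ → ℂ[X] := fun i => (b i).map (algebraMap ℚ ℂ) with hbc
  have hbe : ∀ i z, (b i).aeval z = (bc i).eval z := fun i z => by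
    rw [hbc, Polynomial.eval_map_algebraMap]
  obtain ⟨ψ, hψ, hψ1, hψ2⟩ := exists_entire_quotient hf.ent.differentiable hg.ent.differentiable hG0
    (B := fun z => 1 + ∑ i ∈ Finset.range m, ‖(bc i).eval z‖)
    (by fun_prop) (fun z => by
      rw [evc_qc, evc_qc]
      refine norm_le_of_monic_relation m (fun i => (bc i).eval z) _ _ ?_
      simp_rw [← hbe]
      exact hrel z)
  set N := ∑ i ∈ Finset.range m, (bc i).natDegree with hN
  set C := ∑ i ∈ Finset.range m, ∑ k ∈ Finset.range ((bc i).natDegree + 1), ‖(bc i).coeff k‖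
  obtain ⟨Q, hQ⟩ := exists_polynomial_of_growth hψ (1 + C) N (fun z => by
    refine (hψ2 z).trans ?_
    rw [add_mul, one_mul]
    have h1 : 1 ≤ 1 + ‖z‖ := by linarith [norm_nonneg z]
    refine add_le_add (one_le_pow₀ h1) ?_
    rw [Finset.sum_mul]
    refine Finset.sum_le_sum fun i hi => (norm_eval_le _ _).trans ?_
    refine mul_le_mul_of_nonneg_left (pow_le_pow_right₀ h1 ?_)
      (Finset.sum_nonneg fun _ _ => norm_nonneg _)
    exact Finset.single_le_sum (f := fun i => (bc i).natDegree) (fun _ _ => Nat.zero_le _) hi)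
  have hfg : qc f = (Q : ℂ⟦X⟧) * qc g := by
    rw [← sub_eq_zero]
    refine (hf.ent.sub ((ent_coe Q).mul hg.ent)).eq_zero fun z => ?_
    rw [evc_sub hf.ent ((ent_coe Q).mul hg.ent), evc_mul (ent_coe Q) hg.ent, evc_coe, hψ1, hQ,
      sub_self]
  obtain ⟨φ, hφ⟩ := (Algebra.linearMap ℚ ℂ).exists_leftInverse_of_injective
    (LinearMap.ker_eq_bot.mpr (algebraMap ℚ ℂ).injective)
  have hφ1 : φ 1 = 1 := by
    have := LinearMap.congr_fun hφ 1
    simpa using this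
  have h1 : comp φ (qc f * 1) = comp φ (qc g * (Q : ℂ⟦X⟧)) := by rw [mul_one, hfg, mul_comm]
  have h2 : comp φ 1 = 1 := by
    ext n
    rw [coeff_comp, PowerSeries.coeff_one, PowerSeries.coeff_one]
    split_ifs <;> simp [hφ1]
  rw [comp_qc_mul, comp_qc_mul, h2, mul_one] at h1
  refine ⟨∑ n ∈ Finset.range (Q.natDegree + 1), Polynomial.monomial n (φ (Q.coeff n)), ?_⟩
  rw [h1, mul_comm]
  congr 1
  ext n
  rw [coeff_comp, Polynomial.coeff_coe, Polynomial.coeff_coe, Polynomial.finsetSum_coeff]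
  simp_rw [Polynomial.coeff_monomial]
  rw [Finset.sum_ite_eq']
  split_ifs with hn
  · rfl
  · rw [Polynomial.coeff_eq_zero_of_natDegree_lt (by simpa using hn), map_zero]

theorem exists_dual_family {ι : Type} [Finite ι] [DecidableEq ι] (w : ι → ℂ)
    (hw : LinearIndependent ℚ w) :
    ∃ φ : ι → ℂ →ₗ[ℚ] ℚ, ∀ i j, φ i (w j) = if i = j then 1 else 0 := by
  obtain ⟨g, hg⟩ := (Finsupp.linearCombination ℚ w).exists_leftInverse_of_injective
    (LinearMap.ker_eq_bot.mpr hw)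
  refine ⟨fun i => Finsupp.lapply i ∘ₗ g, fun i j => ?_⟩
  have := LinearMap.congr_fun hg (Finsupp.single j 1)
  simp only [LinearMap.comp_apply, Finsupp.linearCombination_single, one_smul,
    LinearMap.id_apply] at this
  rw [LinearMap.comp_apply, this, Finsupp.lapply_apply, Finsupp.single_apply]
  simp [eq_comm]

theorem mem_range_of_isAlgebraic {k F : Type} [Field k] [Field F] [Algebra ℚ[X] k]
    [IsFractionRing ℚ[X] k] [Algebra eAlg F] [IsFractionRing eAlg F] [Algebra ℚ[X] F] [Algebra k F]
    [IsScalarTower ℚ[X] eAlg F] [IsScalarTower ℚ[X] k F] (x : F) (hx : IsAlgebraic k x) :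
    x ∈ Set.range (algebraMap k F) := by
  rw [← IsFractionRing.isAlgebraic_iff ℚ[X] k F] at hx
  obtain ⟨y, hy, p, hp, hpe⟩ := hx.exists_integral_multiple
  obtain ⟨f, g, hg, hfg⟩ := IsFractionRing.div_surjective (A := eAlg) (y • x)
  have hg0 : g ≠ 0 := nonZeroDivisors.ne_zero hg
  have hgF : algebraMap eAlg F g ≠ 0 := by
    simpa using hg0
  have key : (f : ℚ⟦X⟧) ^ p.natDegree + ∑ i ∈ Finset.range p.natDegree,
      (p.coeff i : ℚ⟦X⟧) * (f : ℚ⟦X⟧) ^ i * (g : ℚ⟦X⟧) ^ (p.natDegree - i) = 0 := by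
    have h1 : f ^ p.natDegree + ∑ i ∈ Finset.range p.natDegree,
        algebraMap ℚ[X] eAlg (p.coeff i) * f ^ i * g ^ (p.natDegree - i) = 0 := by
      apply IsFractionRing.injective eAlg F
      rw [← hfg, Polynomial.eval₂_eq_sum_range, Finset.sum_range_succ, hp.coeff_natDegree,
        map_one, one_mul, add_comm] at hpe
      have h2 := congrArg (· * algebraMap eAlg F g ^ p.natDegree) hpe
      simp only [zero_mul, add_mul, Finset.sum_mul] at h2
      rw [map_zero, ← h2, map_add, map_sum, map_pow, div_pow, div_mul_cancel₀ _ (pow_ne_zero _ hgF)]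
      congr 1
      refine Finset.sum_congr rfl fun i hi => ?_
      rw [map_mul, map_mul, map_pow, map_pow, ← IsScalarTower.algebraMap_apply, div_pow]
      have e : p.natDegree = (p.natDegree - i) + i := by
        have := Finset.mem_range.mp hi
        omega
      conv_rhs => rw [e, pow_add]
      field_simp
    have h3 := congrArg (Subtype.val) h1
    rw [AddMemClass.coe_add, AddSubmonoidClass.coe_finsetSum] at h3
    refine Eq.trans ?_ h3
    refine congrArg₂ _ rfl (Finset.sum_congr rfl fun i _ => ?_)
    have h4 : ((algebraMap ℚ[X] eAlg (p.coeff i) : eAlg) : ℚ⟦X⟧) = (p.coeff i : ℚ⟦X⟧) := by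
      change algebraMap ℚ[X] ℚ⟦X⟧ _ = _
      rw [PowerSeries.algebraMap_apply']
      simp
    rw [← h4]
    rfl
  obtain ⟨P, hP⟩ := exists_eq_coe_mul_of_monic_relation (gr_of_mem_eAlg f.2) (gr_of_mem_eAlg g.2)
    (fun h => hg0 (Subtype.ext h)) _ _ key
  have hfP : f = algebraMap ℚ[X] eAlg P * g := by
    apply Subtype.ext
    rw [hP]
    change _ = algebraMap ℚ[X] ℚ⟦X⟧ P * _
    rw [PowerSeries.algebraMap_apply']
    simp
  have hyF : algebraMap ℚ[X] k y ≠ 0 := by simpa using hy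
  refine ⟨algebraMap ℚ[X] k P / algebraMap ℚ[X] k y, ?_⟩
  have hyF' : algebraMap ℚ[X] F y ≠ 0 := by
    rw [IsScalarTower.algebraMap_apply ℚ[X] k F]
    simpa using hy
  rw [map_div₀, ← IsScalarTower.algebraMap_apply, ← IsScalarTower.algebraMap_apply,
    div_eq_iff hyF', mul_comm, ← Algebra.smul_def, ← hfg, hfP, map_mul, mul_div_cancel_right₀ _ hgF,
    ← IsScalarTower.algebraMap_apply]

/-- A system of `E`-functions spanning a module which contains `1` and a given finite family. -/
theorem exists_eSys_of_mem {ι : Type} [Finite ι] (f : ι → ℚ⟦X⟧) (hf : ∀ i, f i ∈ eAlg) :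
    ∃ (N : ℕ) (S : ESys N), (1 : ℚ⟦X⟧) ∈ Submodule.span ℚ[X] (Set.range S.y) ∧
      (∀ j, S.y j ∈ eAlg) ∧ ∀ i, f i ∈ Submodule.span ℚ[X] (Set.range S.y) := by
  obtain ⟨M, hM, hfM⟩ := exists_common_module (fun o : Option ι => o.elim 1 f) (by
    rintro (_ | i)
    · exact one_mem _
    · exact hf i)
  obtain ⟨N, S, hS⟩ := exists_eSys hM
  refine ⟨N, S, hS ▸ hfM none, fun j => ?_, fun i => hS ▸ hfM (some i)⟩
  exact ⟨M, hM, hS ▸ Submodule.subset_span ⟨j, rfl⟩⟩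

section generic

variable {k F 𝕂 Ω : Type} [Field k] [Field F] [Field 𝕂] [Field Ω]
  [Algebra ℚ[X] k] [IsFractionRing ℚ[X] k] [Algebra eAlg F] [IsFractionRing eAlg F]
  [Algebra ℚ[X] F] [Algebra k F] [IsScalarTower ℚ[X] eAlg F] [IsScalarTower ℚ[X] k F]
  [Algebra ℚ⟦X⟧ 𝕂] [IsFractionRing ℚ⟦X⟧ 𝕂] [Algebra ℂ⟦X⟧ Ω] [IsFractionRing ℂ⟦X⟧ Ω]
  [Algebra k 𝕂] [Algebra 𝕂 Ω] [Algebra k Ω] (τ : F →ₐ[k] Ω)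

theorem algebraMap_smul_eAlg (P : ℚ[X]) (f : eAlg) :
    algebraMap eAlg F (P • f) = algebraMap k F (algebraMap ℚ[X] k P) * algebraMap eAlg F f := by
  rw [Algebra.smul_def, map_mul, ← IsScalarTower.algebraMap_apply,
    IsScalarTower.algebraMap_apply ℚ[X] k F]

theorem tau_preserves_linearIndependent
    (hτ : ∀ f : eAlg, τ (algebraMap eAlg F f) = algebraMap ℂ⟦X⟧ Ω (tau f))
    (hΩ : ∀ x, algebraMap 𝕂 Ω (algebraMap ℚ⟦X⟧ 𝕂 x) = algebraMap ℂ⟦X⟧ Ω (qc x))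
    (hk : ∀ P, algebraMap k 𝕂 (algebraMap ℚ[X] k P) = algebraMap ℚ⟦X⟧ 𝕂 (rtau P))
    (ι : Type) [Fintype ι] (y : ι → F) (hy : LinearIndependent k y) (c : ι → 𝕂)
    (hc : ∑ i, algebraMap 𝕂 Ω (c i) * τ (y i) = 0) (i : ι) : c i = 0 := by
  classical
  obtain ⟨⟨e, he⟩, hey⟩ := IsLocalization.exist_integer_multiples_of_finite (nonZeroDivisors eAlg) y
  obtain ⟨⟨b, hb⟩, hbc⟩ :=
    IsLocalization.exist_integer_multiples_of_finite (nonZeroDivisors ℚ⟦X⟧) c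
  choose f hf using hey
  choose x hx using hbc
  have he0 : algebraMap eAlg F e ≠ 0 := by
    simpa using nonZeroDivisors.ne_zero he
  have hb0 : algebraMap ℚ⟦X⟧ 𝕂 b ≠ 0 := by
    simpa using nonZeroDivisors.ne_zero hb
  replace hf : ∀ i, algebraMap eAlg F (f i) = algebraMap eAlg F e * y i := fun i => by
    rw [hf i, Algebra.smul_def]
  replace hx : ∀ i, algebraMap ℚ⟦X⟧ 𝕂 (x i) = algebraMap ℚ⟦X⟧ 𝕂 b * c i := fun i => by
    rw [hx i, Algebra.smul_def]
  have hsum : ∑ i, qc (x i) * tau (f i) = 0 := by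
    apply IsFractionRing.injective ℂ⟦X⟧ Ω
    rw [map_sum, map_zero]
    simp_rw [map_mul, ← hτ, ← hΩ, hf, hx, map_mul]
    rw [← mul_zero (algebraMap 𝕂 Ω (algebraMap ℚ⟦X⟧ 𝕂 b) * τ (algebraMap eAlg F e)), ← hc,
      Finset.mul_sum]
    exact Finset.sum_congr rfl fun i _ => by ring
  obtain ⟨N, S, h1, hE, hfS⟩ := exists_eSys_of_mem (fun i => (f i : ℚ⟦X⟧)) (fun i => (f i).2)
  choose P hP using fun i => (Submodule.mem_span_range_iff_exists_fun _).mp (hfS i)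
  have hz : (fun l => ∑ i, x i * rtau (P i l)) = 0 := by
    refine S.tau_indep h1 hE _ ?_
    rw [← hsum]
    simp_rw [map_sum, map_mul, Finset.sum_mul]
    rw [Finset.sum_comm]
    refine Finset.sum_congr rfl fun i _ => ?_
    rw [← hP i, tau_sum _ _ fun l _ => (S.gr l).smul _, Finset.mul_sum]
    refine Finset.sum_congr rfl fun l _ => ?_
    rw [tau_smul _ (S.gr l), mul_assoc]
  obtain ⟨g, hg⟩ := (Finsupp.linearCombination k y).exists_leftInverse_of_injective
    (LinearMap.ker_eq_bot.mpr hy)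
  have hgy : ∀ j, g (y j) = Finsupp.single j 1 := fun j => by
    have := LinearMap.congr_fun hg (Finsupp.single j 1)
    simpa only [LinearMap.comp_apply, Finsupp.linearCombination_single, one_smul,
      LinearMap.id_apply] using this
  let s : Fin N → F := fun l => (algebraMap eAlg F e)⁻¹ * algebraMap eAlg F ⟨S.y l, hE l⟩
  have hyP : ∀ j, y j = ∑ l, algebraMap ℚ[X] k (P j l) • s l := fun j => by
    have h3 : f j = ∑ l, P j l • (⟨S.y l, hE l⟩ : eAlg) := by
      apply Subtype.ext
      rw [AddSubmonoidClass.coe_finsetSum]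
      exact (hP j).symm
    have h4 := congrArg (algebraMap eAlg F) h3
    rw [hf, map_sum] at h4
    simp_rw [algebraMap_smul_eAlg (k := k)] at h4
    rw [← mul_right_inj' he0, h4, Finset.mul_sum]
    refine Finset.sum_congr rfl fun l _ => ?_
    simp only [s, Algebra.smul_def]
    field_simp
  have hdelta : ∀ j, ∑ l, algebraMap ℚ[X] k (P j l) * (g (s l)) i = if j = i then 1 else 0 := by
    intro j
    have h5 := congrArg (fun v => g v i) (hyP j)
    simp only [hgy, map_sum, map_smul, Finsupp.finsetSum_apply, Finsupp.smul_apply,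
      smul_eq_mul] at h5
    rw [← h5, Finsupp.single_apply]
  have hxi : algebraMap ℚ⟦X⟧ 𝕂 (x i) = 0 := by
    have h6 : ∑ j, algebraMap ℚ⟦X⟧ 𝕂 (x j) * algebraMap k 𝕂 (if j = i then 1 else 0) =
        ∑ l, algebraMap ℚ⟦X⟧ 𝕂 (∑ j, x j * rtau (P j l)) * algebraMap k 𝕂 (g (s l) i) := by
      simp_rw [← hdelta, map_sum, map_mul, Finset.mul_sum, Finset.sum_mul]
      rw [Finset.sum_comm]
      refine Finset.sum_congr rfl fun l _ => Finset.sum_congr rfl fun j _ => ?_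
      rw [hk, mul_assoc]
    have h7 : ∀ l, ∑ j, x j * rtau (P j l) = 0 := fun l => congrFun hz l
    simp_rw [h7, map_zero, zero_mul, Finset.sum_const_zero] at h6
    rw [← h6, Finset.sum_eq_single i]
    · simp
    · intro j _ hj
      simp [hj]
    · simp
  rw [hx] at hxi
  exact (mul_eq_zero.mp hxi).resolve_left hb0

theorem tau_indep_algebraic_generic [CharZero k] [IsScalarTower k 𝕂 Ω]
    (hτ : ∀ f : eAlg, τ (algebraMap eAlg F f) = algebraMap ℂ⟦X⟧ Ω (tau f))
    (hΩ : ∀ x, algebraMap 𝕂 Ω (algebraMap ℚ⟦X⟧ 𝕂 x) = algebraMap ℂ⟦X⟧ Ω (qc x))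
    (hk : ∀ P, algebraMap k 𝕂 (algebraMap ℚ[X] k P) = algebraMap ℚ⟦X⟧ 𝕂 (rtau P))
    {N : ℕ} (S : ESys N) (hE : ∀ j, S.y j ∈ eAlg) {ι : Type} [Fintype ι] (w : ι → ℂ)
    (hw : ∀ i, IsAlgebraic ℚ (w i)) (x : ι → Fin N → ℚ⟦X⟧)
    (h : ∑ j, (∑ i, qc (x i j) * PowerSeries.C (w i)) * tau (S.y j) = 0) (j : Fin N) :
    ∑ i, qc (x i j) * PowerSeries.C (w i) = 0 := by
  let ω : ι → Ω := fun i => algebraMap ℂ⟦X⟧ Ω (PowerSeries.C (w i))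
  have hω : ∀ i, IsIntegral 𝕂 (ω i) := fun i => by
    have h1 : IsIntegral ℚ (w i) := (hw i).isIntegral
    have h2 := h1.map_of_comp_eq ((algebraMap ℚ⟦X⟧ 𝕂).comp PowerSeries.C)
      ((algebraMap ℂ⟦X⟧ Ω).comp PowerSeries.C) (RingHom.ext_rat _ _)
    exact h2
  let L : IntermediateField 𝕂 Ω := IntermediateField.adjoin 𝕂 (Set.range ω)
  have hL : Algebra.IsAlgebraic 𝕂 L := by
    apply IntermediateField.isAlgebraic_adjoin
    rintro _ ⟨i, rfl⟩
    exact hω i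
  have hmem : ∀ j, algebraMap ℂ⟦X⟧ Ω (∑ i, qc (x i j) * PowerSeries.C (w i)) ∈ L := fun j => by
    rw [map_sum]
    refine sum_mem fun i _ => ?_
    rw [map_mul, ← hΩ]
    exact mul_mem (L.algebraMap_mem _) (IntermediateField.subset_adjoin _ _ ⟨i, rfl⟩)
  have hind : LinearIndependent k fun j => algebraMap eAlg F ⟨S.y j, hE j⟩ := by
    rw [← LinearIndependent.iff_fractionRing ℚ[X] k]
    have h1 : LinearIndependent ℚ[X] fun j => (⟨S.y j, hE j⟩ : eAlg) :=
      LinearIndependent.of_comp eAlg.val.toLinearMap S.indep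
    have h2 := h1.map' (IsScalarTower.toAlgHom ℚ[X] eAlg F).toLinearMap
      (LinearMap.ker_eq_bot.mpr (IsFractionRing.injective eAlg F))
    exact h2
  have h3 := linearIndependent_of_algebraic_extension (𝕂 := 𝕂) τ
    (fun x hx => mem_range_of_isAlgebraic x hx)
    (tau_preserves_linearIndependent τ hτ hΩ hk) L _ hind (fun j => ⟨_, hmem j⟩) (by
      rw [← map_zero (algebraMap ℂ⟦X⟧ Ω), ← h, map_sum]
      refine Finset.sum_congr rfl fun j _ => ?_
      rw [hτ, map_mul]) j
  apply IsFractionRing.injective ℂ⟦X⟧ Ω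
  rw [map_zero]
  exact congrArg Subtype.val h3

end generic

/-- The Taylor expansion at `1` as a ring homomorphism. -/
def tauHom : eAlg →+* ℂ⟦X⟧ where
  toFun f := tau f
  map_one' := by
    have := tau_coe 1
    simpa using this
  map_zero' := tau_zero
  map_mul' f g := tau_mul (gr_of_mem_eAlg f.2) (gr_of_mem_eAlg g.2)
  map_add' f g := tau_add (gr_of_mem_eAlg f.2) (gr_of_mem_eAlg g.2)

theorem tauHom_injective : Function.Injective tauHom := by
  rw [injective_iff_map_eq_zero]
  intro f hf
  obtain ⟨N, S, h1, hE, hfS⟩ := exists_eSys_of_mem (fun _ : Unit => (f : ℚ⟦X⟧)) (fun _ => f.2)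
  obtain ⟨P, hP⟩ := (Submodule.mem_span_range_iff_exists_fun _).mp (hfS ())
  have h0 : (fun l => rtau (P l)) = 0 := by
    refine S.tau_indep h1 hE _ ?_
    have h2 : tau f = 0 := hf
    rw [← hP, tau_sum _ _ fun l _ => (S.gr l).smul _] at h2
    rw [← h2]
    exact Finset.sum_congr rfl fun l _ => (tau_smul _ (S.gr l)).symm
  have hP0 : ∀ l, P l = 0 := fun l =>
    rtau_injective (by rw [map_zero]; exact congrFun h0 l)
  apply Subtype.ext
  rw [← hP]
  simp [hP0]

/-- The expansions at `1` of a system of `E`-functions over `ℚ` are linearly independent over the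
field generated by `ℚ⟦X⟧` and finitely many algebraic numbers. -/
theorem ESys.tau_indep_algebraic {N : ℕ} (S : ESys N) (hE : ∀ j, S.y j ∈ eAlg) {ι : Type}
    [Fintype ι] (w : ι → ℂ) (hw : ∀ i, IsAlgebraic ℚ (w i)) (x : ι → Fin N → ℚ⟦X⟧)
    (h : ∑ j, (∑ i, qc (x i j) * PowerSeries.C (w i)) * tau (S.y j) = 0) (j : Fin N) :
    ∑ i, qc (x i j) * PowerSeries.C (w i) = 0 := by
  let fF : FractionRing ℚ[X] →+* FractionRing eAlg :=
    IsFractionRing.lift (g := algebraMap ℚ[X] (FractionRing eAlg)) (by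
      rw [IsScalarTower.algebraMap_eq ℚ[X] eAlg]
      refine (IsFractionRing.injective eAlg _).comp ?_
      intro P Q hPQ
      have h1 : algebraMap ℚ[X] ℚ⟦X⟧ P = algebraMap ℚ[X] ℚ⟦X⟧ Q := congrArg Subtype.val hPQ
      rw [PowerSeries.algebraMap_apply', PowerSeries.algebraMap_apply'] at h1
      simpa using h1)
  let fK : FractionRing ℚ[X] →+* FractionRing ℚ⟦X⟧ :=
    IsFractionRing.lift (g := (algebraMap ℚ⟦X⟧ (FractionRing ℚ⟦X⟧)).comp rtau)
      ((IsFractionRing.injective ℚ⟦X⟧ (FractionRing ℚ⟦X⟧)).comp rtau_injective)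
  let fΩ : FractionRing ℚ⟦X⟧ →+* FractionRing ℂ⟦X⟧ :=
    IsFractionRing.lift (g := (algebraMap ℂ⟦X⟧ (FractionRing ℂ⟦X⟧)).comp qc)
      ((IsFractionRing.injective ℂ⟦X⟧ (FractionRing ℂ⟦X⟧)).comp qc_injective)
  let fτ : FractionRing eAlg →+* FractionRing ℂ⟦X⟧ :=
    IsFractionRing.lift (g := (algebraMap ℂ⟦X⟧ (FractionRing ℂ⟦X⟧)).comp tauHom)
      ((IsFractionRing.injective ℂ⟦X⟧ (FractionRing ℂ⟦X⟧)).comp tauHom_injective)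
  let : Algebra (FractionRing ℚ[X]) (FractionRing eAlg) := fF.toAlgebra
  let : Algebra (FractionRing ℚ[X]) (FractionRing ℚ⟦X⟧) := fK.toAlgebra
  let : Algebra (FractionRing ℚ⟦X⟧) (FractionRing ℂ⟦X⟧) := fΩ.toAlgebra
  let : Algebra (FractionRing ℚ[X]) (FractionRing ℂ⟦X⟧) := (fΩ.comp fK).toAlgebra
  have hF : ∀ P, fF (algebraMap ℚ[X] _ P) = algebraMap ℚ[X] (FractionRing eAlg) P := fun P =>
    IsFractionRing.lift_algebraMap _ P
  have hK : ∀ P, fK (algebraMap ℚ[X] _ P) = algebraMap ℚ⟦X⟧ (FractionRing ℚ⟦X⟧) (rtau P) :=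
    fun P => IsFractionRing.lift_algebraMap _ P
  have hΩ : ∀ P, fΩ (algebraMap ℚ⟦X⟧ _ P) = algebraMap ℂ⟦X⟧ (FractionRing ℂ⟦X⟧) (qc P) :=
    fun P => IsFractionRing.lift_algebraMap _ P
  have hτ : ∀ f, fτ (algebraMap eAlg _ f) = algebraMap ℂ⟦X⟧ (FractionRing ℂ⟦X⟧) (tau f) :=
    fun P => IsFractionRing.lift_algebraMap _ P
  have : IsScalarTower ℚ[X] (FractionRing ℚ[X]) (FractionRing eAlg) :=
    IsScalarTower.of_algebraMap_eq fun P => (hF P).symm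
  have : IsScalarTower (FractionRing ℚ[X]) (FractionRing ℚ⟦X⟧) (FractionRing ℂ⟦X⟧) :=
    IsScalarTower.of_algebraMap_eq fun P => rfl
  have : CharZero (FractionRing ℚ[X]) :=
    charZero_of_injective_algebraMap (IsFractionRing.injective ℚ[X] _)
  have hcomm : fτ.comp fF = fΩ.comp fK := by
    refine IsLocalization.ringHom_ext (nonZeroDivisors ℚ[X]) (RingHom.ext fun P => ?_)
    simp only [RingHom.comp_apply]
    rw [hF, hK, hΩ, IsScalarTower.algebraMap_apply ℚ[X] eAlg, hτ, ← tau_coe]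
    congr 2
  let τ : FractionRing eAlg →ₐ[FractionRing ℚ[X]] FractionRing ℂ⟦X⟧ :=
    { fτ with commutes' := fun r => RingHom.congr_fun hcomm r }
  exact tau_indep_algebraic_generic (𝕂 := FractionRing ℚ⟦X⟧) τ hτ hΩ hK S hE w hw x h j

/-- Values at `1` of `E`-functions over `ℚ` satisfy no nontrivial linear relation with algebraic
coefficients that are linearly independent over `ℚ`. -/
theorem evz_eq_zero_of_sum_mul_eq_zero {ι : Type} [Fintype ι] (w : ι → ℂ)
    (hw : ∀ i, IsAlgebraic ℚ (w i)) (hli : LinearIndependent ℚ w) (g : ι → ℚ⟦X⟧)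
    (hg : ∀ i, g i ∈ eAlg) (h : ∑ i, w i * evz (g i) 1 = 0) (i : ι) : evz (g i) 1 = 0 := by
  obtain ⟨N, S, h1, hE, hgS⟩ := exists_eSys_of_mem g hg
  obtain ⟨c, e, hc, hce⟩ := S.near_common (fun i => PowerSeries.C (evz (g i) 1))
    (fun i => S.near_const h1 hE _ (S.evz_mem_values (hgS i)))
  have h2 := S.tau_indep_algebraic hE w hw e (by
    simp_rw [Finset.sum_mul]
    rw [Finset.sum_comm]
    have h3 : qc c * PowerSeries.C (∑ i, w i * evz (g i) 1) = 0 := by rw [h, map_zero, mul_zero]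
    rw [map_sum, Finset.mul_sum] at h3
    rw [← h3]
    refine Finset.sum_congr rfl fun i _ => ?_
    rw [map_mul, mul_left_comm, hce, Finset.mul_sum]
    exact Finset.sum_congr rfl fun j _ => by ring)
  have h4 : ∀ j, (fun i => e i j) = 0 := fun j =>
    eq_zero_of_sum_qc_mul (fun i => PowerSeries.C (w i)) (by simpa using hli) _ (h2 j)
  have h5 : qc c * PowerSeries.C (evz (g i) 1) = 0 := by
    rw [hce]
    refine Finset.sum_eq_zero fun j _ => ?_
    rw [show e i j = 0 from congrFun (h4 j) i, map_zero, zero_mul]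
  have h6 := (mul_eq_zero.mp h5).resolve_left (qc_ne_zero hc)
  exact PowerSeries.C_injective (by rw [h6, map_zero])

/-- Embeddings of a subfield of `ℂ` algebraic over `ℚ` extend to all algebraic numbers. -/
theorem exists_extension_embedding (K : Subfield ℂ) (hK : ∀ x ∈ K, IsAlgebraic ℚ x)
    (σ : K →ₐ[ℚ] ℂ) : ∃ σ' : integralClosure ℚ ℂ →+* ℂ,
      ∀ x : K, ∀ h : (x : ℂ) ∈ integralClosure ℚ ℂ, σ' ⟨x, h⟩ = σ x := by
  let ι : K →+* algebraicClosure ℚ ℂ :=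
    { toFun := fun x => ⟨x, mem_algebraicClosure_iff.mpr (hK x x.2)⟩
      map_one' := rfl
      map_zero' := rfl
      map_mul' := fun _ _ => rfl
      map_add' := fun _ _ => rfl }
  let : Algebra K (algebraicClosure ℚ ℂ) := ι.toAlgebra
  have : IsScalarTower ℚ K (algebraicClosure ℚ ℂ) :=
    IsScalarTower.of_algebraMap_eq' (RingHom.ext_rat _ _)
  have : Algebra.IsAlgebraic ℚ (algebraicClosure ℚ ℂ) :=
    ⟨fun x => (isAlgebraic_algHom_iff (algebraMap (algebraicClosure ℚ ℂ) ℂ).toRatAlgHom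
      (algebraMap (algebraicClosure ℚ ℂ) ℂ).injective).mp (mem_algebraicClosure_iff.mp x.2)⟩
  have : Algebra.IsAlgebraic K (algebraicClosure ℚ ℂ) :=
    Algebra.IsAlgebraic.tower_top (K := ℚ) K
  obtain ⟨σ', hσ'⟩ := IsAlgClosed.surjective_domRestrict_of_isAlgebraic
    (E := algebraicClosure ℚ ℂ) σ
  let j : integralClosure ℚ ℂ →+* algebraicClosure ℚ ℂ :=
    { toFun := fun x => ⟨x, mem_algebraicClosure_iff.mpr (IsIntegral.isAlgebraic x.2)⟩
      map_one' := rfl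
      map_zero' := rfl
      map_mul' := fun _ _ => rfl
      map_add' := fun _ _ => rfl }
  refine ⟨σ'.toRingHom.comp j, fun x h => ?_⟩
  rw [← hσ']
  rfl

/-- Linear forms on a number field control sizes and denominators. -/
theorem exists_linearForm_bound (K : Subfield ℂ) [FiniteDimensional ℚ K]
    (hK : ∀ x ∈ K, IsAlgebraic ℚ x) (φ : ℂ →ₗ[ℚ] ℚ) :
    ∃ A D₀ : ℕ, 0 < D₀ ∧ ∀ x ∈ K,
      (∀ B : ℝ, (∀ σ : integralClosure ℚ ℂ →+* ℂ, ∀ h : x ∈ integralClosure ℚ ℂ,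
        ‖σ ⟨x, h⟩‖ ≤ B) → |((φ x : ℚ) : ℝ)| ≤ A * B) ∧
      ∀ e : ℕ, IsIntegral ℤ ((e : ℂ) * x) → ∃ z : ℤ, ((D₀ * e : ℕ) : ℚ) * φ x = z := by
  classical
  let ψ : K →ₗ[ℚ] ℚ := φ ∘ₗ K.subtype.toRatAlgHom.toLinearMap
  let v : K := ((Algebra.traceForm ℚ K).toDual (traceForm_nondegenerate ℚ K)).symm ψ
  have hv : ∀ x : K, φ x = Algebra.trace ℚ K (v * x) := fun x => by
    rw [← Algebra.traceForm_apply, ← LinearMap.BilinForm.toDual_def (traceForm_nondegenerate ℚ K),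
      LinearEquiv.apply_symm_apply]
    rfl
  obtain ⟨y, hy, hyv⟩ : ∃ y : ℤ, y ≠ 0 ∧ IsIntegral ℤ (y • v) := by
    have h1 : IsAlgebraic ℚ v := Algebra.IsAlgebraic.isAlgebraic v
    rw [← IsFractionRing.isAlgebraic_iff ℤ ℚ K] at h1
    exact h1.exists_integral_multiple
  obtain ⟨A, hA⟩ := exists_nat_ge (∑ σ : K →ₐ[ℚ] ℂ, ‖σ v‖)
  refine ⟨A, y.natAbs, Int.natAbs_pos.mpr hy, fun x hx => ⟨fun B hB => ?_, fun e he => ?_⟩⟩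
  · have hB' : ∀ σ : K →ₐ[ℚ] ℂ, ‖σ ⟨x, hx⟩‖ ≤ B := fun σ => by
      obtain ⟨σ', hσ'⟩ := exists_extension_embedding K hK σ
      rw [← hσ' ⟨x, hx⟩ (hK x hx).isIntegral]
      exact hB σ' _
    have hB0 : 0 ≤ B := (norm_nonneg _).trans (hB' (K.subtype.toRatAlgHom))
    have h2 : ((φ x : ℚ) : ℂ) = ∑ σ : K →ₐ[ℚ] ℂ, σ (v * ⟨x, hx⟩) := by
      rw [hv ⟨x, hx⟩, ← trace_eq_sum_embeddings ℂ]
      rfl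
    have h3 : |((φ x : ℚ) : ℝ)| = ‖((φ x : ℚ) : ℂ)‖ := by
      rw [← Complex.ofReal_ratCast, Complex.norm_real, Real.norm_eq_abs]
    rw [h3, h2]
    calc _ ≤ ∑ σ : K →ₐ[ℚ] ℂ, ‖σ (v * ⟨x, hx⟩)‖ := norm_sum_le _ _
      _ ≤ ∑ σ : K →ₐ[ℚ] ℂ, ‖σ v‖ * B := Finset.sum_le_sum fun σ _ => by
          rw [map_mul, norm_mul]
          exact mul_le_mul_of_nonneg_left (hB' σ) (norm_nonneg _)
      _ ≤ A * B := by
          rw [← Finset.sum_mul]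
          exact mul_le_mul_of_nonneg_right hA hB0
  · have h1 : IsIntegral ℤ ((e : K) * ⟨x, hx⟩) := by
      have h2 : IsIntegral ℤ (K.subtype.toIntAlgHom ((e : K) * ⟨x, hx⟩)) := by
        simpa using he
      rwa [isIntegral_algHom_iff _ K.subtype.injective] at h2
    have h2 : IsIntegral ℤ (((y * e : ℤ) : ℚ) * φ x) := by
      have h3 : ((y * e : ℤ) : ℚ) * φ x =
          Algebra.trace ℚ K ((y • v) * ((e : K) * ⟨x, hx⟩)) := by
        rw [hv ⟨x, hx⟩, ← smul_eq_mul, ← map_smul]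
        congr 1
        rw [Algebra.smul_def, zsmul_eq_mul]
        push_cast
        simp
        ring
      rw [h3]
      exact Algebra.isIntegral_trace (hyv.mul h1)
    obtain ⟨z, hz⟩ := IsIntegrallyClosed.isIntegral_iff.mp h2
    rw [eq_intCast] at hz
    rcases Int.natAbs_eq y with h4 | h4
    · refine ⟨z, ?_⟩
      rw [hz]
      have h5 : ((y.natAbs : ℕ) : ℚ) = (y : ℚ) := by rw [← Int.cast_natCast, ← h4]
      rw [Nat.cast_mul, h5]
      push_cast
      ring
    · refine ⟨-z, ?_⟩
      rw [Int.cast_neg, hz]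
      have h5 : ((y.natAbs : ℕ) : ℚ) = -(y : ℚ) := by
        rw [← Int.cast_natCast, ← Int.cast_neg]
        congr 1
        omega
      rw [Nat.cast_mul, h5]
      push_cast
      ring

theorem psD_eq_derivative (f : ℂ⟦X⟧) : psD f = PowerSeries.derivative ℂ f := by
  ext n
  rw [psD, PowerSeries.coeff_mk, PowerSeries.coeff_derivative, mul_comm]

/-- Components of the coefficients of an `E`-function have geometric growth. -/
theorem gr_comp_ePS (K : Subfield ℂ) [FiniteDimensional ℚ K] (hK : ∀ x ∈ K, IsAlgebraic ℚ x)
    (φ : ℂ →ₗ[ℚ] ℚ) {a : ℕ → ℂ} (ha : IsE a) (haK : ∀ n, a n ∈ K) : Gr (comp φ (ePS a)) := by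
  obtain ⟨A, D₀, hD₀, hφ⟩ := exists_linearForm_bound K hK φ
  obtain ⟨-, -, C, hC, d, hd⟩ := ha
  obtain ⟨C₁, hC₁⟩ := exists_nat_ge C
  obtain ⟨R, hR⟩ := exists_nat_ge |φ (a 0)|
  have hcoeff : ∀ n, (n.factorial : ℚ) * PowerSeries.coeff n (comp φ (ePS a)) = φ (a n) := by
    intro n
    have h1 : a n = ((n.factorial : ℚ)) • (a n / (n.factorial : ℂ)) := by
      rw [Algebra.smul_def, map_natCast,
        mul_div_cancel₀ _ (Nat.cast_ne_zero.mpr n.factorial_ne_zero)]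
    rw [coeff_comp, ePS, PowerSeries.coeff_mk, ← smul_eq_mul, ← map_smul, ← h1]
  set q := (φ (a 0)).den with hq
  have hq0 : 0 < q := (φ (a 0)).den_pos
  set E := (A + 1) * D₀ * q * (C₁ + 1) * (R + 1) with hE
  have hE1 : ∀ n, 1 ≤ n → D₀ * q * C₁ ^ n ≤ E ^ (n + 1) := by
    intro n _
    have h1 : D₀ * q ≤ E := by
      calc D₀ * q = 1 * D₀ * q * 1 * 1 := by ring
        _ ≤ E := by rw [hE]; gcongr <;> omega
    have h2 : C₁ ≤ E := by
      calc C₁ ≤ 1 * 1 * 1 * (C₁ + 1) * 1 := by omega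
        _ ≤ E := by rw [hE]; gcongr <;> omega
    rw [pow_succ']
    gcongr
  have hE2 : ∀ n, 1 ≤ n → A * C₁ ^ n ≤ E ^ (n + 1) := by
    intro n _
    have h1 : A ≤ E := by
      calc A ≤ (A + 1) * 1 * 1 * 1 * 1 := by omega
        _ ≤ E := by rw [hE]; gcongr <;> omega
    have h2 : C₁ ≤ E := by
      calc C₁ ≤ 1 * 1 * 1 * (C₁ + 1) * 1 := by omega
        _ ≤ E := by rw [hE]; gcongr <;> omega
    rw [pow_succ']
    gcongr
  have hRE : R ≤ E := by
    calc R ≤ 1 * 1 * 1 * 1 * (R + 1) := by omega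
      _ ≤ E := by rw [hE]; gcongr <;> omega
  have hqE : q ≤ E := by
    calc q = 1 * 1 * q * 1 * 1 := by ring
      _ ≤ E := by rw [hE]; gcongr <;> omega
  refine ⟨E, fun n => if n = 0 then q else D₀ * q * d n, fun n => ?_⟩
  have hisInt0 : ∃ z : ℤ, (q : ℚ) * φ (a 0) = z := ⟨(φ (a 0)).num, by
    rw [hq, mul_comm, Rat.mul_den_eq_num]⟩
  rcases Nat.eq_zero_or_pos n with rfl | hn
  · simp only [if_true]
    refine ⟨hq0, by simpa using hqE, ?_, fun i hi => ?_⟩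
    · rw [hcoeff]
      refine hR.trans ?_
      simpa using (Nat.cast_le (α := ℚ)).mpr hRE
    · obtain rfl : i = 0 := by omega
      rw [hcoeff]
      exact hisInt0
  · have hn0 : n ≠ 0 := by omega
    simp only [if_neg hn0]
    obtain ⟨h1, h2, h3, h4⟩ := hd n hn
    have h5 : d n ≤ C₁ ^ n := by
      have : (d n : ℝ) ≤ (C₁ : ℝ) ^ n := h2.trans (by gcongr)
      exact_mod_cast this
    refine ⟨by positivity, ?_, ?_, fun i hi => ?_⟩
    · exact (Nat.mul_le_mul_left _ h5).trans (hE1 n hn)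
    · rw [hcoeff]
      have h6 := (hφ (a n) (haK n)).1 (C ^ n) h3
      have h7 : |((φ (a n) : ℚ) : ℝ)| ≤ ((E ^ (n + 1) : ℕ) : ℝ) := by
        calc _ ≤ (A : ℝ) * C ^ n := h6
          _ ≤ (A : ℝ) * C₁ ^ n := by gcongr
          _ = ((A * C₁ ^ n : ℕ) : ℝ) := by push_cast; ring
          _ ≤ _ := by exact_mod_cast hE2 n hn
      have h8 : ((|φ (a n)| : ℚ) : ℝ) ≤ (((E : ℚ) ^ (n + 1) : ℚ) : ℝ) := by
        push_cast
        push_cast at h7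
        exact h7
      exact_mod_cast h8
    · rw [hcoeff]
      rcases Nat.eq_zero_or_pos i with rfl | hi0
      · obtain ⟨z, hz⟩ := hisInt0
        refine ⟨D₀ * d n * z, ?_⟩
        push_cast
        rw [← hz]
        ring
      · obtain ⟨z, hz⟩ := (hφ (a i) (haK i)).2 (d n) (h4 i hi0 hi)
        refine ⟨q * z, ?_⟩
        push_cast at hz ⊢
        rw [← hz]
        ring

/-- A polynomial with algebraic coefficients divides a nonzero rational polynomial. -/
theorem exists_dvd_map_of_isAlgebraic {p : ℂ[X]} (hp : ∀ k, IsAlgebraic ℚ (p.coeff k))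
    (hp0 : p ≠ 0) : ∃ T : ℚ[X], T ≠ 0 ∧ p ∣ T.map (algebraMap ℚ ℂ) := by
  let : Algebra ℚ[X] ℂ[X] := (Polynomial.mapRingHom (algebraMap ℚ ℂ)).toAlgebra
  have hisInt : IsIntegral ℚ[X] p := by
    rw [p.as_sum_range_C_mul_X_pow]
    refine IsIntegral.sum _ fun k _ => IsIntegral.mul ?_ (IsIntegral.pow ?_ _)
    · exact (hp k).isIntegral.map_of_comp_eq (Polynomial.C : ℚ →+* ℚ[X])
        (Polynomial.C : ℂ →+* ℂ[X]) (RingHom.ext_rat _ _)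
    · have : (Polynomial.X : ℂ[X]) = algebraMap ℚ[X] ℂ[X] Polynomial.X :=
        (Polynomial.map_X _).symm
      rw [this]
      exact isIntegral_algebraMap
  exact hisInt.isAlgebraic.exists_nonzero_dvd (mem_nonZeroDivisors_of_ne_zero hp0)

theorem isEModule_span {ι : Type} [Finite ι] (f : ι → ℚ⟦X⟧) (hf : ∀ i, Gr (f i)) (T : ℚ[X])
    (hT : T ≠ 0) (h : ∀ i, T • D (f i) ∈ Submodule.span ℚ[X] (Set.range f)) :
    IsEModule (Submodule.span ℚ[X] (Set.range f)) := by
  refine ⟨Submodule.fg_span (Set.finite_range f), fun g hg => ?_, T, hT, fun g hg => ?_⟩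
  · induction hg using Submodule.span_induction with
    | mem x hx => obtain ⟨i, rfl⟩ := hx; exact hf i
    | zero => simpa using gr_coe 0
    | add x y _ _ hx hy => exact hx.add hy
    | smul P x _ hx => exact hx.smul P
  · induction hg using Submodule.span_induction with
    | mem x hx => obtain ⟨i, rfl⟩ := hx; exact h i
    | zero => rw [D, map_zero, smul_zero]; exact zero_mem _
    | add x y _ _ hx hy => rw [D, map_add, smul_add]; exact add_mem hx hy
    | smul P x hxm hx =>
      have h1 : D (P • x) = Polynomial.derivative P • x + P • D x := by
        rw [smul_eq_coe_mul, D_mul, smul_eq_coe_mul, smul_eq_coe_mul]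
        congr 2
        exact iterate_D_coe 1 P
      rw [h1, smul_add, smul_comm T P]
      exact add_mem (Submodule.smul_mem _ _ (Submodule.smul_mem _ _ hxm))
        (Submodule.smul_mem _ _ hx)

/-- Components of polynomials are polynomials. -/
theorem exists_comp_coe (φ : ℂ →ₗ[ℚ] ℚ) (Q : ℂ[X]) :
    ∃ P : ℚ[X], comp φ (Q : ℂ⟦X⟧) = (P : ℚ⟦X⟧) := by
  refine ⟨∑ n ∈ Finset.range (Q.natDegree + 1), Polynomial.monomial n (φ (Q.coeff n)), ?_⟩
  ext n
  rw [coeff_comp, Polynomial.coeff_coe, Polynomial.coeff_coe, Polynomial.finsetSum_coeff]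
  simp_rw [Polynomial.coeff_monomial]
  rw [Finset.sum_ite_eq']
  split_ifs with hn
  · rfl
  · rw [Polynomial.coeff_eq_zero_of_natDegree_lt (by simpa using hn), map_zero]

theorem comp_iterate_psD (φ : ℂ →ₗ[ℚ] ℚ) (i : ℕ) (F : ℂ⟦X⟧) :
    comp φ (psD^[i] F) = D^[i] (comp φ F) := by
  induction i with
  | zero => rfl
  | succ i ih =>
    rw [Function.iterate_succ_apply', Function.iterate_succ_apply', psD_eq_derivative,
      comp_derivative, ih]

theorem iterate_psD_qc (i : ℕ) (f : ℚ⟦X⟧) : psD^[i] (qc f) = qc (D^[i] f) := by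
  induction i with
  | zero => rfl
  | succ i ih =>
    rw [Function.iterate_succ_apply', Function.iterate_succ_apply', ih, psD_eq_derivative,
      derivative_qc]

theorem iterate_psD_sum {ι : Type} [Fintype ι] (w : ι → ℂ) (f : ι → ℚ⟦X⟧) (i : ℕ) :
    psD^[i] (∑ l, PowerSeries.C (w l) * qc (f l)) =
      ∑ l, PowerSeries.C (w l) * qc (D^[i] (f l)) := by
  induction i with
  | zero => rfl
  | succ i ih =>
    rw [Function.iterate_succ_apply', ih, psD_eq_derivative, map_sum]
    refine Finset.sum_congr rfl fun l _ => ?_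
    rw [Function.iterate_succ_apply', Derivation.leibniz, derivative_qc, PowerSeries.derivative_C]
    simp

/-- The components of an `E`-function are `E`-functions. -/
theorem comp_ePS_mem_eAlg (K : Subfield ℂ) [FiniteDimensional ℚ K] (hK : ∀ x ∈ K, IsAlgebraic ℚ x)
    {ι : Type} [Fintype ι] (w : ι → ℂ) (φ : ι → ℂ →ₗ[ℚ] ℚ)
    (hφ : ∀ x ∈ K, x = ∑ l, w l * ((φ l x : ℚ) : ℂ)) {a : ℕ → ℂ} (ha : IsE a)
    (haK : ∀ n, a n ∈ K) (l : ι) : comp (φ l) (ePS a) ∈ eAlg := by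
  classical
  have hgr : ∀ l, Gr (comp (φ l) (ePS a)) := fun l => gr_comp_ePS K hK (φ l) ha haK
  obtain ⟨-, ⟨m₀, p, hp, ⟨i₀, hi₀, hpi₀⟩, hode⟩, -⟩ := ha
  obtain ⟨m, hpm, hmm⟩ : ∃ m, p m ≠ 0 ∧ ∑ i ∈ Finset.range (m + 1),
      polyPS (p i) * psD^[i] (ePS a) = 0 := by
    set s := (Finset.range (m₀ + 1)).filter fun i => p i ≠ 0 with hs
    have hsne : s.Nonempty := ⟨i₀, by simp [hs]; exact ⟨by omega, hpi₀⟩⟩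
    have hmax := s.max'_mem hsne
    simp only [hs, Finset.mem_filter, Finset.mem_range] at hmax
    refine ⟨s.max' hsne, hmax.2, ?_⟩
    rw [← hode]
    refine Finset.sum_subset (fun i hi => ?_) fun i hi hi' => ?_
    · have h1 := hmax.1
      have h2 := Finset.mem_range.mp hi
      exact Finset.mem_range.mpr (lt_of_lt_of_le h2 h1)
    · have : p i = 0 := by
        by_contra hne
        have h1 := s.le_max' i (by simp only [hs, Finset.mem_filter]; exact ⟨hi, hne⟩)
        exact hi' (Finset.mem_range.mpr (Nat.lt_succ_of_le h1))
      rw [this, map_zero, zero_mul]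
  obtain ⟨T, hT0, s, hTs⟩ := exists_dvd_map_of_isAlgebraic (hp m) hpm
  set F := ePS a with hF
  set f : ι → ℚ⟦X⟧ := fun l => comp (φ l) F with hf
  have hFf : F = ∑ l, PowerSeries.C (w l) * qc (f l) := by
    ext n
    rw [map_sum]
    have hmem : a n / (n.factorial : ℂ) ∈ K := div_mem (haK n) (natCast_mem K _)
    have h1 : PowerSeries.coeff n F = a n / (n.factorial : ℂ) := by
      rw [hF, ePS, PowerSeries.coeff_mk]
    rw [h1]
    refine (hφ _ hmem).trans (Finset.sum_congr rfl fun l _ => ?_)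
    rw [PowerSeries.coeff_C_mul, PowerSeries.coeff_map, coeff_comp, h1]
    rfl
  have hlead : ∀ j, (T : ℚ⟦X⟧) * D^[m] (f j) = - ∑ i ∈ Finset.range m, ∑ l,
      D^[i] (f l) * comp (φ j) ((s * p i * Polynomial.C (w l) : ℂ[X]) : ℂ⟦X⟧) := by
    intro j
    have h1 : qc (T : ℚ⟦X⟧) * psD^[m] F =
        - ∑ i ∈ Finset.range m, ((s * p i : ℂ[X]) : ℂ⟦X⟧) * psD^[i] F := by
      rw [Finset.sum_range_succ, add_comm] at hmm
      have h2 : qc (T : ℚ⟦X⟧) = (s : ℂ⟦X⟧) * polyPS (p m) := by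
        have h3 : qc (T : ℚ⟦X⟧) = ((T.map (algebraMap ℚ ℂ) : ℂ[X]) : ℂ⟦X⟧) :=
          (Polynomial.polynomial_map_coe (φ := algebraMap ℚ ℂ)).symm
        rw [h3, hTs, mul_comm, Polynomial.coe_mul]
        rfl
      rw [h2, mul_assoc, eq_neg_of_add_eq_zero_left hmm, mul_neg, Finset.mul_sum]
      congr 1
      refine Finset.sum_congr rfl fun i _ => ?_
      rw [Polynomial.coe_mul, mul_assoc]
      rfl
    have h4 := congrArg (comp (φ j)) h1
    rw [comp_qc_mul, comp_iterate_psD, map_neg, map_sum] at h4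
    rw [hf] at *
    refine h4.trans (congrArg Neg.neg (Finset.sum_congr rfl fun i _ => ?_))
    conv_lhs => rw [hFf]
    rw [iterate_psD_sum, Finset.mul_sum, map_sum]
    refine Finset.sum_congr rfl fun l _ => ?_
    rw [← comp_qc_mul, Polynomial.coe_mul _ (Polynomial.C (w l)), Polynomial.coe_C]
    congr 1
    ring
  by_cases hm0 : m = 0
  · have h1 := hlead l
    rw [hm0] at h1
    simp only [Finset.range_zero, Finset.sum_empty, neg_zero, Function.iterate_zero, id,
      mul_eq_zero, Polynomial.coe_eq_zero_iff] at h1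
    rw [show comp (φ l) F = f l from rfl, h1.resolve_left hT0]
    exact zero_mem _
  · refine ⟨Submodule.span ℚ[X] (Set.range fun x : Fin m × ι => D^[x.1] (f x.2)),
      isEModule_span _ (fun x => (hgr x.2).iterate_D _) T hT0 ?_,
      Submodule.subset_span ⟨(⟨0, by omega⟩, l), rfl⟩⟩
    have hmem : ∀ i, i < m → ∀ l,
        D^[i] (f l) ∈ Submodule.span ℚ[X] (Set.range fun x : Fin m × ι => D^[x.1] (f x.2)) :=
      fun i hi l => Submodule.subset_span ⟨(⟨i, hi⟩, l), rfl⟩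
    rintro ⟨⟨i, hi⟩, j⟩
    rw [← Function.iterate_succ_apply' D]
    rcases Nat.lt_or_ge (i + 1) m with h1 | h1
    · exact Submodule.smul_mem _ _ (hmem _ h1 j)
    · obtain rfl : m = i + 1 := by omega
      rw [smul_eq_coe_mul]
      change (T : ℚ⟦X⟧) * D^[i + 1] (f j) ∈ _
      rw [hlead]
      refine neg_mem (sum_mem fun i' hi' => sum_mem fun l₂ _ => ?_)
      obtain ⟨P, hP⟩ := exists_comp_coe (φ j) (s * p i' * Polynomial.C (w l₂))
      rw [hP, mul_comm, ← smul_eq_coe_mul]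
      exact Submodule.smul_mem _ _ (hmem i' (Finset.mem_range.mp hi') l₂)

/-- Membership in `eAlg` yields an `E`-function with rational coefficients. -/
theorem isE_of_mem_eAlg {g : ℚ⟦X⟧} (hg : g ∈ eAlg) :
    IsE fun n => (((n.factorial : ℚ) * PowerSeries.coeff n g : ℚ) : ℂ) := by
  have halg : ∀ q : ℚ, IsAlgebraic ℚ (q : ℂ) := fun q => isAlgebraic_algebraMap q
  refine ⟨fun n => halg _, ?_, ?_⟩
  · obtain ⟨M, hM, hgM⟩ := hg
    obtain ⟨m, p, hpm, hp⟩ := exists_ode hM hgM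
    have hePS : ePS (fun n => (((n.factorial : ℚ) * PowerSeries.coeff n g : ℚ) : ℂ)) = qc g := by
      ext n
      have hn : (n.factorial : ℂ) ≠ 0 := Nat.cast_ne_zero.mpr n.factorial_ne_zero
      rw [ePS, PowerSeries.coeff_mk, PowerSeries.coeff_map, Rat.cast_mul, Rat.cast_natCast,
        mul_div_cancel_left₀ _ hn]
      rfl
    refine ⟨m, fun i => (zq (p i)).map (algebraMap ℚ ℂ), fun i k => ?_, ⟨m, le_rfl, ?_⟩, ?_⟩
    · rw [Polynomial.coeff_map]
      exact isAlgebraic_algebraMap _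
    · rw [Ne, Polynomial.map_eq_zero]
      exact fun h => hpm (zq_injective (h.trans (map_zero zq).symm))
    · have h1 := congrArg qc hp
      rw [map_sum, map_zero] at h1
      rw [← h1, hePS]
      refine Finset.sum_congr rfl fun i _ => ?_
      rw [map_mul, iterate_psD_qc]
      congr 1
      exact Polynomial.polynomial_map_coe (φ := algebraMap ℚ ℂ)
  · obtain ⟨C, hC⟩ := gr_of_mem_eAlg hg
    have hC1 : 1 ≤ C := hC.pos
    obtain ⟨d, hd⟩ := hC
    have hC1' : (1 : ℝ) ≤ C := by exact_mod_cast hC1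
    have hpow : ∀ n, 1 ≤ n → (C : ℝ) ^ (n + 1) ≤ ((C : ℝ) ^ 2) ^ n := fun n hn => by
      rw [← pow_mul]
      exact pow_le_pow_right₀ hC1' (by omega)
    refine ⟨(C : ℝ) ^ 2, by positivity, d, fun n hn => ?_⟩
    obtain ⟨hd0, hdC, habs, hisInt⟩ := hd n
    refine ⟨hd0, le_trans (by exact_mod_cast hdC) (hpow n hn), fun σ h => ?_, fun i _ hi => ?_⟩
    · set q : ℚ := (n.factorial : ℚ) * PowerSeries.coeff n g with hq
      have h1 : (⟨(q : ℂ), h⟩ : integralClosure ℚ ℂ) = algebraMap ℚ (integralClosure ℚ ℂ) q :=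
        Subtype.ext rfl
      have h2 : σ (algebraMap ℚ (integralClosure ℚ ℂ) q) = (q : ℂ) :=
        RingHom.congr_fun (RingHom.ext_rat (σ.comp (algebraMap ℚ (integralClosure ℚ ℂ)))
          (algebraMap ℚ ℂ)) q
      rw [h1, h2]
      refine le_trans ?_ (hpow n hn)
      rw [show (q : ℂ) = ((q : ℝ) : ℂ) by norm_cast, Complex.norm_real, Real.norm_eq_abs]
      exact_mod_cast habs
    · obtain ⟨z, hz⟩ := hisInt i hi
      have h1 : (d n : ℂ) * (((i.factorial : ℚ) * PowerSeries.coeff i g : ℚ) : ℂ) =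
          algebraMap ℤ ℂ z := by
        rw [eq_intCast]
        exact_mod_cast congrArg (Rat.cast : ℚ → ℂ) hz
      rw [h1]
      exact isIntegral_algebraMap

/-- Decomposition of the value of an `E`-function along a generating family. -/
theorem evalE_eq_sum (K : Subfield ℂ) {ι : Type} [Fintype ι] (w : ι → ℂ) (φ : ι → ℂ →ₗ[ℚ] ℚ)
    (hφ : ∀ x ∈ K, x = ∑ l, w l * ((φ l x : ℚ) : ℂ)) {a : ℕ → ℂ} (haK : ∀ n, a n ∈ K)
    (hgr : ∀ l, comp (φ l) (ePS a) ∈ eAlg) :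
    evalE a 1 = ∑ l, w l * evz (comp (φ l) (ePS a)) 1 := by
  have hs : ∀ l, Summable fun n =>
      ((PowerSeries.coeff n (comp (φ l) (ePS a)) : ℚ) : ℂ) * (1 : ℂ) ^ n :=
    fun l => ((gr_of_mem_eAlg (hgr l)).summable 1).of_norm
  simp only [evz, ← tsum_mul_left]
  rw [← Summable.tsum_finsetSum fun l _ => (hs l).mul_left (w l), evalE]
  refine tsum_congr fun n => ?_
  have hmem : a n / (n.factorial : ℂ) ∈ K := div_mem (haK n) (natCast_mem K _)
  simp only [one_pow, mul_one]
  refine (hφ _ hmem).trans (Finset.sum_congr rfl fun l _ => ?_)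
  rw [coeff_comp, ePS, PowerSeries.coeff_mk]

/-- The values at `1` of `E`-functions with rational coefficients are the values of `eAlg`. -/
theorem mem_Eset_rat_iff {x : ℂ} :
    x ∈ Eset (Set.range ((↑) : ℚ → ℂ)) ↔ ∃ g ∈ eAlg, x = evz g 1 := by
  constructor
  · rintro ⟨a, ha, haQ, rfl⟩
    let K : Subfield ℂ := (algebraMap ℚ ℂ).fieldRange
    have haK : ∀ n, a n ∈ K := haQ
    have hK : ∀ x ∈ K, IsAlgebraic ℚ x := by
      rintro _ ⟨q, rfl⟩
      exact isAlgebraic_algebraMap q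
    have : FiniteDimensional ℚ K := Module.Finite.of_surjective (Algebra.linearMap ℚ K) (by
      rintro ⟨_, q, rfl⟩
      exact ⟨q, Subtype.ext rfl⟩)
    obtain ⟨φ, hφ⟩ := LinearMap.exists_leftInverse_of_injective (Algebra.linearMap ℚ ℂ)
      (LinearMap.ker_eq_bot.mpr (algebraMap ℚ ℂ).injective)
    have hexp : ∀ x ∈ K, x = ∑ _l : Unit, (1 : ℂ) * ((φ x : ℚ) : ℂ) := by
      rintro _ ⟨q, rfl⟩
      have h1 : φ (algebraMap ℚ ℂ q) = q := LinearMap.congr_fun hφ q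
      rw [h1]
      simp
    have hmem := comp_ePS_mem_eAlg K hK (fun _ : Unit => (1 : ℂ)) (fun _ => φ) hexp ha haK
    refine ⟨comp φ (ePS a), hmem (), ?_⟩
    rw [evalE_eq_sum K (fun _ : Unit => (1 : ℂ)) (fun _ => φ) hexp haK hmem]
    simp
  · rintro ⟨g, hg, rfl⟩
    refine ⟨_, isE_of_mem_eAlg hg, fun n => ⟨_, rfl⟩, tsum_congr fun n => ?_⟩
    beta_reduce
    rw [Rat.cast_mul, Rat.cast_natCast,
      mul_div_cancel_left₀ _ (Nat.cast_ne_zero.mpr n.factorial_ne_zero)]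

end EFun

/-- If `K` is a number field and `w₁, …, w_d` is a basis of `K` as a
`ℚ`-vector space, then `E_K = w₁ E_ℚ ⊕ ⋯ ⊕ w_d E_ℚ`: every `ξ ∈ E_K` is uniquely
`ξ = w₁ ξ₁ + ⋯ + w_d ξ_d` with `ξ₁, …, ξ_d ∈ E_ℚ`. -/
theorem E_field_decomposition
    (K : Subfield ℂ) [FiniteDimensional ℚ K] (hKalg : ∀ x ∈ K, IsAlgebraic ℚ x)
    (d : ℕ) (w : Fin d → ℂ) (hwK : ∀ i, w i ∈ K)
    (hbasis : ∀ x ∈ K, ∃! c : Fin d → ℚ, x = ∑ i, (c i : ℂ) * w i)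
    (ξ : ℂ) (hξ : ξ ∈ Eset (K : Set ℂ)) :
    ∃! c : Fin d → ℂ,
      (∀ i, c i ∈ Eset (Set.range ((↑) : ℚ → ℂ))) ∧ ξ = ∑ i, w i * c i := by
  have hli : LinearIndependent ℚ w := by
    refine Fintype.linearIndependent_iff.mpr fun c hc i => ?_
    have hc' : (0 : ℂ) = ∑ i, (c i : ℂ) * w i := by
      rw [← hc]
      exact Finset.sum_congr rfl fun i _ => Algebra.smul_def _ _
    exact congrFun ((hbasis 0 K.zero_mem).unique hc' (by simp : (0 : ℂ) =
      ∑ i, (((0 : Fin d → ℚ) i : ℚ) : ℂ) * w i)) i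
  obtain ⟨φ, hφ⟩ := EFun.exists_dual_family w hli
  have hexp : ∀ x ∈ K, x = ∑ l, w l * ((φ l x : ℚ) : ℂ) := by
    intro x hx
    obtain ⟨c, hc, -⟩ := hbasis x hx
    have h1 : ∀ l, φ l x = c l := fun l => by
      have h2 : x = ∑ i, c i • w i :=
        hc.trans (Finset.sum_congr rfl fun i _ => (Algebra.smul_def (c i) (w i)).symm)
      rw [h2, map_sum]
      simp [hφ]
    simp only [h1]
    exact hc.trans (Finset.sum_congr rfl fun i _ => mul_comm _ _)
  obtain ⟨a, ha, haK, rfl⟩ := hξ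
  have hmem := EFun.comp_ePS_mem_eAlg K hKalg w φ hexp ha haK
  have hsum := EFun.evalE_eq_sum K w φ hexp haK hmem
  refine ⟨fun i => EFun.evz (EFun.comp (φ i) (ePS a)) 1,
    ⟨fun i => EFun.mem_Eset_rat_iff.mpr ⟨_, hmem i, rfl⟩, hsum⟩, ?_⟩
  rintro c ⟨hc, hcs⟩
  choose g hg hcg using fun i => EFun.mem_Eset_rat_iff.mp (hc i)
  have hadd : ∀ i, c i = EFun.evz (g i - EFun.comp (φ i) (ePS a)) 1 +
      EFun.evz (EFun.comp (φ i) (ePS a)) 1 := fun i => by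
    rw [← EFun.evz_add (EFun.gr_of_mem_eAlg (sub_mem (hg i) (hmem i)))
      (EFun.gr_of_mem_eAlg (hmem i)), sub_add_cancel, hcg]
  have hzero := EFun.evz_eq_zero_of_sum_mul_eq_zero w (fun i => hKalg _ (hwK i)) hli
    (fun i => g i - EFun.comp (φ i) (ePS a)) (fun i => sub_mem (hg i) (hmem i)) (by
      have h1 := hcs.symm.trans hsum
      simp only [hadd, mul_add, Finset.sum_add_distrib] at h1
      exact left_eq_add.mp (by rw [add_comm]; exact h1.symm))
  funext i
  rw [hadd i, hzero i, zero_add]
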